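/- Let R > 0, q > 0, λ ∈ ((3/10)·π²/R², π²/R²), and define the energy F(u, φ) = (1/2)∫_{B_R}|∇u|² − (λ/2)∫_{B_R}u² − (q/5)∫_{B_R}|u|⁵φ + (1/10)∫_{B_R}|∇φ|². Then there exists a classical solution (u, φ) of problem (P) with u > 0 and φ > 0 in B_R which is a ground state: F(u, φ) ≤ F(v, ψ) for every nontrivial classical solution (v, ψ) of problem (P). -/

import Mathlib

open Metric Real Set

noncomputable section


/-- Euclidean 3-space. -/
abbrev E3 := EuclideanSpace ℝ (Fin 3)

/-- The Laplace operator on functions `ℝ³ → ℝ`. -/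
def lap (f : E3 → ℝ) (x : E3) : ℝ :=
  ∑ i : Fin 3, fderiv ℝ (fun y => fderiv ℝ f y (EuclideanSpace.single i 1)) x
    (EuclideanSpace.single i 1)

/-- `(u, φ)` is a classical solution of problem (P) on the ball `B_R`. -/
def IsSolP (R q lam : ℝ) (u φ : E3 → ℝ) : Prop :=
  ContDiffOn ℝ 2 u (ball 0 R) ∧ ContDiffOn ℝ 2 φ (ball 0 R) ∧
  ContinuousOn u (closedBall 0 R) ∧ ContinuousOn φ (closedBall 0 R) ∧
  (∀ x ∈ ball (0:E3) R, -lap u x = lam * u x + q * |u x| ^ 3 * u x * φ x) ∧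
  (∀ x ∈ ball (0:E3) R, -lap φ x = q * |u x| ^ 5) ∧
  (∀ x ∈ sphere (0:E3) R, u x = 0) ∧ (∀ x ∈ sphere (0:E3) R, φ x = 0)

/-- The energy functional
`F(u, φ) = ½∫|∇u|² − (λ/2)∫u² − (q/5)∫|u|⁵φ + (1/10)∫|∇φ|²` over `B_R`. -/
def energyF (R q lam : ℝ) (u φ : E3 → ℝ) : ℝ :=
  (1 / 2) * (∫ x in ball (0:E3) R, ‖gradient u x‖ ^ 2)
    - lam / 2 * (∫ x in ball (0:E3) R, (u x) ^ 2)
    - q / 5 * (∫ x in ball (0:E3) R, |u x| ^ 5 * φ x)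
    + (1 / 10) * (∫ x in ball (0:E3) R, ‖gradient φ x‖ ^ 2)

section
open MeasureTheory Filter Topology

lemma AbsolutelyContinuousOnInterval.congr_on {f g : ℝ → ℝ} {a b : ℝ}
    (hf : AbsolutelyContinuousOnInterval f a b) (h : EqOn f g (uIcc a b)) :
    AbsolutelyContinuousOnInterval g a b := by
  rw [absolutelyContinuousOnInterval_iff] at *
  intro ε hε
  obtain ⟨δ, hδ, H⟩ := hf ε hε
  refine ⟨δ, hδ, fun E hE hs => ?_⟩
  have := H E hE hs
  refine lt_of_eq_of_lt (Finset.sum_congr rfl fun i hi => ?_) this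
  rw [h (hE.1 i hi).1, h (hE.1 i hi).2]

lemma AbsolutelyContinuousOnInterval.lipschitz_comp {f F : ℝ → ℝ} {a b : ℝ} {K : NNReal}
    (hf : AbsolutelyContinuousOnInterval f a b) (hF : LipschitzWith K F) :
    AbsolutelyContinuousOnInterval (fun x => F (f x)) a b := by
  rw [absolutelyContinuousOnInterval_iff] at *
  intro ε hε
  obtain ⟨δ, hδ, H⟩ := hf (ε / (K + 1)) (by positivity)
  refine ⟨δ, hδ, fun E hE hs => ?_⟩
  have := H E hE hs
  calc _ ≤ ∑ i ∈ Finset.range E.1, (K : ℝ) * dist (f (E.2 i).1) (f (E.2 i).2) :=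
        Finset.sum_le_sum fun i _ => hF.dist_le_mul _ _
    _ = K * ∑ i ∈ Finset.range E.1, dist (f (E.2 i).1) (f (E.2 i).2) := by
        rw [Finset.mul_sum]
    _ ≤ K * (ε / (K + 1)) := by gcongr
    _ < (K + 1) * (ε / (K + 1)) := by gcongr; linarith
    _ = ε := by field

/-- `w` is the primitive, vanishing at `0` and at `R`, of a square-integrable function `g`. -/
structure Adm (R : ℝ) (w g : ℝ → ℝ) : Prop where
  int : IntervalIntegrable g volume 0 R
  sq : IntervalIntegrable (fun r => g r ^ 2) volume 0 R
  eq : ∀ r ∈ Icc 0 R, w r = ∫ t in (0 : ℝ)..r, g t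
  zero : w R = 0

namespace Adm

variable {R : ℝ} {w g : ℝ → ℝ}

lemma ac (hR : 0 ≤ R) (h : Adm R w g) : AbsolutelyContinuousOnInterval w 0 R :=
  (h.int.absolutelyContinuousOnInterval_intervalIntegral (c := 0) (by simp)).congr_on
    fun r hr => (h.eq r (by rwa [uIcc_of_le hR] at hr)).symm

lemma cont (hR : 0 ≤ R) (h : Adm R w g) : ContinuousOn w (Icc 0 R) := by
  have := (h.ac hR).continuousOn
  rwa [uIcc_of_le hR] at this

lemma left (hR : 0 ≤ R) (h : Adm R w g) : w 0 = 0 := by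
  rw [h.eq 0 ⟨le_rfl, hR⟩]; simp

lemma ae_hasDerivAt (h : Adm R w g) : ∀ᵐ r, r ∈ Ioo 0 R → HasDerivAt w (g r) r := by
  filter_upwards [h.int.ae_hasDerivAt_integral] with r hr hrR
  have hR : 0 ≤ R := hrR.1.le.trans hrR.2.le
  have := hr (by rw [uIcc_of_le hR]; exact Ioo_subset_Icc_self hrR) 0 (by simp)
  refine this.congr_of_eventuallyEq ?_
  filter_upwards [Ioo_mem_nhds hrR.1 hrR.2] with s hs using h.eq s (Ioo_subset_Icc_self hs)

lemma int_sub (h : Adm R w g) {a b : ℝ} (ha : a ∈ Icc 0 R) (hb : b ∈ Icc 0 R) :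
    IntervalIntegrable g volume a b := by
  have hR : 0 ≤ R := ha.1.trans ha.2
  exact h.int.mono_set (by rw [uIcc_of_le hR]; exact uIcc_subset_Icc ha hb)

lemma sq_sub (h : Adm R w g) {a b : ℝ} (ha : a ∈ Icc 0 R) (hb : b ∈ Icc 0 R) :
    IntervalIntegrable (fun r => g r ^ 2) volume a b := by
  have hR : 0 ≤ R := ha.1.trans ha.2
  exact h.sq.mono_set (by rw [uIcc_of_le hR]; exact uIcc_subset_Icc ha hb)

lemma sq_le (h : Adm R w g) {r : ℝ} (hr : r ∈ Icc 0 R) :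
    w r ^ 2 ≤ r * ∫ t in (0 : ℝ)..r, g t ^ 2 := by
  have hR : 0 ≤ R := hr.1.trans hr.2
  rcases hr.1.eq_or_lt with h0 | h0
  · subst h0; simp [h.left hR]
  have h0' : (0 : ℝ) ∈ Icc 0 R := ⟨le_rfl, hR⟩
  have i1 := h.int_sub h0' hr
  have i2 := h.sq_sub h0' hr
  set c := w r / r
  have : 0 ≤ ∫ t in (0 : ℝ)..r, (g t - c) ^ 2 :=
    intervalIntegral.integral_nonneg hr.1 fun t _ => sq_nonneg _
  have e : ∫ t in (0 : ℝ)..r, (g t - c) ^ 2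
      = (∫ t in (0 : ℝ)..r, g t ^ 2) - 2 * c * (∫ t in (0 : ℝ)..r, g t) + c ^ 2 * r := by
    have : ∀ t, (g t - c) ^ 2 = g t ^ 2 - 2 * c * g t + c ^ 2 := fun t => by ring
    simp_rw [this]
    rw [intervalIntegral.integral_add (i2.sub (i1.const_mul _)) (by simp),
      intervalIntegral.integral_sub i2 (i1.const_mul _), intervalIntegral.integral_const_mul]
    simp [mul_comm]
  rw [e, ← h.eq r hr] at this
  have hc : w r = c * r := by simp [c, h0.ne']
  rw [hc] at this ⊢
  nlinarith

lemma energy_mono (h : Adm R w g) {r : ℝ} (hr : r ∈ Icc 0 R) :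
    ∫ t in (0 : ℝ)..r, g t ^ 2 ≤ ∫ t in (0 : ℝ)..R, g t ^ 2 := by
  have hR : 0 ≤ R := hr.1.trans hr.2
  refine intervalIntegral.integral_mono_interval le_rfl hr.1 hr.2 ?_ h.sq
  exact Eventually.of_forall fun t => sq_nonneg _

lemma energy_nonneg (hR : 0 ≤ R) : 0 ≤ ∫ t in (0 : ℝ)..R, g t ^ 2 :=
  intervalIntegral.integral_nonneg hR fun _ _ => sq_nonneg _

lemma sq_le' (h : Adm R w g) {r : ℝ} (hr : r ∈ Icc 0 R) :
    w r ^ 2 ≤ r * ∫ t in (0 : ℝ)..R, g t ^ 2 :=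
  (h.sq_le hr).trans (mul_le_mul_of_nonneg_left (h.energy_mono hr) hr.1)

/-- The energy near the origin is small, so `w = o(r^{1/2})`. -/
lemma sq_div_tendsto (hR : 0 < R) (h : Adm R w g) :
    Tendsto (fun r => w r ^ 2 / r) (𝓝[>] 0) (𝓝 0) := by
  have c : ContinuousOn (fun r => ∫ t in (0 : ℝ)..r, g t ^ 2) (Icc 0 R) := by
    have := intervalIntegral.continuousOn_primitive_interval' h.sq (a := 0) (by simp)
    rwa [uIcc_of_le hR.le] at this
  have hmem : Icc 0 R ∈ 𝓝[>] (0 : ℝ) := by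
    filter_upwards [Ioo_mem_nhdsGT hR] with r hr using Ioo_subset_Icc_self hr
  have t : Tendsto (fun r => ∫ t in (0 : ℝ)..r, g t ^ 2) (𝓝[>] 0) (𝓝 0) := by
    have h1 : Tendsto (fun r => ∫ t in (0 : ℝ)..r, g t ^ 2) (𝓝[Icc 0 R] 0)
        (𝓝 (∫ t in (0 : ℝ)..0, g t ^ 2)) := c 0 ⟨le_rfl, hR.le⟩
    rw [intervalIntegral.integral_same] at h1
    exact h1.mono_left (nhdsWithin_le_of_mem hmem)
  refine squeeze_zero' ?_ ?_ t
  · filter_upwards [self_mem_nhdsWithin] with r hr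
    exact div_nonneg (sq_nonneg _) (le_of_lt hr)
  · filter_upwards [Ioo_mem_nhdsGT hR] with r hr
    rw [div_le_iff₀ hr.1, mul_comm]
    exact h.sq_le (Ioo_subset_Icc_self hr)

lemma of_lipschitz (hR : 0 ≤ R) {K : NNReal} (hw : LipschitzOnWith K w (Icc 0 R)) (h0 : w 0 = 0)
    (hwR : w R = 0) (hm : Measurable g) (hg : ∀ r ∈ Ioo 0 R, deriv w r = g r) : Adm R w g := by
  have ac : AbsolutelyContinuousOnInterval w 0 R := by
    apply LipschitzOnWith.absolutelyContinuousOnInterval (K := K); rwa [uIcc_of_le hR]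
  have bd : ∀ r ∈ Ioo 0 R, ‖g r‖ ≤ K := by
    intro r hr
    rw [← hg r hr]
    exact norm_deriv_le_of_lipschitzOn (Icc_mem_nhds hr.1 hr.2) hw
  have bi : ∀ f : ℝ → ℝ, Measurable f → ∀ C : ℝ, (∀ r ∈ Ioo 0 R, ‖f r‖ ≤ C) →
      IntervalIntegrable f volume 0 R := by
    intro f hf C hC
    rw [intervalIntegrable_iff_integrableOn_Ioo_of_le hR]
    exact Measure.integrableOn_of_bounded (M := C) (by simp) hf.aestronglyMeasurable
      ((ae_restrict_iff' measurableSet_Ioo).2 (Eventually.of_forall hC))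
  have s1 : IntervalIntegrable g volume 0 R := bi g hm (K : ℝ) bd
  have s2 : IntervalIntegrable (fun r => g r ^ 2) volume 0 R := by
    refine bi _ (hm.pow_const 2) ((K : ℝ) ^ 2) ?_
    intro r hr
    rw [norm_pow]
    exact pow_le_pow_left₀ (norm_nonneg _) (bd r hr) 2
  refine ⟨s1, s2, ?_, hwR⟩
  · intro r hr
    have := (ac.mono (c := 0) (d := r) (by
      rw [uIcc_of_le hR, uIcc_of_le hr.1]; exact Icc_subset_Icc_right hr.2)).integral_deriv_eq_sub
    rw [h0, sub_zero] at this
    rw [← this]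
    rw [intervalIntegral.integral_of_le hr.1, intervalIntegral.integral_of_le hr.1,
      integral_Ioc_eq_integral_Ioo, integral_Ioc_eq_integral_Ioo]
    exact setIntegral_congr_fun measurableSet_Ioo fun s hs => hg s ⟨hs.1, hs.2.trans_le hr.2⟩

end Adm

lemma AbsolutelyContinuousOnInterval.ftc {F f : ℝ → ℝ} {a b : ℝ} (hab : a ≤ b)
    (hF : AbsolutelyContinuousOnInterval F a b)
    (hd : ∀ᵐ r, r ∈ Ioo a b → HasDerivAt F (f r) r) :
    IntervalIntegrable f volume a b ∧ ∫ t in a..b, f t = F b - F a := by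
  have e : ∀ᵐ r, r ∈ Ioc a b → deriv F r = f r := by
    filter_upwards [hd, (by simp [ae_iff] : ∀ᵐ r : ℝ, r ≠ b)] with r hr hb hm
    exact (hr ⟨hm.1, lt_of_le_of_ne hm.2 hb⟩).deriv
  have i := hF.intervalIntegrable_deriv
  refine ⟨i.congr_ae ?_, ?_⟩
  · rw [uIoc_of_le hab]; exact (ae_restrict_iff' measurableSet_Ioc).2 e
  · rw [← hF.integral_deriv_eq_sub]
    refine intervalIntegral.integral_congr_ae ?_
    rw [uIoc_of_le hab]
    filter_upwards [e] with r hr hm using (hr hm).symm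

namespace Adm

variable {R : ℝ} {w g v k : ℝ → ℝ}

lemma add (hw : Adm R w g) (hv : Adm R v k) : Adm R (fun r => w r + v r) (fun r => g r + k r) := by
  have hgk : IntervalIntegrable (fun r => g r * k r) volume 0 R := by
    refine (((hw.sq.add hv.sq).const_mul 1)).mono_fun
      ((intervalIntegrable_iff.1 hw.int).aestronglyMeasurable.mul
        (intervalIntegrable_iff.1 hv.int).aestronglyMeasurable) ?_
    ·
      refine Eventually.of_forall fun r => ?_
      simp only [Real.norm_eq_abs, one_mul]
      rw [abs_of_nonneg (by positivity : 0 ≤ g r ^ 2 + k r ^ 2), abs_le]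
      constructor <;> nlinarith [sq_nonneg (g r + k r), sq_nonneg (g r - k r)]
  refine ⟨hw.int.add hv.int, ?_, fun r hr => ?_, by simp [hw.zero, hv.zero]⟩
  · have := (hw.sq.add (hgk.const_mul 2)).add hv.sq
    refine this.congr (fun r _ => ?_)
    ring
  · have hR : 0 ≤ R := hr.1.trans hr.2
    rw [intervalIntegral.integral_add (hw.int_sub ⟨le_rfl, hR⟩ hr) (hv.int_sub ⟨le_rfl, hR⟩ hr),
      hw.eq r hr, hv.eq r hr]

lemma mul_int (hw : Adm R w g) (hv : Adm R v k) :
    IntervalIntegrable (fun r => g r * k r) volume 0 R := by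
  have := (((hw.add hv).sq.sub hw.sq).sub hv.sq).const_mul (1 / 2)
  refine this.congr (fun r _ => ?_)
  ring

lemma smul (c : ℝ) (hw : Adm R w g) : Adm R (fun r => c * w r) (fun r => c * g r) := by
  refine ⟨hw.int.const_mul c, ?_, fun r hr => ?_, by simp [hw.zero]⟩
  · refine (hw.sq.const_mul (c ^ 2)).congr fun r _ => ?_
    ring
  · rw [intervalIntegral.integral_const_mul, hw.eq r hr]

lemma sq_int_w (hR : 0 ≤ R) (hw : Adm R w g) :
    IntervalIntegrable (fun r => w r ^ 2) volume 0 R :=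
  ContinuousOn.intervalIntegrable (by rw [uIcc_of_le hR]; exact (hw.cont hR).pow 2)

/-- One-dimensional Poincaré inequality with the sharp constant. -/
lemma poincare (hR : 0 < R) (hw : Adm R w g) {μ : ℝ} (h0 : 0 < μ) (h1 : μ < π ^ 2 / R ^ 2) :
    μ * ∫ r in (0 : ℝ)..R, w r ^ 2 ≤ ∫ r in (0 : ℝ)..R, g r ^ 2 := by
  set m := √μ with hm
  have hm0 : 0 < m := Real.sqrt_pos.2 h0
  have hm2 : m ^ 2 = μ := Real.sq_sqrt h0.le
  have hmR : m * R < π := by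
    have : (m * R) ^ 2 < π ^ 2 := by
      rw [mul_pow, hm2]; rwa [lt_div_iff₀ (by positivity)] at h1
    exact lt_of_pow_lt_pow_left₀ 2 pi_pos.le this
  set δ := (π - m * R) / 2 with hδ
  set s := fun r : ℝ => Real.sin (m * r + δ) with hs
  have spos : ∀ r ∈ Icc 0 R, 0 < s r := by
    intro r hr
    have : m * r ≤ m * R := by gcongr; exact hr.2
    have : 0 ≤ m * r := mul_nonneg hm0.le hr.1
    exact sin_pos_of_pos_of_lt_pi (by rw [hδ]; linarith) (by rw [hδ]; linarith)
  set c := fun r : ℝ => m * Real.cos (m * r + δ) / Real.sin (m * r + δ) with hc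
  have cder : ∀ r ∈ Icc 0 R, HasDerivAt c (-μ - c r ^ 2) r := by
    intro r hr
    have hl : HasDerivAt (fun r : ℝ => m * r + δ) m r := by
      simpa using ((hasDerivAt_id r).const_mul m).add_const δ
    have := ((hl.cos.const_mul m).div hl.sin (spos r hr).ne')
    refine this.congr_deriv ?_
    have h2 : Real.sin (m * r + δ) ≠ 0 := (spos r hr).ne'
    rw [← hm2]
    simp only [hc]
    field_simp
  have ccont : ContinuousOn c (Icc 0 R) := fun r hr => (cder r hr).continuousAt.continuousWithinAt
  have cac : AbsolutelyContinuousOnInterval c 0 R := by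
    apply ContDiffOn.absolutelyContinuousOnInterval
    rw [uIcc_of_le hR.le]
    refine ContDiffOn.div ?_ ?_ fun r hr => (spos r hr).ne'
    · exact (contDiff_const.mul (Real.contDiff_cos.comp
        ((contDiff_const.mul contDiff_id).add contDiff_const))).contDiffOn
    · exact (Real.contDiff_sin.comp
        ((contDiff_const.mul contDiff_id).add contDiff_const)).contDiffOn
  obtain ⟨i, e⟩ := AbsolutelyContinuousOnInterval.ftc (f := fun r => (g r * w r + w r * g r) * c r
      + w r * w r * (-μ - c r ^ 2)) hR.le (((hw.ac hR.le).fun_mul (hw.ac hR.le)).fun_mul cac)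
    (by filter_upwards [hw.ae_hasDerivAt] with r hr hm
        exact ((hr hm).mul (hr hm)).mul (cder r (Ioo_subset_Icc_self hm)))
  rw [hw.zero, hw.left hR.le] at e
  have key : 0 ≤ ∫ r in (0 : ℝ)..R, (g r - w r * c r) ^ 2 :=
    intervalIntegral.integral_nonneg hR.le fun _ _ => sq_nonneg _
  have : ∀ r, (g r - w r * c r) ^ 2 = g r ^ 2 - μ * w r ^ 2 - ((g r * w r + w r * g r) * c r
      + w r * w r * (-μ - c r ^ 2)) := fun r => by ring
  simp_rw [this] at key
  rw [intervalIntegral.integral_sub (hw.sq.sub ((hw.sq_int_w hR.le).const_mul μ)) i,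
    intervalIntegral.integral_sub hw.sq ((hw.sq_int_w hR.le).const_mul μ), e,
    intervalIntegral.integral_const_mul] at key
  linarith

end Adm

/-- The best constant in the radial Sobolev (Bliss) inequality. -/
def Sstar : ℝ := 256 / (27 * π ^ 2)

lemma Sstar_pos : 0 < Sstar := by unfold Sstar; positivity

/-- Primitive of `½√(1 - (τ/A)²)`, the calibration for the Bliss inequality. -/
def blissK (A Y : ℝ) : ℝ := ∫ τ in (0 : ℝ)..Y, 1 / 2 * √(1 - (τ / A) ^ 2)

lemma blissK_hasDerivAt (A Y : ℝ) :
    HasDerivAt (blissK A) (1 / 2 * √(1 - (Y / A) ^ 2)) Y := by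
  have c : Continuous fun τ : ℝ => 1 / 2 * √(1 - (τ / A) ^ 2) := by fun_prop
  exact intervalIntegral.integral_hasDerivAt_right (c.intervalIntegrable _ _)
    (c.stronglyMeasurableAtFilter _ _) c.continuousAt

lemma blissK_lipschitz (A : ℝ) : LipschitzWith (1 / 2) (blissK A) := by
  refine lipschitzWith_of_nnnorm_deriv_le (fun Y => (blissK_hasDerivAt A Y).differentiableAt) ?_
  intro Y
  rw [(blissK_hasDerivAt A Y).deriv, ← NNReal.coe_le_coe]
  simp only [coe_nnnorm, norm_mul, Real.norm_eq_abs]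
  have h : √(1 - (Y / A) ^ 2) ≤ 1 := Real.sqrt_le_one.2 (by nlinarith [sq_nonneg (Y / A)])
  rw [abs_of_nonneg (Real.sqrt_nonneg _)]
  norm_num
  nlinarith [h]

lemma blissK_zero (A : ℝ) : blissK A 0 = 0 := by simp [blissK]

lemma blissK_self {A : ℝ} (hA : 0 < A) : blissK A A = A * π / 8 := by
  have h1 : ∫ x in (0 : ℝ)..1, √(1 - x ^ 2) = π / 4 := by
    have h := integral_sqrt_one_sub_sq
    have c : Continuous fun x : ℝ => √(1 - x ^ 2) := by fun_prop
    rw [← intervalIntegral.integral_add_adjacent_intervals (b := 0) (c.intervalIntegrable _ _)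
      (c.intervalIntegrable _ _)] at h
    have h2 : ∫ x in (-1 : ℝ)..0, √(1 - x ^ 2) = ∫ x in (0 : ℝ)..1, √(1 - x ^ 2) := by
      have := intervalIntegral.integral_comp_neg (a := 0) (b := 1) fun x : ℝ => √(1 - x ^ 2)
      simp only [neg_sq, neg_zero] at this
      exact this.symm
    rw [h2] at h; linarith
  unfold blissK
  rw [intervalIntegral.integral_const_mul]
  have := intervalIntegral.integral_comp_div (a := 0) (b := A) (fun x : ℝ => √(1 - x ^ 2)) hA.ne'
  rw [this, zero_div, div_self hA.ne', h1, smul_eq_mul]; ring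

namespace Adm

variable {R : ℝ} {w g v k : ℝ → ℝ}

lemma bliss_piece (hw : Adm R w g) {A : ℝ} (hA : 0 < A) (hY : ∀ r ∈ Icc 0 R, w r ^ 2 / r ≤ A)
    {a b σ : ℝ} (ha : 0 < a) (hab : a ≤ b) (hb : b ≤ R) (hσ : σ ^ 2 = 1) :
    (w b ^ 2 / b / 2 + σ * blissK A (w b ^ 2 / b)) - (w a ^ 2 / a / 2 + σ * blissK A (w a ^ 2 / a))
      + 1 / (4 * A ^ 2) * ∫ r in a..b, w r ^ 6 / r ^ 4 ≤ ∫ r in a..b, g r ^ 2 := by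
  have hR : 0 ≤ R := by linarith
  have sub : Icc a b ⊆ Icc 0 R := Icc_subset_Icc ha.le hb
  have wac : AbsolutelyContinuousOnInterval w a b := (hw.ac hR).mono (by
    rw [uIcc_of_le hR, uIcc_of_le hab]; exact sub)
  have inv : AbsolutelyContinuousOnInterval (fun r : ℝ => r⁻¹) a b := by
    apply ContDiffOn.absolutelyContinuousOnInterval
    rw [uIcc_of_le hab]
    exact contDiffOn_id.inv fun r hr => (ha.trans_le hr.1).ne'
  have Yac := (wac.fun_mul wac).fun_mul inv
  have Fac := (Yac.const_mul (1 / 2)).add ((Yac.lipschitz_comp (blissK_lipschitz A)).const_mul σ)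
  set Y := fun r => w r * w r * r⁻¹ with hYd
  have Yeq : ∀ r, w r ^ 2 / r = Y r := fun r => by simp only [hYd]; ring
  set Y' := fun r => (g r * w r + w r * g r) * r⁻¹ + w r * w r * (-(r ^ 2)⁻¹) with hY'
  obtain ⟨i, e⟩ := Fac.ftc (f := fun r => 1 / 2 * Y' r
      + σ * (1 / 2 * √(1 - (Y r / A) ^ 2) * Y' r)) hab (by
    filter_upwards [hw.ae_hasDerivAt] with r hr hm
    have hm' : r ∈ Ioo 0 R := ⟨ha.trans hm.1, hm.2.trans_le hb⟩
    have dY : HasDerivAt Y (Y' r) r :=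
      ((hr hm').mul (hr hm')).mul (hasDerivAt_inv (ha.trans hm.1).ne')
    exact (dY.const_mul (1 / 2)).add (((blissK_hasDerivAt A (Y r)).comp r dY).const_mul σ))
  simp only [Pi.add_apply] at e
  have c6 : ContinuousOn (fun r => w r ^ 6 / r ^ 4) (Icc a b) :=
    (((hw.cont hR).mono sub).pow 6).div (continuousOn_id.pow 4) fun r hr =>
      pow_ne_zero _ (ha.trans_le hr.1).ne'
  have i6 : IntervalIntegrable (fun r => w r ^ 6 / r ^ 4) volume a b :=
    ContinuousOn.intervalIntegrable (by rwa [uIcc_of_le hab])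
  have i2 := hw.sq_sub (sub ⟨le_rfl, hab⟩) (sub ⟨hab, le_rfl⟩)
  have mono := intervalIntegral.integral_mono_on hab (i.add (i6.const_mul (1 / (4 * A ^ 2)))) i2
    (by
      intro r hr
      have hr0 : 0 < r := ha.trans_le hr.1
      set θ := √(1 - (Y r / A) ^ 2) with hθ
      have hYA : Y r / A ≤ 1 := by
        rw [div_le_one hA, ← Yeq]; exact hY r (sub hr)
      have hY0 : 0 ≤ Y r / A := by
        apply div_nonneg _ hA.le; rw [← Yeq]; positivity
      have hθ2 : θ ^ 2 = 1 - (Y r / A) ^ 2 := Real.sq_sqrt (by nlinarith)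
      have e6 : 1 / (4 * A ^ 2) * (w r ^ 6 / r ^ 4) = (w r / r) ^ 2 / 4 * (1 - θ ^ 2) := by
        rw [hθ2]; simp only [hYd]; field_simp; ring
      rw [e6]
      have eY : Y' r = 2 * (w r / r) * g r - (w r / r) ^ 2 := by
        simp only [hY']; field_simp
        ring
      rw [eY]
      have hp : σ ^ 2 * (θ ^ 2 * (w r / r) ^ 2) = θ ^ 2 * (w r / r) ^ 2 := by rw [hσ, one_mul]
      have := sq_nonneg (g r - (w r / r) / 2 - σ * θ * (w r / r) / 2)
      ring_nf at this hp ⊢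
      linarith)
  rw [intervalIntegral.integral_add i (i6.const_mul _), e, intervalIntegral.integral_const_mul]
    at mono
  simp only [Yeq]
  linarith

lemma bliss_pos {A r0 : ℝ} (hw : Adm R w g) (hA : 0 < A)
    (hY : ∀ r ∈ Icc 0 R, w r ^ 2 / r ≤ A) (hr0 : r0 ∈ Ioc 0 R) (h0 : w r0 ^ 2 / r0 = A)
    {a : ℝ} (ha : a ∈ Ioc 0 r0) :
    A * π / 4 - w a ^ 2 / a / 2 - blissK A (w a ^ 2 / a)
      + 1 / (4 * A ^ 2) * ∫ r in a..R, w r ^ 6 / r ^ 4 ≤ ∫ r in (0 : ℝ)..R, g r ^ 2 := by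
  have hR : 0 ≤ R := hr0.1.le.trans hr0.2
  have p1 := hw.bliss_piece hA hY ha.1 ha.2 hr0.2 (σ := 1) (by norm_num)
  have p2 := hw.bliss_piece hA hY hr0.1 hr0.2 le_rfl (σ := -1) (by norm_num)
  have hi : ∀ b ∈ Icc a R, IntervalIntegrable (fun r => w r ^ 6 / r ^ 4) volume a b := by
    intro b hb
    refine ContinuousOn.intervalIntegrable ?_
    rw [uIcc_of_le hb.1]
    exact (((hw.cont hR).mono (Icc_subset_Icc ha.1.le hb.2)).pow 6).div (continuousOn_id.pow 4)
      fun r hr => pow_ne_zero _ (ha.1.trans_le hr.1).ne'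
  have hs := intervalIntegral.integral_add_adjacent_intervals (hi r0 ⟨ha.2, hr0.2⟩)
    ((hi r0 ⟨ha.2, hr0.2⟩).symm.trans (hi R ⟨ha.2.trans hr0.2, le_rfl⟩))
  have m0 : (0 : ℝ) ∈ Icc 0 R := ⟨le_rfl, hR⟩
  have mR : R ∈ Icc 0 R := ⟨hR, le_rfl⟩
  have mr : r0 ∈ Icc 0 R := ⟨hr0.1.le, hr0.2⟩
  have ma : a ∈ Icc 0 R := ⟨ha.1.le, ha.2.trans hr0.2⟩
  have g1 := intervalIntegral.integral_add_adjacent_intervals (hw.sq_sub m0 ma) (hw.sq_sub ma mr)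
  have g2 := intervalIntegral.integral_add_adjacent_intervals (hw.sq_sub m0 mr) (hw.sq_sub mr mR)
  have gn : 0 ≤ ∫ r in (0 : ℝ)..a, g r ^ 2 :=
    intervalIntegral.integral_nonneg ha.1.le fun _ _ => sq_nonneg _
  rw [h0, blissK_self hA] at p1 p2
  rw [hw.zero] at p2
  norm_num [blissK_zero] at p2
  rw [← hs]
  norm_num at p1 p2 ⊢
  rw [mul_add]
  linarith

/-- Bliss' inequality (the sharp radial Sobolev inequality). -/
lemma bliss (hR : 0 < R) (hw : Adm R w g) :
    IntegrableOn (fun r => w r ^ 6 / r ^ 4) (Ioc 0 R) ∧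
    ∫ r in (0 : ℝ)..R, w r ^ 6 / r ^ 4 ≤ Sstar * (∫ r in (0 : ℝ)..R, g r ^ 2) ^ 3 := by
  set Y := fun r => w r ^ 2 / r with hYd
  set E := ∫ r in (0 : ℝ)..R, g r ^ 2 with hE
  have Yc : ContinuousOn Y (Icc 0 R) := by
    intro r hr
    rcases hr.1.eq_or_lt with h0 | h0
    · subst h0
      have t := hw.sq_div_tendsto hR
      have : ContinuousWithinAt Y (Ioi 0) 0 := by
        have e : Y 0 = 0 := by simp [hYd]
        unfold ContinuousWithinAt; rw [e]; exact t
      have := (continuousWithinAt_Ioi_iff_Ici.1 this)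
      exact this.mono fun x hx => hx.1
    · exact ((hw.cont hR.le) r hr |>.pow 2).div continuousWithinAt_id h0.ne'
  obtain ⟨r0, hr0, hmax⟩ := isCompact_Icc.exists_isMaxOn ⟨0, le_rfl, hR.le⟩ Yc
  have hmax' : ∀ r ∈ Icc 0 R, Y r ≤ Y r0 := fun r hr => hmax hr
  have A0 : 0 ≤ Y r0 := div_nonneg (sq_nonneg _) hr0.1
  have En : 0 ≤ E := energy_nonneg hR.le
  rcases A0.eq_or_lt with hA | hA
  · have wz : ∀ r ∈ Ioc 0 R, w r ^ 6 / r ^ 4 = 0 := by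
      intro r hr
      have h1 := hmax' r ⟨hr.1.le, hr.2⟩
      rw [← hA] at h1
      have h2 : w r ^ 2 ≤ 0 := by
        have := (div_le_iff₀ hr.1).1 h1; linarith
      have : w r = 0 := by nlinarith [pow_eq_zero_iff (two_ne_zero) |>.1 (le_antisymm h2 (sq_nonneg _))]
      simp [this]
    refine ⟨(integrableOn_zero).congr_fun (fun r hr => (wz r hr).symm) measurableSet_Ioc, ?_⟩
    rw [intervalIntegral.integral_of_le hR.le, setIntegral_congr_fun measurableSet_Ioc wz]
    simp only [integral_zero]
    have := Sstar_pos; positivity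
  have hr0' : 0 < r0 := by
    rcases hr0.1.eq_or_lt with h | h
    · rw [← h] at hA; simp [hYd] at hA
    · exact h
  set A := Y r0 with hAd
  have key : ∀ a ∈ Ioc 0 r0, A * π / 4 - Y a / 2 - blissK A (Y a)
      + 1 / (4 * A ^ 2) * ∫ r in a..R, w r ^ 6 / r ^ 4 ≤ E := fun a ha =>
    hw.bliss_pos hA hmax' ⟨hr0', hr0.2⟩ rfl ha
  have Kb : ∀ y, 0 ≤ y → blissK A y ≤ y / 2 := by
    intro y hy
    have := (blissK_lipschitz A).dist_le_mul y 0
    rw [blissK_zero, Real.dist_eq, Real.dist_eq, sub_zero, sub_zero, abs_of_nonneg hy] at this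
    have h2 := (le_abs_self _).trans this
    norm_num at h2; linarith
  have key2 : ∀ a ∈ Ioc 0 r0, ∫ r in a..R, w r ^ 6 / r ^ 4 ≤
      4 * A ^ 2 * (E - A * π / 4 + Y a) := by
    intro a ha
    have h1 := key a ha
    have h2 := Kb (Y a) (div_nonneg (sq_nonneg _) ha.1.le)
    have h3 : 1 / (4 * A ^ 2) * (∫ r in a..R, w r ^ 6 / r ^ 4) ≤ E - A * π / 4 + Y a := by linarith
    rw [one_div, inv_mul_le_iff₀ (by positivity)] at h3
    exact h3
  have pos : ∀ r, 0 ≤ w r ^ 6 / r ^ 4 := fun r => by positivity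
  have loc : ∀ a ∈ Ioc 0 R, IntegrableOn (fun r => w r ^ 6 / r ^ 4) (Ioc a R) := by
    intro a ha
    have : IntervalIntegrable (fun r => w r ^ 6 / r ^ 4) volume a R := by
      refine ContinuousOn.intervalIntegrable ?_
      rw [uIcc_of_le ha.2]
      exact (((hw.cont hR.le).mono (Icc_subset_Icc_left ha.1.le)).pow 6).div (continuousOn_id.pow 4)
        fun r hr => pow_ne_zero _ (ha.1.trans_le hr.1).ne'
    exact (intervalIntegrable_iff_integrableOn_Ioc_of_le ha.2).1 this
  set a : ℕ → ℝ := fun n => r0 * (1 / ((n : ℝ) + 1)) with ha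
  have am : ∀ n, a n ∈ Ioc 0 r0 := by
    intro n
    refine ⟨by positivity, ?_⟩
    have : 1 / ((n : ℝ) + 1) ≤ 1 := by
      rw [div_le_one (by positivity)]; linarith [(Nat.cast_nonneg n : (0 : ℝ) ≤ n)]
    calc r0 * (1 / ((n : ℝ) + 1)) ≤ r0 * 1 := by gcongr
      _ = r0 := mul_one _
  have at0 : Tendsto a atTop (𝓝 0) := by
    have := (tendsto_one_div_add_atTop_nhds_zero_nat (𝕜 := ℝ)).const_mul r0
    rwa [mul_zero] at this
  have at0' : Tendsto a atTop (𝓝[Icc 0 R] 0) := tendsto_nhdsWithin_iff.2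
    ⟨at0, Eventually.of_forall fun n => ⟨(am n).1.le, (am n).2.trans hr0.2⟩⟩
  have Y0 : Tendsto (fun n => Y (a n)) atTop (𝓝 0) := by
    have h1 : Tendsto Y (𝓝[Icc 0 R] 0) (𝓝 (Y 0)) := Yc 0 ⟨le_rfl, hR.le⟩
    have h2 : Y 0 = 0 := by simp [hYd]
    rw [h2] at h1
    exact h1.comp at0'
  have int : IntegrableOn (fun r => w r ^ 6 / r ^ 4) (Ioc 0 R) := by
    refine integrableOn_Ioc_of_intervalIntegral_norm_bounded_left
      (I := 4 * A ^ 2 * (E - A * π / 4 + A)) (fun n => loc (a n) ⟨(am n).1, (am n).2.trans hr0.2⟩)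
      at0 (Eventually.of_forall fun n => ?_)
    simp_rw [Real.norm_eq_abs, abs_of_nonneg (pos _)]
    rw [← intervalIntegral.integral_of_le ((am n).2.trans hr0.2)]
    refine (key2 _ (am n)).trans ?_
    gcongr
    exact hmax' _ ⟨(am n).1.le, (am n).2.trans hr0.2⟩
  refine ⟨int, ?_⟩
  have ii : IntervalIntegrable (fun r => w r ^ 6 / r ^ 4) volume 0 R :=
    (intervalIntegrable_iff_integrableOn_Ioc_of_le hR.le).2 int
  have lim : Tendsto (fun n => ∫ r in a n..R, w r ^ 6 / r ^ 4) atTop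
      (𝓝 (∫ r in (0 : ℝ)..R, w r ^ 6 / r ^ 4)) := by
    have c := intervalIntegral.continuousOn_primitive_interval' ii (a := R) (by simp)
    rw [uIcc_of_le hR.le] at c
    have h1 : Tendsto (fun b => ∫ r in R..b, w r ^ 6 / r ^ 4) (𝓝[Icc 0 R] 0)
      (𝓝 (∫ r in R..0, w r ^ 6 / r ^ 4)) := c 0 ⟨le_rfl, hR.le⟩
    have h2 := (h1.comp at0').neg
    simpa [intervalIntegral.integral_symm R, Function.comp_def] using h2
  have h3 : ∫ r in (0 : ℝ)..R, w r ^ 6 / r ^ 4 ≤ 4 * A ^ 2 * (E - A * π / 4 + 0) :=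
    le_of_tendsto_of_tendsto' lim ((Y0.const_add _).const_mul _) fun n => key2 _ (am n)
  refine h3.trans ?_
  have h4 : 0 ≤ (π * A - 8 * E / 3) ^ 2 * (π * A + 4 * E / 3) :=
    mul_nonneg (sq_nonneg _) (by positivity)
  clear_value A
  unfold Sstar
  have h5 : 256 / (27 * π ^ 2) * E ^ 3 - 4 * A ^ 2 * (E - A * π / 4 + 0)
      = (π * A - 8 * E / 3) ^ 2 * (π * A + 4 * E / 3) / π ^ 2 := by
    field_simp
    ring
  have h6 : 0 ≤ (π * A - 8 * E / 3) ^ 2 * (π * A + 4 * E / 3) / π ^ 2 := by positivity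
  linarith

end Adm

lemma young_six {a b : ℝ} (ha : 0 ≤ a) (hb : 0 ≤ b) : a ^ 5 * b ≤ 5 / 6 * a ^ 6 + 1 / 6 * b ^ 6 := by
  have : 5 / 6 * a ^ 6 + 1 / 6 * b ^ 6 - a ^ 5 * b = 1 / 6 * ((a - b) ^ 2 *
    (5 * a ^ 4 + 4 * a ^ 3 * b + 3 * a ^ 2 * b ^ 2 + 2 * a * b ^ 3 + b ^ 4)) := by ring
  have h : 0 ≤ 1 / 6 * ((a - b) ^ 2 *
    (5 * a ^ 4 + 4 * a ^ 3 * b + 3 * a ^ 2 * b ^ 2 + 2 * a * b ^ 3 + b ^ 4)) := by positivity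
  linarith

namespace Adm

variable {R : ℝ} {w g z k : ℝ → ℝ}

lemma eq_zero_of_energy (hw : Adm R w g) (h : ∫ r in (0 : ℝ)..R, g r ^ 2 = 0) {r : ℝ}
    (hr : r ∈ Icc 0 R) : w r = 0 := by
  have := hw.sq_le' hr
  rw [h, mul_zero] at this
  exact pow_eq_zero_iff two_ne_zero |>.1 (le_antisymm this (sq_nonneg _))

lemma aesm (hR : 0 ≤ R) (hw : Adm R w g) :
    AEStronglyMeasurable w (volume.restrict (Ioc 0 R)) :=
  ((hw.cont hR).mono Ioc_subset_Icc_self).aestronglyMeasurable measurableSet_Ioc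

lemma pair_integrable (hR : 0 < R) (hw : Adm R w g) (hz : Adm R z k) :
    IntegrableOn (fun r => |w r| ^ 5 * |z r| / r ^ 4) (Ioc 0 R) := by
  refine Integrable.mono' (((hw.bliss hR).1.const_mul (5 / 6)).add
    ((hz.bliss hR).1.const_mul (1 / 6))) ?_ ?_
  · refine (AEMeasurable.div ?_ (by fun_prop)).aestronglyMeasurable
    exact ((hw.aesm hR.le).norm.aemeasurable.pow_const 5).mul (hz.aesm hR.le).norm.aemeasurable
  · refine Eventually.of_forall fun r => ?_
    rw [Real.norm_eq_abs, abs_of_nonneg (by positivity)]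
    simp only [Pi.add_apply]
    have := young_six (abs_nonneg (w r)) (abs_nonneg (z r))
    rw [Even.pow_abs (n := 6) (by decide), Even.pow_abs (n := 6) (by decide)] at this
    calc |w r| ^ 5 * |z r| / r ^ 4 ≤ (5 / 6 * w r ^ 6 + 1 / 6 * z r ^ 6) / r ^ 4 := by gcongr
      _ = _ := by ring

/-- The sharp bilinear Sobolev inequality. -/
lemma pair_le (hR : 0 < R) (hw : Adm R w g) (hz : Adm R z k) :
    ∫ r in Ioc 0 R, |w r| ^ 5 * |z r| / r ^ 4 ≤
      Sstar * √(∫ r in (0 : ℝ)..R, g r ^ 2) ^ 5 * √(∫ r in (0 : ℝ)..R, k r ^ 2) := by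
  set E := ∫ r in (0 : ℝ)..R, g r ^ 2
  set T := ∫ r in (0 : ℝ)..R, k r ^ 2
  have hE : 0 ≤ E := energy_nonneg hR.le
  have hT : 0 ≤ T := energy_nonneg hR.le
  rcases hE.eq_or_lt with h | hE'
  · have : ∀ r ∈ Ioc 0 R, |w r| ^ 5 * |z r| / r ^ 4 = 0 := fun r hr => by
      rw [hw.eq_zero_of_energy h.symm (Ioc_subset_Icc_self hr)]; simp
    rw [setIntegral_congr_fun measurableSet_Ioc this, ← h]; simp
  rcases hT.eq_or_lt with h | hT'
  · have : ∀ r ∈ Ioc 0 R, |w r| ^ 5 * |z r| / r ^ 4 = 0 := fun r hr => by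
      rw [hz.eq_zero_of_energy h.symm (Ioc_subset_Icc_self hr)]; simp
    rw [setIntegral_congr_fun measurableSet_Ioc this, ← h]; simp
  set e := √E with he
  set t := √T with ht
  have e0 : 0 < e := Real.sqrt_pos.2 hE'
  have t0 : 0 < t := Real.sqrt_pos.2 hT'
  have e2 : E = e ^ 2 := (Real.sq_sqrt hE).symm
  have t2 : T = t ^ 2 := (Real.sq_sqrt hT).symm
  obtain ⟨i1, b1⟩ := hw.bliss hR
  obtain ⟨i2, b2⟩ := hz.bliss hR
  rw [intervalIntegral.integral_of_le hR.le] at b1 b2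
  have step : ∫ r in Ioc 0 R, |w r| ^ 5 * |z r| / r ^ 4 ≤
      ∫ r in Ioc 0 R, (5 / 6 * (t / e) * (w r ^ 6 / r ^ 4) + 1 / 6 * (e / t) ^ 5 * (z r ^ 6 / r ^ 4)) := by
    refine integral_mono (pair_integrable hR hw hz) ((i1.const_mul _).add (i2.const_mul _)) ?_
    intro r
    have := young_six (a := |w r| * t) (b := |z r| * e) (by positivity) (by positivity)
    simp only [mul_pow] at this
    rw [Even.pow_abs (n := 6) (by decide), Even.pow_abs (n := 6) (by decide)] at this
    show |w r| ^ 5 * |z r| / r ^ 4 ≤ _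
    have h2 : |w r| ^ 5 * |z r| ≤ 5 / 6 * (t / e) * w r ^ 6 + 1 / 6 * (e / t) ^ 5 * z r ^ 6 := by
      have h3 : (5 / 6 * (t / e) * w r ^ 6 + 1 / 6 * (e / t) ^ 5 * z r ^ 6) =
        (5 / 6 * (w r ^ 6 * t ^ 6) + 1 / 6 * (z r ^ 6 * e ^ 6)) / (t ^ 5 * e) := by
        field_simp
      rw [h3, le_div_iff₀ (by positivity)]
      linarith
    calc |w r| ^ 5 * |z r| / r ^ 4 ≤ (5 / 6 * (t / e) * w r ^ 6 + 1 / 6 * (e / t) ^ 5 * z r ^ 6) / r ^ 4 := by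
          gcongr
      _ = _ := by ring
  rw [integral_add (i1.const_mul _) (i2.const_mul _), integral_const_mul, integral_const_mul] at step
  refine step.trans ?_
  calc _ ≤ 5 / 6 * (t / e) * (Sstar * E ^ 3) + 1 / 6 * (e / t) ^ 5 * (Sstar * T ^ 3) := by gcongr
    _ = Sstar * e ^ 5 * t := by
      rw [e2, t2]; field_simp; ring

end Adm

lemma Adm.of_hasDerivAt {R : ℝ} {w g : ℝ → ℝ} (hw : ∀ r, HasDerivAt w (g r) r) (hg : Continuous g)
    (h0 : w 0 = 0) (hR : w R = 0) : Adm R w g := by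
  refine ⟨hg.intervalIntegrable _ _, (hg.pow 2).intervalIntegrable _ _, fun r _ => ?_, hR⟩
  rw [intervalIntegral.integral_eq_sub_of_hasDerivAt (fun x _ => hw x) (hg.intervalIntegrable _ _),
    h0, sub_zero]

lemma cont_bubble (n : ℕ) : Continuous fun τ : ℝ => τ ^ n / (1 + τ ^ 2) ^ 3 := by
  refine (continuous_pow n).div (by fun_prop) fun τ => by positivity

lemma bubbleInt_hasDerivAt (n : ℕ) (L : ℝ) :
    HasDerivAt (fun L => ∫ τ in (0 : ℝ)..L, τ ^ n / (1 + τ ^ 2) ^ 3) (L ^ n / (1 + L ^ 2) ^ 3) L :=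
  intervalIntegral.integral_hasDerivAt_right ((cont_bubble n).intervalIntegrable _ _)
    ((cont_bubble n).stronglyMeasurableAtFilter _ _) (cont_bubble n).continuousAt

lemma tendsto_div_one_add_sq : Tendsto (fun τ : ℝ => τ / (1 + τ ^ 2)) atTop (𝓝 0) := by
  refine squeeze_zero' ?_ ?_ tendsto_inv_atTop_zero
  · filter_upwards [eventually_ge_atTop 0] with τ h; positivity
  · filter_upwards [eventually_gt_atTop 0] with τ h
    rw [div_le_iff₀ (by positivity), inv_mul_eq_div, le_div_iff₀ h]; nlinarith

lemma tendsto_inv_one_add_sq : Tendsto (fun τ : ℝ => 1 / (1 + τ ^ 2)) atTop (𝓝 0) := by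
  refine squeeze_zero' ?_ ?_ tendsto_inv_atTop_zero
  · filter_upwards [eventually_ge_atTop 0] with τ h; positivity
  · filter_upwards [eventually_gt_atTop 0] with τ h
    rw [div_le_iff₀ (by positivity), inv_mul_eq_div, le_div_iff₀ h]; nlinarith [sq_nonneg (τ - 1)]

lemma arctan_tendsto : Tendsto Real.arctan atTop (𝓝 (π / 2)) :=
  tendsto_nhds_of_tendsto_nhdsWithin Real.tendsto_arctan_atTop

lemma bubble_zero (L : ℝ) : ∫ τ in (0 : ℝ)..L, τ ^ 0 / (1 + τ ^ 2) ^ 3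
    = 1 / 4 * (L / (1 + L ^ 2) * (1 / (1 + L ^ 2))) + 3 / 8 * (L / (1 + L ^ 2))
      + 3 / 8 * Real.arctan L := by
  have d : ∀ x ∈ uIcc 0 L, HasDerivAt (fun L : ℝ => 1 / 4 * (L / (1 + L ^ 2) * (1 / (1 + L ^ 2)))
      + 3 / 8 * (L / (1 + L ^ 2)) + 3 / 8 * Real.arctan L) (x ^ 0 / (1 + x ^ 2) ^ 3) x := by
    intro x _
    have p : (1 + x ^ 2) ≠ 0 := by positivity
    have h1 : HasDerivAt (fun x : ℝ => 1 + x ^ 2) (2 * x) x := by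
      simpa using (hasDerivAt_pow 2 x).const_add 1
    have h2 := (hasDerivAt_id x).div h1 p
    have h3 := (hasDerivAt_const x (1 : ℝ)).div h1 p
    have := (((h2.mul h3).const_mul (1 / 4)).add (h2.const_mul (3 / 8))).add
      ((Real.hasDerivAt_arctan x).const_mul (3 / 8))
    refine this.congr_deriv ?_
    simp only [Pi.div_apply, id]
    field_simp
    ring
  rw [intervalIntegral.integral_eq_sub_of_hasDerivAt d ((cont_bubble 0).intervalIntegrable _ _)]
  simp

lemma bubble_two (L : ℝ) : ∫ τ in (0 : ℝ)..L, τ ^ 2 / (1 + τ ^ 2) ^ 3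
    = -1 / 4 * (L / (1 + L ^ 2) * (1 / (1 + L ^ 2))) + 1 / 8 * (L / (1 + L ^ 2))
      + 1 / 8 * Real.arctan L := by
  have d : ∀ x ∈ uIcc 0 L, HasDerivAt (fun L : ℝ => -1 / 4 * (L / (1 + L ^ 2) * (1 / (1 + L ^ 2)))
      + 1 / 8 * (L / (1 + L ^ 2)) + 1 / 8 * Real.arctan L) (x ^ 2 / (1 + x ^ 2) ^ 3) x := by
    intro x _
    have p : (1 + x ^ 2) ≠ 0 := by positivity
    have h1 : HasDerivAt (fun x : ℝ => 1 + x ^ 2) (2 * x) x := by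
      simpa using (hasDerivAt_pow 2 x).const_add 1
    have h2 := (hasDerivAt_id x).div h1 p
    have h3 := (hasDerivAt_const x (1 : ℝ)).div h1 p
    have := (((h2.mul h3).const_mul (-1 / 4)).add (h2.const_mul (1 / 8))).add
      ((Real.hasDerivAt_arctan x).const_mul (1 / 8))
    refine this.congr_deriv ?_
    simp only [Pi.div_apply, id]
    field_simp
    ring
  rw [intervalIntegral.integral_eq_sub_of_hasDerivAt d ((cont_bubble 2).intervalIntegrable _ _)]
  simp

lemma bubble_zero_le (L : ℝ) : ∫ τ in (0 : ℝ)..L, τ ^ 0 / (1 + τ ^ 2) ^ 3 ≤ 3 * π / 16 := by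
  have mono : Monotone fun L : ℝ => ∫ τ in (0 : ℝ)..L, τ ^ 0 / (1 + τ ^ 2) ^ 3 :=
    monotone_of_deriv_nonneg (fun x => (bubbleInt_hasDerivAt 0 x).differentiableAt) fun x => by
      rw [(bubbleInt_hasDerivAt 0 x).deriv]; positivity
  refine mono.ge_of_tendsto ?_ L
  simp_rw [bubble_zero]
  have := (((tendsto_div_one_add_sq.mul tendsto_inv_one_add_sq).const_mul (1 / 4)).add
    (tendsto_div_one_add_sq.const_mul (3 / 8))).add (arctan_tendsto.const_mul (3 / 8))
  convert this using 2
  ring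

lemma bubble_two_ge {L : ℝ} (hL : 1 ≤ L) :
    π / 16 - 1 / L ^ 2 ≤ ∫ τ in (0 : ℝ)..L, τ ^ 2 / (1 + τ ^ 2) ^ 3 := by
  have hL0 : 0 < L := by linarith
  have h1 : π / 2 - 1 / L ≤ Real.arctan L := by
    have h := Real.arctan_inv_of_pos hL0
    have h2 : Real.arctan L⁻¹ ≤ L⁻¹ := by
      have h3 : 0 ≤ Real.arctan L⁻¹ := Real.arctan_nonneg.2 (by positivity)
      calc Real.arctan L⁻¹ ≤ Real.tan (Real.arctan L⁻¹) :=
            Real.le_tan h3 (Real.arctan_lt_pi_div_two _)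
        _ = L⁻¹ := Real.tan_arctan _
    rw [one_div]; linarith
  rw [bubble_two]
  have h4 : L / (1 + L ^ 2) * (1 / (1 + L ^ 2)) ≤ 1 / L ^ 2 := by
    rw [div_mul_div_comm, div_le_div_iff₀ (by positivity) (by positivity)]
    nlinarith [pow_pos hL0 2, pow_pos hL0 3, pow_pos hL0 4]
  have h5 : 1 / L - 1 / L ^ 2 ≤ L / (1 + L ^ 2) := by
    rw [div_sub_div _ _ hL0.ne' (by positivity), div_le_div_iff₀ (by positivity) (by positivity)]
    nlinarith [pow_pos hL0 2, pow_pos hL0 3, pow_pos hL0 4]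
  have : 0 ≤ 1 / L ^ 2 := by positivity
  linarith

lemma bubble_two_le {L : ℝ} (hL : 0 ≤ L) :
    ∫ τ in (0 : ℝ)..L, τ ^ 2 / (1 + τ ^ 2) ^ 3 ≤ π / 2 := by
  have : ∫ τ in (0 : ℝ)..L, τ ^ 2 / (1 + τ ^ 2) ^ 3 ≤ ∫ τ in (0 : ℝ)..L, (1 + τ ^ 2)⁻¹ := by
    refine intervalIntegral.integral_mono_on hL ((cont_bubble 2).intervalIntegrable _ _)
      ((Continuous.inv₀ (by fun_prop) fun x => by positivity).intervalIntegrable _ _) fun x _ => ?_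
    rw [inv_eq_one_div, div_le_div_iff₀ (by positivity) (by positivity)]
    nlinarith [sq_nonneg x, pow_two_nonneg (x ^ 2), pow_two_nonneg (x ^ 3)]
  refine this.trans ?_
  rw [integral_inv_one_add_sq, Real.arctan_zero, sub_zero]
  exact (Real.arctan_lt_pi_div_two _).le

lemma bubble_four_le {L : ℝ} (hL : 0 ≤ L) :
    ∫ τ in (0 : ℝ)..L, τ ^ 4 / (1 + τ ^ 2) ^ 3 ≤ π / 2 := by
  have : ∫ τ in (0 : ℝ)..L, τ ^ 4 / (1 + τ ^ 2) ^ 3 ≤ ∫ τ in (0 : ℝ)..L, (1 + τ ^ 2)⁻¹ := by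
    refine intervalIntegral.integral_mono_on hL ((cont_bubble 4).intervalIntegrable _ _)
      ((Continuous.inv₀ (by fun_prop) fun x => by positivity).intervalIntegrable _ _) fun x _ => ?_
    rw [inv_eq_one_div, div_le_div_iff₀ (by positivity) (by positivity)]
    nlinarith [sq_nonneg x, pow_two_nonneg (x ^ 2), pow_two_nonneg (x ^ 3)]
  refine this.trans ?_
  rw [integral_inv_one_add_sq, Real.arctan_zero, sub_zero]
  exact (Real.arctan_lt_pi_div_two _).le

lemma bubble_one (L : ℝ) : ∫ τ in (0 : ℝ)..L, τ ^ 1 / (1 + τ ^ 2) ^ 3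
    = 1 / 4 - 1 / 4 * (1 / (1 + L ^ 2) ^ 2) := by
  have d : ∀ x ∈ uIcc 0 L, HasDerivAt (fun L : ℝ => 1 / 4 - 1 / 4 * (1 / (1 + L ^ 2) ^ 2))
      (x ^ 1 / (1 + x ^ 2) ^ 3) x := by
    intro x _
    have p : (1 + x ^ 2) ≠ 0 := by positivity
    have h1 : HasDerivAt (fun x : ℝ => 1 + x ^ 2) (2 * x) x := by
      simpa using (hasDerivAt_pow 2 x).const_add 1
    have h3 := (hasDerivAt_const x (1 : ℝ)).div (h1.pow 2) (pow_ne_zero 2 p)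
    have := (h3.const_mul (1 / 4)).const_sub (1 / 4)
    refine this.congr_deriv ?_
    simp only [Pi.pow_apply]
    field_simp
    ring
  rw [intervalIntegral.integral_eq_sub_of_hasDerivAt d ((cont_bubble 1).intervalIntegrable _ _)]
  simp

lemma bubble_three (L : ℝ) : ∫ τ in (0 : ℝ)..L, τ ^ 3 / (1 + τ ^ 2) ^ 3
    = 1 / 4 * (L ^ 4 / (1 + L ^ 2) ^ 2) := by
  have d : ∀ x ∈ uIcc 0 L, HasDerivAt (fun L : ℝ => 1 / 4 * (L ^ 4 / (1 + L ^ 2) ^ 2))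
      (x ^ 3 / (1 + x ^ 2) ^ 3) x := by
    intro x _
    have p : (1 + x ^ 2) ≠ 0 := by positivity
    have h1 : HasDerivAt (fun x : ℝ => 1 + x ^ 2) (2 * x) x := by
      simpa using (hasDerivAt_pow 2 x).const_add 1
    have h3 := (hasDerivAt_pow 4 x).div (h1.pow 2) (pow_ne_zero 2 p)
    have := (h3.const_mul (1 / 4))
    refine this.congr_deriv ?_
    simp only [Pi.pow_apply]
    field_simp
    ring
  rw [intervalIntegral.integral_eq_sub_of_hasDerivAt d ((cont_bubble 3).intervalIntegrable _ _)]
  simp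

lemma bubble_one_le (L : ℝ) : ∫ τ in (0 : ℝ)..L, τ ^ 1 / (1 + τ ^ 2) ^ 3 ≤ 1 / 4 := by
  rw [bubble_one]
  have : 0 ≤ 1 / (1 + L ^ 2) ^ 2 := by positivity
  linarith

lemma bubble_one_ge {L : ℝ} (hL : 1 ≤ L) :
    1 / 4 - 1 / L ≤ ∫ τ in (0 : ℝ)..L, τ ^ 1 / (1 + τ ^ 2) ^ 3 := by
  rw [bubble_one]
  have : 1 / (1 + L ^ 2) ^ 2 ≤ 1 / L := by
    apply one_div_le_one_div_of_le (by linarith)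
    nlinarith [sq_nonneg (L ^ 2)]
  have : 0 ≤ 1 / L := by positivity
  linarith

lemma bubble_three_ge {L : ℝ} (hL : 1 ≤ L) :
    1 / 4 - 1 / L ≤ ∫ τ in (0 : ℝ)..L, τ ^ 3 / (1 + τ ^ 2) ^ 3 := by
  rw [bubble_three]
  have : 1 - 4 / L ≤ L ^ 4 / (1 + L ^ 2) ^ 2 := by
    rw [one_sub_div (by positivity), div_le_div_iff₀ (by positivity) (by positivity)]
    have h2 : 1 ≤ L ^ 2 := by nlinarith
    nlinarith [mul_nonneg (by linarith : 0 ≤ L - 1) (sq_nonneg (L ^ 2)), sq_nonneg (L ^ 2 - 1), pow_pos (by linarith : 0 < L) 3]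
  have e : 1 / 4 - 1 / L = 1 / 4 * (1 - 4 / L) := by ring
  rw [e]; gcongr

lemma bubble_three_le (L : ℝ) : ∫ τ in (0 : ℝ)..L, τ ^ 3 / (1 + τ ^ 2) ^ 3 ≤ 1 / 4 := by
  rw [bubble_three]
  have : L ^ 4 / (1 + L ^ 2) ^ 2 ≤ 1 := by
    rw [div_le_one (by positivity)]; nlinarith [sq_nonneg L]
  linarith

lemma taylor_two {F F' F'' : ℝ → ℝ} (h1 : ∀ r, HasDerivAt F (F' r) r)
    (h2 : ∀ r, HasDerivAt F' (F'' r) r) (hc : Continuous F'') (R : ℝ) :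
    ∃ C, 0 ≤ C ∧ ∀ r ∈ Icc 0 R, |F r - (F 0 + F' 0 * r)| ≤ C * r ^ 2 := by
  obtain ⟨C, hC⟩ := isCompact_Icc.exists_bound_of_continuousOn (s := Icc 0 R) hc.continuousOn
  refine ⟨max C 0, le_max_right _ _, fun r hr => ?_⟩
  have b : ∀ x ∈ Icc 0 R, ‖F'' x‖ ≤ max C 0 := fun x hx => (hC x hx).trans (le_max_left _ _)
  have d1 : ∀ x ∈ Icc 0 r, |F' x - F' 0| ≤ max C 0 * r := by
    intro x hx
    have := (convex_Icc (0 : ℝ) r).norm_image_sub_le_of_norm_hasDerivWithin_le (f := F') (f' := F'')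
      (C := max C 0) (fun y _ => (h2 y).hasDerivWithinAt)
      (fun y hy => b y ⟨hy.1, hy.2.trans hr.2⟩) ⟨le_rfl, hr.1⟩ hx
    rw [Real.norm_eq_abs, Real.norm_eq_abs, sub_zero, abs_of_nonneg hx.1] at this
    exact this.trans (mul_le_mul_of_nonneg_left hx.2 (le_max_right _ _))
  have := (convex_Icc (0 : ℝ) r).norm_image_sub_le_of_norm_hasDerivWithin_le
    (f := fun x => F x - F' 0 * x) (f' := fun x => F' x - F' 0) (C := max C 0 * r)
    (fun y _ => ((h1 y).sub (by simpa using (hasDerivAt_id y).const_mul (F' 0))).hasDerivWithinAt)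
    (fun y hy => d1 y hy) ⟨le_rfl, hr.1⟩ ⟨hr.1, le_rfl⟩
  rw [Real.norm_eq_abs, Real.norm_eq_abs, sub_zero, abs_of_nonneg hr.1] at this
  convert this using 1
  · congr 1; ring
  · ring

lemma scaled_le {R ε c C : ℝ} (hR : 0 < R) (hε : 0 < ε) (hεR : ε ≤ R) (hC : 0 ≤ C) {F : ℝ → ℝ}
    (hF : Continuous F) (h : ∀ r ∈ Icc 0 R, F r ≤ 1 + c * r + C * r ^ 2) :
    ε * ∫ r in (0 : ℝ)..R, F r * (ε ^ 4 / (ε ^ 2 + r ^ 2) ^ 3)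
      ≤ 3 * π / 16 + c / 4 * ε + (|c| / R + C * (π / 2)) * ε ^ 2 := by
  set L := R / ε with hL
  have hL1 : 1 ≤ L := by rwa [hL, le_div_iff₀ hε, one_mul]
  have e1 : ε * ∫ r in (0 : ℝ)..R, F r * (ε ^ 4 / (ε ^ 2 + r ^ 2) ^ 3)
      = ∫ τ in (0 : ℝ)..L, F (ε * τ) / (1 + τ ^ 2) ^ 3 := by
    have := intervalIntegral.integral_comp_div (a := 0) (b := R)
      (fun τ => F (ε * τ) / (1 + τ ^ 2) ^ 3) hε.ne'
    rw [zero_div, smul_eq_mul] at this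
    have e2 : ∫ r in (0 : ℝ)..R, F (ε * (r / ε)) / (1 + (r / ε) ^ 2) ^ 3
        = ∫ r in (0 : ℝ)..R, ε ^ 2 * (F r * (ε ^ 4 / (ε ^ 2 + r ^ 2) ^ 3)) := by
      congr 1; ext r
      rw [mul_div_cancel₀ _ hε.ne']
      have : ε ^ 2 + r ^ 2 ≠ 0 := by positivity
      field_simp
    rw [e2, intervalIntegral.integral_const_mul] at this
    have h3 : ε * (ε * ∫ r in (0 : ℝ)..R, F r * (ε ^ 4 / (ε ^ 2 + r ^ 2) ^ 3))
      = ε * ∫ τ in (0 : ℝ)..L, F (ε * τ) / (1 + τ ^ 2) ^ 3 := by rw [← this]; ring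
    exact mul_left_cancel₀ hε.ne' h3
  have ci : ∀ n, IntervalIntegrable (fun τ : ℝ => τ ^ n / (1 + τ ^ 2) ^ 3) volume 0 L :=
    fun n => (cont_bubble n).intervalIntegrable _ _
  have e3 : ∫ τ in (0 : ℝ)..L, F (ε * τ) / (1 + τ ^ 2) ^ 3 ≤
      ∫ τ in (0 : ℝ)..L, (τ ^ 0 / (1 + τ ^ 2) ^ 3 + c * ε * (τ ^ 1 / (1 + τ ^ 2) ^ 3)
        + C * ε ^ 2 * (τ ^ 2 / (1 + τ ^ 2) ^ 3)) := by
    refine intervalIntegral.integral_mono_on (by linarith) ?_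
      (((ci 0).add ((ci 1).const_mul _)).add ((ci 2).const_mul _)) fun τ hτ => ?_
    · exact ((hF.comp (continuous_const.mul continuous_id)).div (by fun_prop)
        fun x => by positivity).intervalIntegrable _ _
    · have hm : ε * τ ∈ Icc 0 R := by
        refine ⟨mul_nonneg hε.le hτ.1, ?_⟩
        have := hτ.2; rw [hL, le_div_iff₀ hε] at this; linarith
      calc F (ε * τ) / (1 + τ ^ 2) ^ 3 ≤ (1 + c * (ε * τ) + C * (ε * τ) ^ 2) / (1 + τ ^ 2) ^ 3 := by
            gcongr; exact h _ hm
        _ = _ := by ring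
  rw [intervalIntegral.integral_add ((ci 0).add ((ci 1).const_mul _)) ((ci 2).const_mul _),
    intervalIntegral.integral_add (ci 0) ((ci 1).const_mul _),
    intervalIntegral.integral_const_mul, intervalIntegral.integral_const_mul] at e3
  rw [e1]
  refine e3.trans ?_
  have b0 := bubble_zero_le L
  have b1 := bubble_one_le L
  have b1' := bubble_one_ge hL1
  have b2 := bubble_two_le (by linarith : 0 ≤ L)
  set I1 := ∫ τ in (0 : ℝ)..L, τ ^ 1 / (1 + τ ^ 2) ^ 3
  have k1 : c * ε * I1 ≤ c / 4 * ε + |c| / R * ε ^ 2 := by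
    have a1 : |I1 - 1 / 4| ≤ ε / R := by
      have : 1 / L = ε / R := by rw [hL]; field_simp
      rw [abs_le]; constructor <;> [linarith; linarith [show 0 ≤ ε / R by positivity]]
    have a2 : c * (I1 - 1 / 4) ≤ |c| * (ε / R) :=
      (le_abs_self _).trans (by rw [abs_mul]; gcongr)
    have : c * ε * I1 = c / 4 * ε + ε * (c * (I1 - 1 / 4)) := by ring
    rw [this]
    have : |c| / R * ε ^ 2 = ε * (|c| * (ε / R)) := by field_simp
    rw [this]; gcongr
  have k2 : C * ε ^ 2 * ∫ τ in (0 : ℝ)..L, τ ^ 2 / (1 + τ ^ 2) ^ 3 ≤ C * ε ^ 2 * (π / 2) := by gcongr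
  nlinarith [k1, k2, b0]

lemma scaled_ge {R ε c C : ℝ} (hR : 0 < R) (hε : 0 < ε) (hεR : ε ≤ R) (hC : 0 ≤ C) {F : ℝ → ℝ}
    (hF : Continuous F) (h : ∀ r ∈ Icc 0 R, 1 + c * r - C * r ^ 2 ≤ F r) :
    π / 16 + c / 4 * ε - (1 / R ^ 2 + |c| / R + C * (π / 2)) * ε ^ 2 ≤
      ε ^ 3 * ∫ r in (0 : ℝ)..R, F r * (r ^ 2 / (ε ^ 2 + r ^ 2) ^ 3) := by
  set L := R / ε with hL
  have hL1 : 1 ≤ L := by rwa [hL, le_div_iff₀ hε, one_mul]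
  have e1 : ε ^ 3 * ∫ r in (0 : ℝ)..R, F r * (r ^ 2 / (ε ^ 2 + r ^ 2) ^ 3)
      = ∫ τ in (0 : ℝ)..L, F (ε * τ) * (τ ^ 2 / (1 + τ ^ 2) ^ 3) := by
    have := intervalIntegral.integral_comp_div (a := 0) (b := R)
      (fun τ => F (ε * τ) * (τ ^ 2 / (1 + τ ^ 2) ^ 3)) hε.ne'
    rw [zero_div, smul_eq_mul] at this
    have e2 : ∫ r in (0 : ℝ)..R, F (ε * (r / ε)) * ((r / ε) ^ 2 / (1 + (r / ε) ^ 2) ^ 3)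
        = ∫ r in (0 : ℝ)..R, ε ^ 4 * (F r * (r ^ 2 / (ε ^ 2 + r ^ 2) ^ 3)) := by
      congr 1; ext r
      rw [mul_div_cancel₀ _ hε.ne']
      have : ε ^ 2 + r ^ 2 ≠ 0 := by positivity
      field_simp
    rw [e2, intervalIntegral.integral_const_mul] at this
    have h3 : ε * (ε ^ 3 * ∫ r in (0 : ℝ)..R, F r * (r ^ 2 / (ε ^ 2 + r ^ 2) ^ 3))
      = ε * ∫ τ in (0 : ℝ)..L, F (ε * τ) * (τ ^ 2 / (1 + τ ^ 2) ^ 3) := by rw [← this]; ring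
    exact mul_left_cancel₀ hε.ne' h3
  have ci : ∀ n, IntervalIntegrable (fun τ : ℝ => τ ^ n / (1 + τ ^ 2) ^ 3) volume 0 L :=
    fun n => (cont_bubble n).intervalIntegrable _ _
  have e3 : ∫ τ in (0 : ℝ)..L, (τ ^ 2 / (1 + τ ^ 2) ^ 3 + c * ε * (τ ^ 3 / (1 + τ ^ 2) ^ 3)
        - C * ε ^ 2 * (τ ^ 4 / (1 + τ ^ 2) ^ 3)) ≤
      ∫ τ in (0 : ℝ)..L, F (ε * τ) * (τ ^ 2 / (1 + τ ^ 2) ^ 3) := by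
    refine intervalIntegral.integral_mono_on (by linarith)
      (((ci 2).add ((ci 3).const_mul _)).sub ((ci 4).const_mul _)) ?_ fun τ hτ => ?_
    · exact ((hF.comp (continuous_const.mul continuous_id)).mul
        (cont_bubble 2)).intervalIntegrable _ _
    · have hm : ε * τ ∈ Icc 0 R := by
        refine ⟨mul_nonneg hε.le hτ.1, ?_⟩
        have := hτ.2; rw [hL, le_div_iff₀ hε] at this; linarith
      calc _ = (1 + c * (ε * τ) - C * (ε * τ) ^ 2) * (τ ^ 2 / (1 + τ ^ 2) ^ 3) := by ring
        _ ≤ F (ε * τ) * (τ ^ 2 / (1 + τ ^ 2) ^ 3) := by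
            gcongr; exact h _ hm
  rw [intervalIntegral.integral_sub ((ci 2).add ((ci 3).const_mul _)) ((ci 4).const_mul _),
    intervalIntegral.integral_add (ci 2) ((ci 3).const_mul _),
    intervalIntegral.integral_const_mul, intervalIntegral.integral_const_mul] at e3
  rw [e1]
  refine le_trans ?_ e3
  have b0 := bubble_two_ge hL1
  have b1 := bubble_three_le L
  have b1' := bubble_three_ge hL1
  have b2 := bubble_four_le (by linarith : 0 ≤ L)
  set I1 := ∫ τ in (0 : ℝ)..L, τ ^ 3 / (1 + τ ^ 2) ^ 3
  have k1 : c / 4 * ε - |c| / R * ε ^ 2 ≤ c * ε * I1 := by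
    have a1 : |I1 - 1 / 4| ≤ ε / R := by
      have : 1 / L = ε / R := by rw [hL]; field_simp
      rw [abs_le]; constructor <;> [linarith; linarith [show 0 ≤ ε / R by positivity]]
    have a2 : -(|c| * (ε / R)) ≤ c * (I1 - 1 / 4) :=
      (neg_le_neg (show |c * (I1 - 1 / 4)| ≤ |c| * (ε / R) by rw [abs_mul]; gcongr)).trans
        (neg_abs_le _)
    have e4 : c * ε * I1 = c / 4 * ε + ε * (c * (I1 - 1 / 4)) := by ring
    have e5 : |c| / R * ε ^ 2 = ε * (|c| * (ε / R)) := by field_simp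
    rw [e4, e5]
    nlinarith
  have k2 : C * ε ^ 2 * ∫ τ in (0 : ℝ)..L, τ ^ 4 / (1 + τ ^ 2) ^ 3 ≤ C * ε ^ 2 * (π / 2) := by gcongr
  have k3 : 1 / L ^ 2 = 1 / R ^ 2 * ε ^ 2 := by rw [hL]; field_simp
  nlinarith [k1, k2, b0]

lemma cot_condition {R lam : ℝ} (hR : 0 < R) (hlow : 3 / 10 * (π ^ 2 / R ^ 2) < lam)
    (hhigh : lam < π ^ 2 / R ^ 2) : 0 < √lam * R ∧ √lam * R < π ∧
      5 * (√lam * R) * Real.cos (√lam * R) + Real.sin (√lam * R) < 0 := by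
  have hl0 : 0 < lam := lt_trans (by positivity) hlow
  set t := √lam * R with ht
  have t0 : 0 < t := by positivity
  have t2 : t ^ 2 = lam * R ^ 2 := by rw [ht, mul_pow, Real.sq_sqrt hl0.le]
  have u : t ^ 2 < π ^ 2 := by rw [t2]; rwa [lt_div_iff₀ (by positivity)] at hhigh
  have l : 3 / 10 * π ^ 2 < t ^ 2 := by
    rw [t2, ← div_lt_iff₀ (by positivity)]; rwa [mul_div_assoc]
  have tp : t < π := lt_of_pow_lt_pow_left₀ 2 pi_pos.le u
  refine ⟨t0, tp, ?_⟩
  set x := t - π / 2 with hx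
  have hp := Real.pi_gt_d4
  have tl : 0.547 * π < t := by
    refine lt_of_pow_lt_pow_left₀ 2 t0.le (lt_trans ?_ l)
    rw [mul_pow]; nlinarith [sq_pos_of_pos pi_pos]
  have x0 : 0.147 < x := by rw [hx]; nlinarith
  have xp : x < π / 2 := by rw [hx]; linarith
  have tx : t = x + π / 2 := by rw [hx]; ring
  rw [tx, Real.cos_add_pi_div_two, Real.sin_add_pi_div_two, ← tx]
  have cp : 0 < Real.cos x := Real.cos_pos_of_mem_Ioo ⟨by linarith, xp⟩
  have h1 : x * Real.cos x ≤ Real.sin x := by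
    have := Real.le_tan (by linarith : 0 ≤ x) xp
    rwa [Real.tan_eq_sin_div_cos, le_div_iff₀ cp] at this
  have h2 : 1.71 < t := by nlinarith
  have h3 : Real.cos x < 5 * t * (x * Real.cos x) := by
    have : 1 < 5 * t * x := by nlinarith
    nlinarith
  have h4 : 5 * t * (x * Real.cos x) ≤ 5 * t * Real.sin x := by gcongr
  linarith

/-- If `X = 5b + 1/R` is negative the expansion of the test quotient beats the Sobolev constant. -/
lemma expansion_gt {b R C1 C2 C3 : ℝ} (hX : 5 * b + 1 / R < 0) :
    ∀ᶠ ε in 𝓝[>] (0 : ℝ), Sstar * (5 / 6 * (3 * π / 16 + -(2 * b) / 4 * ε + C1 * ε ^ 2) ^ 3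
        + 1 / 6 * (3 * π / 16 + -(2 / R) / 4 * ε + C2 * ε ^ 2) ^ 3)
      < π / 16 + -(5 * b + 1 / R) / 4 * ε - C3 * ε ^ 2 := by
  set f : ℝ → ℝ := fun ε => π / 16 + -(5 * b + 1 / R) / 4 * ε - C3 * ε ^ 2
    - Sstar * (5 / 6 * (3 * π / 16 + -(2 * b) / 4 * ε + C1 * ε ^ 2) ^ 3
        + 1 / 6 * (3 * π / 16 + -(2 / R) / 4 * ε + C2 * ε ^ 2) ^ 3) with hf
  have aux : ∀ p q : ℝ, HasDerivAt (fun ε : ℝ => 3 * π / 16 + p * ε + q * ε ^ 2) p 0 := by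
    intro p q
    have := (((hasDerivAt_id (0 : ℝ)).const_mul p).const_add (3 * π / 16)).add
      ((hasDerivAt_pow 2 (0 : ℝ)).const_mul q)
    refine this.congr_deriv ?_
    simp
  have d : HasDerivAt f (-(5 * b + 1 / R) / 6) 0 := by
    have h1 := (((hasDerivAt_id (0 : ℝ)).const_mul (-(5 * b + 1 / R) / 4)).const_add (π / 16)).sub
      ((hasDerivAt_pow 2 (0 : ℝ)).const_mul C3)
    have h2 := ((((aux (-(2 * b) / 4) C1).pow 3).const_mul (5 / 6)).add
      (((aux (-(2 / R) / 4) C2).pow 3).const_mul (1 / 6))).const_mul Sstar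
    refine (h1.sub h2).congr_deriv ?_
    simp only [Sstar]
    have := Real.pi_pos.ne'
    norm_num
    field_simp
    ring
  have f0 : f 0 = 0 := by
    simp only [hf, Sstar]
    have := Real.pi_pos.ne'
    norm_num
    field_simp
    ring
  have s := (hasDerivAt_iff_tendsto_slope.1 d).mono_left
    (nhdsWithin_mono (0 : ℝ) (fun x (hx : 0 < x) => hx.ne') : 𝓝[>] (0 : ℝ) ≤ _)
  have ev := s.eventually_const_lt (show 0 < -(5 * b + 1 / R) / 6 by linarith)
  filter_upwards [ev, self_mem_nhdsWithin] with ε h1 h2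
  rw [slope_def_field, f0, sub_zero, sub_zero] at h1
  have h3 : 0 < f ε := by
    have h2' : 0 < ε := h2
    rw [lt_div_iff₀ h2', zero_mul] at h1; exact h1
  simp only [hf] at h3
  linarith

lemma exists_test {R lam : ℝ} (hR : 0 < R) (hlow : 3 / 10 * (π ^ 2 / R ^ 2) < lam)
    (hhigh : lam < π ^ 2 / R ^ 2) : ∃ w g z k : ℝ → ℝ, Adm R w g ∧ Adm R z k ∧
      (∀ r ∈ Icc 0 R, 0 ≤ w r) ∧ (∀ r ∈ Icc 0 R, 0 ≤ z r) ∧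
      Sstar * √((∫ r in (0 : ℝ)..R, g r ^ 2) - lam * ∫ r in (0 : ℝ)..R, w r ^ 2) ^ 5
        * √(∫ r in (0 : ℝ)..R, k r ^ 2) < ∫ r in Ioc 0 R, w r ^ 5 * z r / r ^ 4 := by
  obtain ⟨t0, tp, tc⟩ := cot_condition hR hlow hhigh
  have hl0 : 0 < lam := lt_trans (by positivity) hlow
  set m := √lam with hm
  have m2 : m ^ 2 = lam := Real.sq_sqrt hl0.le
  have sp : 0 < Real.sin (m * R) := sin_pos_of_pos_of_lt_pi t0 tp
  set S := Real.sin (m * R) with hS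
  set b := m * Real.cos (m * R) / S with hb
  set s : ℝ → ℝ := fun r => Real.sin (m * (R - r)) / S with hs
  set s' : ℝ → ℝ := fun r => -m * Real.cos (m * (R - r)) / S with hs'
  have ds : ∀ r, HasDerivAt s (s' r) r := by
    intro r
    have h1 : HasDerivAt (fun r : ℝ => m * (R - r)) (-m) r := by
      simpa using ((hasDerivAt_id r).const_sub R).const_mul m
    refine (h1.sin.div_const S).congr_deriv ?_
    simp only [hs']; ring
  have ds' : ∀ r, HasDerivAt s' (-lam * s r) r := by
    intro r
    have h1 : HasDerivAt (fun r : ℝ => m * (R - r)) (-m) r := by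
      simpa using ((hasDerivAt_id r).const_sub R).const_mul m
    refine ((h1.cos.const_mul (-m)).div_const S).congr_deriv ?_
    simp only [hs, ← m2]; ring
  have s0 : s 0 = 1 := by simp only [hs, sub_zero]; exact div_self sp.ne'
  have sR : s R = 0 := by simp [hs]
  have s'0 : s' 0 = -b := by simp only [hs', hb, sub_zero]; ring
  have sc : Continuous s := continuous_iff_continuousAt.2 fun r => (ds r).continuousAt
  have sc' : Continuous s' := continuous_iff_continuousAt.2 fun r => (ds' r).continuousAt
  have snn : ∀ r ∈ Icc 0 R, 0 ≤ s r := by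
    intro r hr
    have m0 : 0 ≤ m := Real.sqrt_nonneg _
    refine div_nonneg (sin_nonneg_of_nonneg_of_le_pi (mul_nonneg m0 (by linarith [hr.2])) ?_) sp.le
    have : m * (R - r) ≤ m * R := by gcongr; linarith [hr.1]
    linarith
  set l : ℝ → ℝ := fun r => 1 - r / R with hl
  have dl : ∀ r, HasDerivAt l (-(1 / R)) r := fun r => by
    simpa using ((hasDerivAt_id r).div_const R).const_sub 1
  have lc : Continuous l := continuous_iff_continuousAt.2 fun r => (dl r).continuousAt
  have l0 : l 0 = 1 := by simp [hl]
  have lR : l R = 0 := by simp [hl, hR.ne']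
  have lnn : ∀ r ∈ Icc 0 R, 0 ≤ l r := fun r hr => by
    simp only [hl]; rw [sub_nonneg, div_le_one hR]; exact hr.2
  -- Taylor bounds
  obtain ⟨C1, hC1, T1⟩ := taylor_two (F := fun r => s r ^ 2) (F' := fun r => 2 * s r * s' r)
    (F'' := fun r => 2 * (s' r * s' r + s r * (-lam * s r)))
    (fun r => ((ds r).pow 2).congr_deriv (by simp)) (fun r => (((ds r).mul (ds' r)).const_mul 2
      |>.congr_deriv rfl).congr_of_eventuallyEq (Eventually.of_forall fun x => by
        simp only [Pi.mul_apply]; ring)) (by fun_prop) R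
  obtain ⟨C2, hC2, T2⟩ := taylor_two (F := fun r => l r ^ 2) (F' := fun r => 2 * l r * (-(1 / R)))
    (F'' := fun r => 2 * (-(1 / R)) * (-(1 / R)))
    (fun r => ((dl r).pow 2).congr_deriv (by simp)) (fun r => ((dl r).const_mul 2).mul_const _)
    (by fun_prop) R
  obtain ⟨C3, hC3, T3⟩ := taylor_two (F := fun r => s r ^ 5 * l r)
    (F' := fun r => 5 * s r ^ 4 * s' r * l r + s r ^ 5 * (-(1 / R)))
    (F'' := fun r => (5 * (4 * s r ^ 3 * s' r) * s' r + 5 * s r ^ 4 * (-lam * s r)) * l r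
      + 5 * s r ^ 4 * s' r * (-(1 / R)) + 5 * s r ^ 4 * s' r * (-(1 / R)))
    (fun r => (((ds r).pow 5).mul (dl r)).congr_deriv (by simp))
    (fun r => (((((ds r).pow 4).const_mul 5).mul (ds' r)).mul (dl r)).add
      (((ds r).pow 5).mul_const (-(1 / R))) |>.congr_deriv (by simp)) (by fun_prop) R
  simp only [s0, s'0, l0] at T1 T2 T3
  have hX : 5 * b + 1 / R < 0 := by
    have : 5 * b + 1 / R = (5 * (m * R) * Real.cos (m * R) + S) / (S * R) := by
      simp only [hb]; field_simp
    rw [this]; exact div_neg_of_neg_of_pos tc (by positivity)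
  obtain ⟨ε, hexp, hε, hεR⟩ := ((expansion_gt (C1 := |-(2 * b)| / R + C1 * (π / 2))
    (C2 := |-(2 / R)| / R + C2 * (π / 2))
    (C3 := 1 / R ^ 2 + |-(5 * b + 1 / R)| / R + C3 * (π / 2)) hX).and
    (Ioo_mem_nhdsGT hR)).exists
  have bN := scaled_le (c := -(2 * b)) hR hε hεR.le hC1 (F := fun r => s r ^ 2) (by fun_prop)
    (fun r hr => by have := (abs_le.1 (T1 r hr)).2; linarith)
  have bT := scaled_le (c := -(2 / R)) hR hε hεR.le hC2 (F := fun r => l r ^ 2) (by fun_prop)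
    (fun r hr => by
      have := (abs_le.1 (T2 r hr)).2
      have e : 2 * 1 * -(1 / R) * r = -(2 / R) * r := by ring
      rw [e] at this
      linarith)
  have bP := scaled_ge (c := -(5 * b + 1 / R)) hR hε hεR.le hC3 (F := fun r => s r ^ 5 * l r)
    (by fun_prop) (fun r hr => by have := (abs_le.1 (T3 r hr)).1; linarith)
  -- the bubble
  have rp : ∀ r : ℝ, 0 < ε ^ 2 + r ^ 2 := fun r => by positivity
  set D : ℝ → ℝ := fun r => √(ε ^ 2 + r ^ 2) with hD
  have Dp : ∀ r, 0 < D r := fun r => Real.sqrt_pos.2 (rp r)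
  have D2 : ∀ r, D r ^ 2 = ε ^ 2 + r ^ 2 := fun r => Real.sq_sqrt (rp r).le
  have dD : ∀ r, HasDerivAt D (r / D r) r := by
    intro r
    have h1 : HasDerivAt (fun r : ℝ => ε ^ 2 + r ^ 2) (2 * r) r := by
      simpa using (hasDerivAt_pow 2 r).const_add (ε ^ 2)
    refine (h1.sqrt (rp r).ne').congr_deriv ?_
    simp only [hD]; field_simp
  have Dc : Continuous D := continuous_iff_continuousAt.2 fun r => (dD r).continuousAt
  set W : ℝ → ℝ := fun r => r / D r with hW
  set W' : ℝ → ℝ := fun r => ε ^ 2 / D r ^ 3 with hW'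
  have dW : ∀ r, HasDerivAt W (W' r) r := by
    intro r
    refine ((hasDerivAt_id r).div (dD r) (Dp r).ne').congr_deriv ?_
    simp only [hW', id]
    have h0 := (Dp r).ne'
    field_simp
    rw [D2]; ring
  have Wc : Continuous W := continuous_iff_continuousAt.2 fun r => (dW r).continuousAt
  have Wc' : Continuous W' := continuous_const.div (by fun_prop) fun r => pow_ne_zero 3 (Dp r).ne'
  have W0 : W 0 = 0 := by simp [hW]
  have WW : ∀ r, W' r ^ 2 = ε ^ 4 / (ε ^ 2 + r ^ 2) ^ 3 := fun r => by
    simp only [hW']; rw [← D2, div_pow]; ring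
  have Wnn : ∀ r ∈ Icc 0 R, 0 ≤ W r := fun r hr => div_nonneg hr.1 (Dp r).le
  have a1 : Adm R (fun r => W r * s r) (fun r => W' r * s r + W r * s' r) :=
    Adm.of_hasDerivAt (fun r => (dW r).mul (ds r)) (by fun_prop) (by simp [W0]) (by simp [sR])
  have a2 : Adm R (fun r => W r * l r) (fun r => W' r * l r + W r * (-(1 / R))) :=
    Adm.of_hasDerivAt (fun r => (dW r).mul (dl r)) (by fun_prop) (by simp [W0]) (by simp [lR])
  have eN : (∫ r in (0 : ℝ)..R, (W' r * s r + W r * s' r) ^ 2)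
      - lam * ∫ r in (0 : ℝ)..R, (W r * s r) ^ 2
      = ∫ r in (0 : ℝ)..R, s r ^ 2 * (ε ^ 4 / (ε ^ 2 + r ^ 2) ^ 3) := by
    have ftc := intervalIntegral.integral_eq_sub_of_hasDerivAt (a := 0) (b := R)
      (fun r _ => (((dW r).mul (dW r)).mul ((ds r).mul (ds' r))))
      (Continuous.intervalIntegrable (by fun_prop) _ _)
    simp only [Pi.mul_apply, W0, sR, zero_mul, mul_zero, sub_zero] at ftc
    rw [← intervalIntegral.integral_const_mul, ← intervalIntegral.integral_sub
      (Continuous.intervalIntegrable (by fun_prop) _ _)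
      (Continuous.intervalIntegrable (by fun_prop) _ _), ← sub_eq_zero, ← ftc]
    simp_rw [← WW]
    rw [← intervalIntegral.integral_sub (Continuous.intervalIntegrable (by fun_prop) _ _)
      (Continuous.intervalIntegrable (by fun_prop) _ _)]
    congr 1; ext r; ring
  have eT : (∫ r in (0 : ℝ)..R, (W' r * l r + W r * (-(1 / R))) ^ 2)
      = ∫ r in (0 : ℝ)..R, l r ^ 2 * (ε ^ 4 / (ε ^ 2 + r ^ 2) ^ 3) := by
    have ftc := intervalIntegral.integral_eq_sub_of_hasDerivAt (a := 0) (b := R)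
      (fun r _ => (((dW r).mul (dW r)).mul ((dl r).mul_const (-(1 / R)))))
      (Continuous.intervalIntegrable (by fun_prop) _ _)
    simp only [Pi.mul_apply, W0, lR, zero_mul, mul_zero, sub_zero] at ftc
    rw [← sub_eq_zero, ← ftc]
    simp_rw [← WW]
    rw [← intervalIntegral.integral_sub (Continuous.intervalIntegrable (by fun_prop) _ _)
      (Continuous.intervalIntegrable (by fun_prop) _ _)]
    congr 1; ext r; ring
  have eP : ∫ r in Ioc 0 R, (W r * s r) ^ 5 * (W r * l r) / r ^ 4
      = ∫ r in (0 : ℝ)..R, s r ^ 5 * l r * (r ^ 2 / (ε ^ 2 + r ^ 2) ^ 3) := by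
    rw [intervalIntegral.integral_of_le hR.le]
    refine setIntegral_congr_fun measurableSet_Ioc fun r hr => ?_
    have e : (ε ^ 2 + r ^ 2) ^ 3 = D r ^ 6 := by rw [← D2]; ring
    have := (Dp r).ne'
    have := hr.1.ne'
    simp only [hW]; rw [e]; field_simp
  refine ⟨_, _, _, _, a1, a2, fun r hr => mul_nonneg (Wnn r hr) (snn r hr),
    fun r hr => mul_nonneg (Wnn r hr) (lnn r hr), ?_⟩
  rw [eN, eT, eP]
  set N := ∫ r in (0 : ℝ)..R, s r ^ 2 * (ε ^ 4 / (ε ^ 2 + r ^ 2) ^ 3) with hN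
  set T := ∫ r in (0 : ℝ)..R, l r ^ 2 * (ε ^ 4 / (ε ^ 2 + r ^ 2) ^ 3) with hT
  set P := ∫ r in (0 : ℝ)..R, s r ^ 5 * l r * (r ^ 2 / (ε ^ 2 + r ^ 2) ^ 3) with hP
  have N0 : 0 ≤ N := intervalIntegral.integral_nonneg hR.le fun r _ => by positivity
  have T0 : 0 ≤ T := intervalIntegral.integral_nonneg hR.le fun r _ => by positivity
  have y := young_six (Real.sqrt_nonneg N) (Real.sqrt_nonneg T)
  have N6 : √N ^ 6 = N ^ 3 := by
    rw [show 6 = 2 * 3 from rfl, pow_mul, Real.sq_sqrt N0]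
  have T6 : √T ^ 6 = T ^ 3 := by
    rw [show 6 = 2 * 3 from rfl, pow_mul, Real.sq_sqrt T0]
  rw [N6, T6] at y
  have S0 := Sstar_pos
  have n3 : (ε * N) ^ 3 ≤ (3 * π / 16 + -(2 * b) / 4 * ε + (|-(2 * b)| / R + C1 * (π / 2)) * ε ^ 2) ^ 3 :=
    pow_le_pow_left₀ (by positivity) bN 3
  have t3 : (ε * T) ^ 3 ≤ (3 * π / 16 + -(2 / R) / 4 * ε + (|-(2 / R)| / R + C2 * (π / 2)) * ε ^ 2) ^ 3 :=
    pow_le_pow_left₀ (by positivity) bT 3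
  have fin : ε ^ 3 * (Sstar * √N ^ 5 * √T) < ε ^ 3 * P := by
    calc ε ^ 3 * (Sstar * √N ^ 5 * √T) = ε ^ 3 * Sstar * (√N ^ 5 * √T) := by ring
      _ ≤ ε ^ 3 * Sstar * (5 / 6 * N ^ 3 + 1 / 6 * T ^ 3) := by gcongr
      _ = Sstar * (5 / 6 * (ε * N) ^ 3 + 1 / 6 * (ε * T) ^ 3) := by ring
      _ ≤ Sstar * (5 / 6 * (3 * π / 16 + -(2 * b) / 4 * ε + (|-(2 * b)| / R + C1 * (π / 2)) * ε ^ 2) ^ 3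
        + 1 / 6 * (3 * π / 16 + -(2 / R) / 4 * ε + (|-(2 / R)| / R + C2 * (π / 2)) * ε ^ 2) ^ 3) := by
          gcongr
      _ < _ := hexp
      _ ≤ _ := bP
  exact lt_of_mul_lt_mul_left fin (by positivity)

lemma memLp_two_of_sq {R : ℝ} (hR : 0 ≤ R) {g : ℝ → ℝ} (h1 : IntervalIntegrable g volume 0 R)
    (h2 : IntervalIntegrable (fun r => g r ^ 2) volume 0 R) :
    MemLp g 2 (volume.restrict (Ioc 0 R)) := by
  rw [intervalIntegrable_iff_integrableOn_Ioc_of_le hR] at h1 h2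
  exact (memLp_two_iff_integrable_sq h1.aestronglyMeasurable).2 h2

/-- Weak sequential compactness of bounded sequences in the energy space. -/
lemma Adm.weak_compact {R : ℝ} (hR : 0 ≤ R) {w g : ℕ → ℝ → ℝ} (h : ∀ n, Adm R (w n) (g n)) {K : ℝ}
    (hK : ∀ n, ∫ r in (0 : ℝ)..R, g n r ^ 2 ≤ K) :
    ∃ (φ : ℕ → ℕ) (w' g' : ℝ → ℝ), StrictMono φ ∧ Adm R w' g' ∧
      (∀ r ∈ Icc 0 R, Tendsto (fun n => w (φ n) r) atTop (𝓝 (w' r))) ∧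
      Tendsto (fun n => ∫ r in (0 : ℝ)..R, g (φ n) r * g' r) atTop
        (𝓝 (∫ r in (0 : ℝ)..R, g' r ^ 2)) := by
  set μ := (volume : Measure ℝ).restrict (Ioc 0 R) with hμ
  have : Fact ((2 : ENNReal) ≠ ⊤) := ⟨by norm_num⟩
  have mem : ∀ n, MemLp (g n) 2 μ := fun n => memLp_two_of_sq hR (h n).int (h n).sq
  set G : ℕ → Lp ℝ 2 μ := fun n => (mem n).toLp (g n) with hG
  have inn : ∀ (n) (f : Lp ℝ 2 μ), inner ℝ (G n) f = ∫ r in Ioc 0 R, g n r * f r := by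
    intro n f
    rw [L2.inner_def]
    refine integral_congr_ae ?_
    filter_upwards [(mem n).coeFn_toLp] with r hr
    rw [hr]; simp [mul_comm]
  have norm_le : ∀ n, ‖G n‖ ≤ √K := by
    intro n
    refine Real.le_sqrt_of_sq_le ?_
    rw [← real_inner_self_eq_norm_sq, inn]
    refine le_trans (le_of_eq ?_) (hK n)
    rw [intervalIntegral.integral_of_le hR]
    refine integral_congr_ae ?_
    filter_upwards [(mem n).coeFn_toLp] with r hr
    rw [hr, pow_two]
  set x : ℕ → WeakDual ℝ (Lp ℝ 2 μ) := fun n =>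
    StrongDual.toWeakDual (InnerProductSpace.toDual ℝ (Lp ℝ 2 μ) (G n)) with hx
  obtain ⟨a, -, φ, hφ, ha⟩ := WeakDual.isSeqCompact_closedBall ℝ _ (0 : StrongDual ℝ (Lp ℝ 2 μ)) (√K)
    (x := x) (fun n => by
      simp only [mem_preimage, mem_closedBall, dist_zero_right, hx]
      refine le_trans (le_of_eq ?_) (norm_le n)
      exact (InnerProductSpace.toDual ℝ (Lp ℝ 2 μ)).norm_map (G n))
  set g' : Lp ℝ 2 μ := (InnerProductSpace.toDual ℝ (Lp ℝ 2 μ)).symm (WeakDual.toStrongDual a) with hg'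
  have conv : ∀ f : Lp ℝ 2 μ, Tendsto (fun n => inner ℝ (G (φ n)) f) atTop (𝓝 (inner ℝ g' f)) := by
    intro f
    have h1 := _root_.tendsto_iff_forall_eval_tendsto_topDualPairing.1 ha f
    have e : inner ℝ g' f = a f := by
      have := (InnerProductSpace.toDual ℝ (Lp ℝ 2 μ)).apply_symm_apply (WeakDual.toStrongDual a)
      have h2 := congrArg (fun L : StrongDual ℝ (Lp ℝ 2 μ) => L f) this
      exact h2
    rw [e]
    exact h1
  have i2' : Integrable (fun r => (g' : ℝ → ℝ) r ^ 2) μ := (Lp.memLp g').integrable_sq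
  have i1' : Integrable (fun r => (g' : ℝ → ℝ) r) μ := (Lp.memLp g').integrable (by norm_num)
  have I1 : IntervalIntegrable (fun r => (g' : ℝ → ℝ) r) volume 0 R :=
    (intervalIntegrable_iff_integrableOn_Ioc_of_le hR).2 i1'
  have I2 : IntervalIntegrable (fun r => (g' : ℝ → ℝ) r ^ 2) volume 0 R :=
    (intervalIntegrable_iff_integrableOn_Ioc_of_le hR).2 i2'
  have pt : ∀ r ∈ Icc 0 R, Tendsto (fun n => w (φ n) r) atTop (𝓝 (∫ t in (0 : ℝ)..r, g' t)) := by
    intro r hr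
    set f : Lp ℝ 2 μ := indicatorConstLp 2 (measurableSet_Ioc (a := (0 : ℝ)) (b := r))
      (ne_top_of_le_ne_top (measure_Ioc_lt_top (a := (0:ℝ)) (b := r)).ne (Measure.restrict_apply_le _ _)) (1 : ℝ) with hf
    have key : ∀ u : Lp ℝ 2 μ, inner ℝ u f = ∫ t in (0 : ℝ)..r, (u : ℝ → ℝ) t := by
      intro u
      have e : μ.restrict (Ioc 0 r) = volume.restrict (Ioc 0 r) := by
        rw [hμ, Measure.restrict_restrict measurableSet_Ioc,
          inter_eq_left.2 (Ioc_subset_Ioc_right hr.2)]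
      rw [real_inner_comm, hf, L2.inner_indicatorConstLp_one, intervalIntegral.integral_of_le hr.1]
      exact congrArg (fun ν => ∫ t, (u : ℝ → ℝ) t ∂ν) e
    have := conv f
    rw [key] at this
    refine this.congr fun n => ?_
    rw [key, (h (φ n)).eq r hr]
    rw [intervalIntegral.integral_of_le hr.1, intervalIntegral.integral_of_le hr.1]
    refine integral_congr_ae ?_
    have := (mem (φ n)).coeFn_toLp
    exact ae_restrict_of_ae_restrict_of_subset (Ioc_subset_Ioc_right hr.2) this
  refine ⟨φ, fun r => ∫ t in (0 : ℝ)..r, g' t, g', hφ, ⟨I1, I2, fun _ _ => rfl, ?_⟩, pt, ?_⟩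
  · have := pt R ⟨hR, le_rfl⟩
    simp only [(h _).zero] at this
    exact (tendsto_nhds_unique this tendsto_const_nhds)
  · have := conv g'
    have e : inner ℝ g' g' = ∫ r in (0 : ℝ)..R, (g' : ℝ → ℝ) r ^ 2 := by
      rw [L2.inner_def, intervalIntegral.integral_of_le hR]
      exact integral_congr_ae (Eventually.of_forall fun r => by simp [pow_two])
    rw [e] at this
    refine this.congr fun n => ?_
    rw [inn, intervalIntegral.integral_of_le hR]

lemma Adm.sub {R : ℝ} {w g v k : ℝ → ℝ} (hw : Adm R w g) (hv : Adm R v k) :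
    Adm R (fun r => w r - v r) (fun r => g r - k r) := by
  have h := hw.add (hv.smul (-1))
  have e1 : (fun r => w r + -1 * v r) = fun r => w r - v r := by ext r; ring
  have e2 : (fun r => g r + -1 * k r) = fun r => g r - k r := by ext r; ring
  rw [e1, e2] at h
  exact h

/-- The nonlinearity `(x⁺)⁵ y`. -/
def pp (x y : ℝ) : ℝ := (max x 0) ^ 5 * y

lemma continuous_pp : Continuous fun p : ℝ × ℝ => pp p.1 p.2 := by unfold pp; fun_prop

lemma abs_pp_le (x y : ℝ) : |pp x y| ≤ |x| ^ 5 * |y| := by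
  unfold pp
  rw [abs_mul, abs_pow, abs_of_nonneg (le_max_right x 0)]
  gcongr
  exact max_le (le_abs_self x) (abs_nonneg x)

lemma pow_five_sub_le {x y m : ℝ} (hx : 0 ≤ x) (hy : 0 ≤ y) (hxm : x ≤ m) (hym : y ≤ m) :
    |x ^ 5 - y ^ 5| ≤ 5 * m ^ 4 * |x - y| := by
  have e : x ^ 5 - y ^ 5 = (x ^ 4 + x ^ 3 * y + x ^ 2 * y ^ 2 + x * y ^ 3 + y ^ 4) * (x - y) := by ring
  rw [e, abs_mul, abs_of_nonneg (by positivity)]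
  have hm : 0 ≤ m := hx.trans hxm
  gcongr
  calc x ^ 4 + x ^ 3 * y + x ^ 2 * y ^ 2 + x * y ^ 3 + y ^ 4
      ≤ m ^ 4 + m ^ 3 * m + m ^ 2 * m ^ 2 + m * m ^ 3 + m ^ 4 := by gcongr
    _ = 5 * m ^ 4 := by ring

lemma pp_sub_le {a b w z s t : ℝ} (ha : |a| ≤ s) (hb : |b| ≤ s) (hw : |w| ≤ t) (hz : |z| ≤ t) :
    |pp (a + w) (b + z) - pp a b| ≤ 6 * (s + t) ^ 5 * t := by
  have hs : 0 ≤ s := (abs_nonneg a).trans ha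
  have ht : 0 ≤ t := (abs_nonneg w).trans hw
  unfold pp
  set x := max (a + w) 0
  set y := max a 0
  have hy : y ≤ s := max_le ((le_abs_self a).trans ha) hs
  have hx : x ≤ s + t := max_le (add_le_add ((le_abs_self a).trans ha) ((le_abs_self w).trans hw)) (by positivity)
  have hxy : |x - y| ≤ t := by
    refine (abs_max_sub_max_le_abs (a + w) a 0).trans ?_
    simpa using hw
  have hx0 : 0 ≤ x := le_max_right _ _
  have hy0 : 0 ≤ y := le_max_right _ _
  have e : x ^ 5 * (b + z) - y ^ 5 * b = (x ^ 5 - y ^ 5) * (b + z) + y ^ 5 * z := by ring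
  rw [e]
  calc |(x ^ 5 - y ^ 5) * (b + z) + y ^ 5 * z|
      ≤ |x ^ 5 - y ^ 5| * |b + z| + y ^ 5 * |z| := by
        refine (abs_add_le _ _).trans ?_
        rw [abs_mul, abs_mul, abs_of_nonneg (pow_nonneg hy0 5)]
    _ ≤ (5 * (s + t) ^ 4 * t) * (s + t) + (s + t) ^ 5 * t := by
        gcongr
        · exact (pow_five_sub_le hx0 hy0 hx (by linarith)).trans (by gcongr)
        · exact (abs_add_le _ _).trans (by gcongr)
        · linarith
    _ = 6 * (s + t) ^ 5 * t := by ring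

lemma max_abs_pow_six_le (a b : ℝ) : (max |a| |b|) ^ 6 ≤ a ^ 6 + b ^ 6 := by
  have h6 : ∀ x : ℝ, |x| ^ 6 = x ^ 6 := fun x => Even.pow_abs (n := 6) (by decide) x
  have ha : 0 ≤ a ^ 6 := by positivity
  have hb : 0 ≤ b ^ 6 := by positivity
  rcases max_choice |a| |b| with h | h <;> rw [h, h6] <;> linarith

lemma brezis_lieb_pointwise {η : ℝ} (hη : 0 < η) : ∃ C : ℝ, 0 ≤ C ∧ ∀ a b w z : ℝ,
    |pp (a + w) (b + z) - pp a b - pp w z| ≤ η * (a ^ 6 + b ^ 6) + C * (w ^ 6 + z ^ 6) := by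
  set κ := min 1 (η / 192) with hκ
  have k0 : 0 < κ := lt_min one_pos (by positivity)
  have k1 : κ ≤ 1 := min_le_left _ _
  have k2 : 192 * κ ≤ η := by have := min_le_right 1 (η / 192); rw [← hκ] at this; linarith
  refine ⟨6 * (1 / κ + 1) ^ 5 + 1, by positivity, fun a b w z => ?_⟩
  set s := max |a| |b| with hs
  set t := max |w| |z| with ht
  have hs0 : 0 ≤ s := (abs_nonneg a).trans (le_max_left _ _)
  have ht0 : 0 ≤ t := (abs_nonneg w).trans (le_max_left _ _)
  have h1 := pp_sub_le (le_max_left |a| |b|) (le_max_right |a| |b|) (le_max_left |w| |z|) (le_max_right |w| |z|)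
  rw [← hs, ← ht] at h1
  have h2 : |pp w z| ≤ t ^ 6 := by
    refine (abs_pp_le w z).trans ?_
    calc |w| ^ 5 * |z| ≤ t ^ 5 * t := by gcongr; exacts [le_max_left _ _, le_max_right _ _]
      _ = t ^ 6 := by ring
  have hsa := max_abs_pow_six_le a b
  have hta := max_abs_pow_six_le w z
  rw [← hs] at hsa
  rw [← ht] at hta
  have h3 : |pp (a + w) (b + z) - pp a b - pp w z| ≤ 6 * (s + t) ^ 5 * t + t ^ 6 :=
    (abs_sub _ _).trans (add_le_add h1 h2)
  have t6 : 0 ≤ t ^ 6 := by positivity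
  refine h3.trans ?_
  rcases le_total t (κ * s) with h | h
  · have hts : t ≤ s := h.trans (by nlinarith)
    have : 6 * (s + t) ^ 5 * t ≤ η * s ^ 6 := calc
      6 * (s + t) ^ 5 * t ≤ 6 * (s + s) ^ 5 * (κ * s) := by gcongr
      _ = 192 * κ * s ^ 6 := by ring
      _ ≤ _ := by gcongr
    have h4 : η * s ^ 6 ≤ η * (a ^ 6 + b ^ 6) := by gcongr
    have h5 : t ^ 6 ≤ (6 * (1 / κ + 1) ^ 5 + 1) * (w ^ 6 + z ^ 6) := by
      refine hta.trans (le_mul_of_one_le_left (t6.trans hta) ?_)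
      have : 0 ≤ 6 * (1 / κ + 1) ^ 5 := by positivity
      linarith
    linarith
  · have hst : s ≤ 1 / κ * t := by
      rw [one_div, ← div_eq_inv_mul, le_div_iff₀ k0]; linarith
    have : 6 * (s + t) ^ 5 * t + t ^ 6 ≤ (6 * (1 / κ + 1) ^ 5 + 1) * t ^ 6 := calc
      6 * (s + t) ^ 5 * t + t ^ 6 ≤ 6 * (1 / κ * t + t) ^ 5 * t + t ^ 6 := by gcongr
      _ = _ := by ring
    have h4 : (6 * (1 / κ + 1) ^ 5 + 1) * t ^ 6 ≤ (6 * (1 / κ + 1) ^ 5 + 1) * (w ^ 6 + z ^ 6) := by gcongr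
    have h5 : 0 ≤ η * (a ^ 6 + b ^ 6) := by positivity
    linarith

/-- Dirichlet energy. -/
def En (R : ℝ) (g : ℝ → ℝ) : ℝ := ∫ r in (0 : ℝ)..R, g r ^ 2

/-- Quadratic form `∫ g² - λ ∫ w²`. -/
def Nn (R lam : ℝ) (w g : ℝ → ℝ) : ℝ := En R g - lam * ∫ r in (0 : ℝ)..R, w r ^ 2

/-- The interaction functional. -/
def PP (R : ℝ) (w z : ℝ → ℝ) : ℝ := ∫ r in Ioc 0 R, pp (w r) (z r) / r ^ 4

lemma aesm_pp {R : ℝ} (hR : 0 < R) {w g z k : ℝ → ℝ} (hw : Adm R w g) (hz : Adm R z k) :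
    AEStronglyMeasurable (fun r => pp (w r) (z r) / r ^ 4) (volume.restrict (Ioc 0 R)) := by
  have := continuous_pp.comp_aestronglyMeasurable ((hw.aesm hR.le).prodMk (hz.aesm hR.le))
  exact (AEMeasurable.div this.aemeasurable (by fun_prop)).aestronglyMeasurable

lemma PP_integrable {R : ℝ} (hR : 0 < R) {w g z k : ℝ → ℝ} (hw : Adm R w g) (hz : Adm R z k) :
    IntegrableOn (fun r => pp (w r) (z r) / r ^ 4) (Ioc 0 R) := by
  refine Integrable.mono' (hw.pair_integrable hR hz) (aesm_pp hR hw hz) (Eventually.of_forall fun r => ?_)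
  rw [Real.norm_eq_abs, abs_div, abs_of_nonneg (show (0 : ℝ) ≤ r ^ 4 by positivity)]
  gcongr
  exact abs_pp_le _ _

lemma abs_PP_le {R : ℝ} (hR : 0 < R) {w g z k : ℝ → ℝ} (hw : Adm R w g) (hz : Adm R z k) :
    |PP R w z| ≤ Sstar * √(En R g) ^ 5 * √(En R k) := by
  refine le_trans ?_ (hw.pair_le hR hz)
  refine (abs_integral_le_integral_abs).trans ?_
  refine integral_mono (PP_integrable hR hw hz).abs (hw.pair_integrable hR hz) fun r => ?_
  simp only
  rw [abs_div, abs_of_nonneg (show (0 : ℝ) ≤ r ^ 4 by positivity)]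
  gcongr
  exact abs_pp_le _ _

lemma pp_smul {c d : ℝ} (hc : 0 ≤ c) (x y : ℝ) : pp (c * x) (d * y) = c ^ 5 * d * pp x y := by
  unfold pp
  have : max (c * x) 0 = c * max x 0 := by rw [mul_max_of_nonneg _ _ hc, mul_zero]
  rw [this]; ring

lemma PP_smul {R c d : ℝ} (hc : 0 ≤ c) (w z : ℝ → ℝ) :
    PP R (fun r => c * w r) (fun r => d * z r) = c ^ 5 * d * PP R w z := by
  unfold PP
  rw [← integral_const_mul]
  congr 1; ext r; rw [pp_smul hc]; ring

lemma En_smul {R : ℝ} (c : ℝ) (g : ℝ → ℝ) : En R (fun r => c * g r) = c ^ 2 * En R g := by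
  unfold En
  rw [← intervalIntegral.integral_const_mul]
  congr 1; ext r; ring

lemma Nn_smul {R lam : ℝ} (c : ℝ) (w g : ℝ → ℝ) :
    Nn R lam (fun r => c * w r) (fun r => c * g r) = c ^ 2 * Nn R lam w g := by
  unfold Nn
  have : ∫ r in (0 : ℝ)..R, (c * w r) ^ 2 = c ^ 2 * ∫ r in (0 : ℝ)..R, w r ^ 2 := by
    rw [← intervalIntegral.integral_const_mul]
    congr 1; ext r; ring
  rw [En_smul, this]; ring

lemma En_nonneg {R : ℝ} (hR : 0 ≤ R) (g : ℝ → ℝ) : 0 ≤ En R g :=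
  intervalIntegral.integral_nonneg hR fun _ _ => sq_nonneg _

lemma Nn_coercive {R lam : ℝ} (hR : 0 < R) (h0 : 0 < lam) (h1 : lam < π ^ 2 / R ^ 2) :
    ∃ c : ℝ, 0 < c ∧ ∀ w g : ℝ → ℝ, Adm R w g → c * En R g ≤ Nn R lam w g := by
  set μ := (lam + π ^ 2 / R ^ 2) / 2 with hμ
  have m1 : lam < μ := by linarith
  have m2 : μ < π ^ 2 / R ^ 2 := by linarith
  have m0 : 0 < μ := by linarith
  refine ⟨1 - lam / μ, by rw [sub_pos, div_lt_one m0]; exact m1, fun w g h => ?_⟩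
  have := h.poincare hR m0 m2
  unfold Nn En
  have h2 : lam * ∫ r in (0 : ℝ)..R, w r ^ 2 ≤ lam / μ * ∫ r in (0 : ℝ)..R, g r ^ 2 := by
    calc lam * ∫ r in (0 : ℝ)..R, w r ^ 2 = lam / μ * (μ * ∫ r in (0 : ℝ)..R, w r ^ 2) := by field_simp
      _ ≤ _ := by gcongr
  linarith

/-- Brezis–Lieb decomposition of the interaction functional. -/
lemma brezis_lieb {R : ℝ} (hR : 0 < R) {w g z k : ℕ → ℝ → ℝ} {w' g' z' k' : ℝ → ℝ}
    (hw : ∀ n, Adm R (w n) (g n)) (hz : ∀ n, Adm R (z n) (k n))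
    (hw' : Adm R w' g') (hz' : Adm R z' k') {K : ℝ}
    (hK : ∀ n, En R (fun r => g n r - g' r) ≤ K) (hK' : ∀ n, En R (fun r => k n r - k' r) ≤ K)
    (cw : ∀ r ∈ Icc 0 R, Tendsto (fun n => w n r) atTop (𝓝 (w' r)))
    (cz : ∀ r ∈ Icc 0 R, Tendsto (fun n => z n r) atTop (𝓝 (z' r))) :
    Tendsto (fun n => PP R (w n) (z n) - PP R (fun r => w n r - w' r) (fun r => z n r - z' r)) atTop
      (𝓝 (PP R w' z')) := by
  have K0 : 0 ≤ K := (En_nonneg hR.le _).trans (hK 0)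
  have aw := fun n => (hw n).sub hw'
  have az := fun n => (hz n).sub hz'
  set f : ℕ → ℝ → ℝ := fun n r => |pp (w n r) (z n r) - pp (w n r - w' r) (z n r - z' r) - pp (w' r) (z' r)| / r ^ 4 with hf
  have fint : ∀ n, IntegrableOn (f n) (Ioc 0 R) := by
    intro n
    have := (((PP_integrable hR (hw n) (hz n)).sub (PP_integrable hR (aw n) (az n))).sub
      (PP_integrable hR hw' hz')).abs
    refine this.congr (Eventually.of_forall fun r => ?_)
    simp only [hf, Pi.sub_apply]
    rw [← sub_div, ← sub_div, abs_div, abs_of_nonneg (show (0 : ℝ) ≤ r ^ 4 by positivity)]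
  have key : ∀ n, |PP R (w n) (z n) - PP R (fun r => w n r - w' r) (fun r => z n r - z' r) - PP R w' z'| ≤
      ∫ r in Ioc 0 R, f n r := by
    intro n
    unfold PP
    have i12 : IntegrableOn (fun r => pp (w n r) (z n r) / r ^ 4 -
        pp (w n r - w' r) (z n r - z' r) / r ^ 4) (Ioc 0 R) :=
      (PP_integrable hR (hw n) (hz n)).sub (PP_integrable hR (aw n) (az n))
    rw [← integral_sub (PP_integrable hR (hw n) (hz n)) (PP_integrable hR (aw n) (az n)),
      ← integral_sub i12 (PP_integrable hR hw' hz')]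
    refine abs_integral_le_integral_abs.trans (le_of_eq ?_)
    congr 1; ext r
    simp only [hf]
    rw [← sub_div, ← sub_div, abs_div, abs_of_nonneg (show (0 : ℝ) ≤ r ^ 4 by positivity)]
  set B := 2 * (Sstar * K ^ 3) with hB
  have B0 : 0 ≤ B := by have := Sstar_pos; positivity
  rw [tendsto_iff_norm_sub_tendsto_zero]
  refine squeeze_zero (fun _ => norm_nonneg _) key ?_
  rw [Metric.tendsto_atTop]
  intro ε hε
  set η := ε / (2 * (B + 1)) with hη
  have η0 : 0 < η := by positivity
  obtain ⟨C, C0, hC⟩ := brezis_lieb_pointwise η0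
  set S : ℕ → ℝ → ℝ := fun n r => η * ((w n r - w' r) ^ 6 / r ^ 4 + (z n r - z' r) ^ 6 / r ^ 4) with hS
  have Sint : ∀ n, IntegrableOn (S n) (Ioc 0 R) := fun n =>
    (((aw n).bliss hR).1.add ((az n).bliss hR).1).const_mul η
  have Sle : ∀ n, ∫ r in Ioc 0 R, S n r ≤ η * B := by
    intro n
    have e : ∫ r in Ioc 0 R, S n r = η * ((∫ r in Ioc 0 R, (w n r - w' r) ^ 6 / r ^ 4) +
        ∫ r in Ioc 0 R, (z n r - z' r) ^ 6 / r ^ 4) := by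
      rw [← integral_add ((aw n).bliss hR).1 ((az n).bliss hR).1, ← integral_const_mul]
    have h1 := ((aw n).bliss hR).2
    have h2 := ((az n).bliss hR).2
    rw [intervalIntegral.integral_of_le hR.le] at h1 h2
    have := Sstar_pos
    have h3 : Sstar * (∫ r in (0:ℝ)..R, (g n r - g' r) ^ 2) ^ 3 ≤ Sstar * K ^ 3 := by
      gcongr
      · exact (En_nonneg hR.le (fun r => g n r - g' r))
      · exact hK n
    have h4 : Sstar * (∫ r in (0:ℝ)..R, (k n r - k' r) ^ 2) ^ 3 ≤ Sstar * K ^ 3 := by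
      gcongr
      · exact (En_nonneg hR.le (fun r => k n r - k' r))
      · exact hK' n
    rw [e, hB]
    gcongr
    linarith
  have lim : Tendsto (fun n => ∫ r in Ioc 0 R, max (f n r - S n r) 0) atTop (𝓝 (∫ r in Ioc 0 R, (0 : ℝ))) := by
    refine tendsto_integral_of_dominated_convergence (fun r => C * (w' r ^ 6 / r ^ 4 + z' r ^ 6 / r ^ 4)) ?_ ?_ ?_ ?_
    · intro n
      exact ((fint n).sub (Sint n)).pos_part.aestronglyMeasurable
    · exact ((hw'.bliss hR).1.add (hz'.bliss hR).1).const_mul C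
    · intro n
      refine Eventually.of_forall fun r => ?_
      rw [Real.norm_eq_abs, abs_of_nonneg (le_max_right _ _)]
      have := hC (w n r - w' r) (z n r - z' r) (w' r) (z' r)
      rw [sub_add_cancel, sub_add_cancel] at this
      refine max_le ?_ (by positivity)
      simp only [hf, hS]
      have h4 : (0:ℝ) ≤ r ^ 4 := by positivity
      have := div_le_div_of_nonneg_right this h4
      refine (sub_le_sub_right this _).trans (le_of_eq ?_)
      ring
    · filter_upwards [ae_restrict_mem measurableSet_Ioc] with r hr
      have hr' : r ∈ Icc 0 R := Ioc_subset_Icc_self hr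
      have h1 := cw r hr'
      have h2 := cz r hr'
      have l1 := (continuous_pp.tendsto (w' r, z' r)).comp (h1.prodMk_nhds h2)
      have h3 : Tendsto (fun n => w n r - w' r) atTop (𝓝 0) := by simpa using h1.sub_const (w' r)
      have h4 : Tendsto (fun n => z n r - z' r) atTop (𝓝 0) := by simpa using h2.sub_const (z' r)
      have l2 := (continuous_pp.tendsto (0, 0)).comp (h3.prodMk_nhds h4)
      have l3 : Tendsto (fun n => f n r) atTop (𝓝 0) := by
        have := (((l1.sub l2).sub_const (pp (w' r) (z' r))).abs.div_const (r ^ 4))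
        simpa [pp, hf, Function.comp_def] using this
      have l4 : Tendsto (fun n => S n r) atTop (𝓝 0) := by
        have := (((h3.pow 6).div_const (r ^ 4)).add ((h4.pow 6).div_const (r ^ 4))).const_mul η
        simpa [hS] using this
      have := (l3.sub l4).max (tendsto_const_nhds (x := (0 : ℝ)))
      simpa using this
  rw [integral_zero, Metric.tendsto_atTop] at lim
  obtain ⟨N, hN⟩ := lim (ε / 2) (by positivity)
  refine ⟨N, fun n hn => ?_⟩
  have h1 := hN n hn
  rw [dist_zero_right, Real.norm_eq_abs] at h1
  rw [dist_zero_right, Real.norm_eq_abs, abs_of_nonneg (integral_nonneg fun r => by simp only [hf]; positivity)]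
  have h2 : ∫ r in Ioc 0 R, f n r ≤ (∫ r in Ioc 0 R, max (f n r - S n r) 0) + ∫ r in Ioc 0 R, S n r := by
    have ip : IntegrableOn (fun r => max (f n r - S n r) 0) (Ioc 0 R) :=
      ((fint n).sub (Sint n)).pos_part
    rw [← integral_add ip (Sint n)]
    refine integral_mono (fint n) (ip.add (Sint n)) fun r => ?_
    have := le_max_left (f n r - S n r) 0
    simp only
    linarith
  have h3 := Sle n
  have h4 : η * B < ε / 2 := by
    rw [hη, div_mul_eq_mul_div, div_lt_div_iff₀ (by positivity) (by norm_num)]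
    nlinarith
  have h5 := (abs_lt.1 h1).2
  linarith

lemma En_sub {R : ℝ} {w g v k : ℝ → ℝ} (hw : Adm R w g) (hv : Adm R v k) :
    En R (fun r => g r - k r) = En R g - 2 * (∫ r in (0 : ℝ)..R, g r * k r) + En R k := by
  unfold En
  have h1 := hw.mul_int hv
  rw [← intervalIntegral.integral_const_mul, ← intervalIntegral.integral_sub hw.sq (h1.const_mul 2),
    ← intervalIntegral.integral_add (hw.sq.sub (h1.const_mul 2)) hv.sq]
  congr 1; ext r; ring

lemma tendsto_int_sq {R : ℝ} (hR : 0 ≤ R) {w g : ℕ → ℝ → ℝ} {w' : ℝ → ℝ} (h : ∀ n, Adm R (w n) (g n))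
    {K : ℝ} (hK : ∀ n, En R (g n) ≤ K)
    (cw : ∀ r ∈ Icc 0 R, Tendsto (fun n => w n r) atTop (𝓝 (w' r))) :
    Tendsto (fun n => ∫ r in (0 : ℝ)..R, w n r ^ 2) atTop (𝓝 (∫ r in (0 : ℝ)..R, w' r ^ 2)) := by
  refine intervalIntegral.tendsto_integral_filter_of_dominated_convergence (fun _ => R * K) ?_ ?_ ?_ ?_
  · exact Eventually.of_forall fun n => (intervalIntegrable_iff.1 ((h n).sq_int_w hR)).aestronglyMeasurable
  · refine Eventually.of_forall fun n => Eventually.of_forall fun r hr => ?_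
    rw [uIoc_of_le hR] at hr
    rw [Real.norm_eq_abs, abs_of_nonneg (_root_.sq_nonneg _)]
    refine ((h n).sq_le' (Ioc_subset_Icc_self hr)).trans ?_
    exact mul_le_mul hr.2 (hK n) (En_nonneg hR _) hR
  · exact intervalIntegrable_const
  · refine Eventually.of_forall fun r hr => ?_
    rw [uIoc_of_le hR] at hr
    exact (cw r (Ioc_subset_Icc_self hr)).pow 2

lemma mass_one_of_le {M S α β P : ℝ} (hS : 0 < S) (hSM : S < M) (a0 : 0 ≤ α) (a1 : α ≤ 1) (b0 : 0 ≤ β)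
    (b1 : β ≤ 1) (h1 : M ≤ P + S * √(1 - α) ^ 5 * √(1 - β)) (h2 : P ≤ M * √α ^ 5 * √β) :
    α = 1 ∧ β = 1 := by
  set a := √α
  set b := √β
  set c := √(1 - α)
  set d := √(1 - β)
  have ha : a ^ 2 = α := Real.sq_sqrt a0
  have hb : b ^ 2 = β := Real.sq_sqrt b0
  have hc : c ^ 2 = 1 - α := Real.sq_sqrt (by linarith)
  have hd : d ^ 2 = 1 - β := Real.sq_sqrt (by linarith)
  have pa : 0 ≤ a := Real.sqrt_nonneg _
  have pb : 0 ≤ b := Real.sqrt_nonneg _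
  have pc : 0 ≤ c := Real.sqrt_nonneg _
  have pd : 0 ≤ d := Real.sqrt_nonneg _
  have ha1 : a ≤ 1 := by nlinarith
  have hb1 : b ≤ 1 := by nlinarith
  have hc1 : c ≤ 1 := by nlinarith
  have hd1 : d ≤ 1 := by nlinarith
  have a5 : a ^ 5 ≤ a := by simpa using pow_le_pow_of_le_one pa ha1 (show 1 ≤ 5 by norm_num)
  have c5 : c ^ 5 ≤ c := by simpa using pow_le_pow_of_le_one pc hc1 (show 1 ≤ 5 by norm_num)
  have hab : a ^ 5 * b + c ^ 5 * d ≤ 1 := by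
    have h3 : a ^ 5 * b ≤ a * b := by gcongr
    have h4 : c ^ 5 * d ≤ c * d := by gcongr
    nlinarith [sq_nonneg (a - b), sq_nonneg (c - d)]
  have M0 : 0 < M := hS.trans hSM
  have p5 : 0 ≤ c ^ 5 * d := by positivity
  have hz : c ^ 5 * d = 0 := by
    by_contra hne
    have p6 : 0 < c ^ 5 * d := lt_of_le_of_ne p5 (Ne.symm hne)
    nlinarith [mul_lt_mul_of_pos_right hSM p6]
  have h5 : M ≤ M * (a ^ 5 * b) := by
    have : S * c ^ 5 * d = 0 := by rw [mul_assoc, hz, mul_zero]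
    linarith
  have h6 : 1 ≤ a ^ 5 * b := by
    by_contra h; push Not at h; nlinarith
  have a1' : 1 ≤ a := by nlinarith [mul_le_mul a5 hb1 pb pa]
  have b1' : 1 ≤ b := by
    have : a ^ 5 ≤ 1 := a5.trans ha1
    nlinarith [mul_le_mul_of_nonneg_right this pb]
  have e1 : a = 1 := le_antisymm ha1 a1'
  have e2 : b = 1 := le_antisymm hb1 b1'
  rw [← ha, ← hb, e1, e2]; norm_num

/-- The sharp constant of the radial quotient is attained. -/
theorem exists_maximizer {R lam : ℝ} (hR : 0 < R) (hlow : 3 / 10 * (π ^ 2 / R ^ 2) < lam)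
    (hhigh : lam < π ^ 2 / R ^ 2) :
    ∃ (M : ℝ) (w g z k : ℝ → ℝ), 0 < M ∧ Adm R w g ∧ Adm R z k ∧ Nn R lam w g = 1 ∧ En R k = 1 ∧
      PP R w z = M ∧ ∀ w' g' z' k' : ℝ → ℝ, Adm R w' g' → Adm R z' k' →
        PP R w' z' ≤ M * √(Nn R lam w' g') ^ 5 * √(En R k') := by
  have lam0 : 0 < lam := lt_trans (by positivity) hlow
  obtain ⟨c, c0, hc⟩ := Nn_coercive hR lam0 hhigh
  have S0 := Sstar_pos
  set S : Set ℝ := {p | ∃ w g z k : ℝ → ℝ, Adm R w g ∧ Adm R z k ∧ Nn R lam w g ≤ 1 ∧ En R k ≤ 1 ∧ PP R w z = p} with hS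
  have Ebd : ∀ w g : ℝ → ℝ, Adm R w g → Nn R lam w g ≤ 1 → En R g ≤ 1 / c := by
    intro w g h h1
    rw [le_div_iff₀ c0]; linarith [hc w g h]
  have bdd : BddAbove S := by
    refine ⟨Sstar * √(1 / c) ^ 5 * √1, ?_⟩
    rintro p ⟨w, g, z, k, hw, hz, h1, h2, rfl⟩
    refine (le_abs_self _).trans ((abs_PP_le hR hw hz).trans ?_)
    gcongr
    exact Ebd w g hw h1
  set M := sSup S with hM
  have hom : ∀ w' g' z' k' : ℝ → ℝ, Adm R w' g' → Adm R z' k' →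
        PP R w' z' ≤ M * √(Nn R lam w' g') ^ 5 * √(En R k') := by
    intro w g z k hw hz
    have hN0 : 0 ≤ Nn R lam w g := (mul_nonneg c0.le (En_nonneg hR.le g)).trans (hc w g hw)
    rcases hN0.eq_or_lt with h | h
    · have h2 := hc w g hw
      have h3 : En R g = 0 := by
        refine le_antisymm ?_ (En_nonneg hR.le g)
        by_contra h4; push Not at h4; nlinarith
      have := (le_abs_self _).trans (abs_PP_le hR hw hz)
      rw [h3] at this
      rw [← h]; simpa using this
    rcases (En_nonneg hR.le k).eq_or_lt with h' | h'
    · have := (le_abs_self _).trans (abs_PP_le hR hw hz)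
      rw [← h'] at this
      rw [← h']; simpa using this
    set a := √(Nn R lam w g) with ha
    set b := √(En R k) with hb
    have a0 : 0 < a := Real.sqrt_pos.2 h
    have b0 : 0 < b := Real.sqrt_pos.2 h'
    have a2 : a ^ 2 = Nn R lam w g := Real.sq_sqrt h.le
    have b2 : b ^ 2 = En R k := Real.sq_sqrt h'.le
    have mem : PP R (fun r => a⁻¹ * w r) (fun r => b⁻¹ * z r) ∈ S := by
      refine ⟨_, _, _, _, hw.smul a⁻¹, hz.smul b⁻¹, ?_, ?_, rfl⟩
      · rw [Nn_smul, ← a2]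
        refine le_of_eq ?_
        field_simp
      · rw [En_smul, ← b2]
        refine le_of_eq ?_
        field_simp
    have := le_csSup bdd mem
    rw [PP_smul (by positivity), ← hM] at this
    have e : PP R w z = (a⁻¹ ^ 5 * b⁻¹ * PP R w z) * a ^ 5 * b := by
      clear_value a b
      field_simp
    rw [e]
    gcongr
  have SM : Sstar < M := by
    obtain ⟨w, g, z, k, hw, hz, w0, z0, hlt⟩ := exists_test hR hlow hhigh
    have e : ∫ r in Ioc 0 R, w r ^ 5 * z r / r ^ 4 = PP R w z := by
      refine setIntegral_congr_fun measurableSet_Ioc fun r hr => ?_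
      simp only [pp]
      rw [max_eq_left (w0 r (Ioc_subset_Icc_self hr))]
    rw [e] at hlt
    have := hom w g z k hw hz
    by_contra hcon
    push Not at hcon
    have h2 : M * √(Nn R lam w g) ^ 5 * √(En R k) ≤ Sstar * √(Nn R lam w g) ^ 5 * √(En R k) := by gcongr
    exact absurd (hlt.trans_le (this.trans h2)) (lt_irrefl _)
  have M0 : 0 < M := S0.trans SM
  have ne : S.Nonempty := by
    by_contra h
    rw [not_nonempty_iff_eq_empty] at h
    rw [hM, h, Real.sSup_empty] at M0
    exact lt_irrefl _ M0
  obtain ⟨u, -, hu, hmem⟩ := exists_seq_tendsto_sSup ne bdd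
  choose w g z k hw hz hN hT hP using hmem
  obtain ⟨φ, w', g', hφ, hw', cw, cg⟩ := Adm.weak_compact hR.le hw (fun n => Ebd _ _ (hw n) (hN n))
  obtain ⟨χ, z', k', hχ, hz', cz, ck⟩ := Adm.weak_compact hR.le (fun n => hz (φ n)) (fun n => hT (φ n))
  set θ : ℕ → ℕ := fun n => φ (χ n) with hθ
  have cw2 : ∀ r ∈ Icc 0 R, Tendsto (fun n => w (θ n) r) atTop (𝓝 (w' r)) :=
    fun r hr => (cw r hr).comp hχ.tendsto_atTop
  have cg2 := cg.comp hχ.tendsto_atTop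
  have cP : Tendsto (fun n => PP R (w (θ n)) (z (θ n))) atTop (𝓝 M) := by
    have := hu.comp ((hφ.comp hχ).tendsto_atTop)
    exact this.congr fun n => (hP _).symm
  have cI := tendsto_int_sq hR.le (fun n => hw (θ n)) (fun n => Ebd _ _ (hw (θ n)) (hN (θ n))) cw2
  set X : ℕ → ℝ := fun n => 1 + lam * (∫ r in (0 : ℝ)..R, w (θ n) r ^ 2) -
    2 * (∫ r in (0 : ℝ)..R, g (θ n) r * g' r) + En R g' with hX
  set Y : ℕ → ℝ := fun n => 1 - 2 * (∫ r in (0 : ℝ)..R, k (θ n) r * k' r) + En R k' with hY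
  have hXl : ∀ n, En R (fun r => g (θ n) r - g' r) ≤ X n := by
    intro n
    rw [En_sub (hw _) hw']
    have := hN (θ n)
    unfold Nn at this
    simp only [hX]; linarith
  have hYl : ∀ n, En R (fun r => k (θ n) r - k' r) ≤ Y n := by
    intro n
    rw [En_sub (hz _) hz']
    have := hT (θ n)
    simp only [hY]; linarith
  have cX : Tendsto X atTop (𝓝 (1 - Nn R lam w' g')) := by
    have := (((cI.const_mul lam).const_add 1).sub (cg2.const_mul 2)).add_const (En R g')
    refine Tendsto.congr (fun n => rfl) (this.trans (le_of_eq ?_))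
    congr 1
    unfold Nn En; ring
  have cY : Tendsto Y atTop (𝓝 (1 - En R k')) := by
    have := ((ck.const_mul 2).const_sub 1).add_const (En R k')
    refine Tendsto.congr (fun n => rfl) (this.trans (le_of_eq ?_))
    congr 1
    unfold En; ring
  obtain ⟨K1, hK1⟩ := cX.bddAbove_range
  obtain ⟨K2, hK2⟩ := cY.bddAbove_range
  have cBL := brezis_lieb hR (fun n => hw (θ n)) (fun n => hz (θ n)) hw' hz' (K := max K1 K2)
    (fun n => (hXl n).trans ((hK1 (mem_range_self n)).trans (le_max_left _ _)))
    (fun n => (hYl n).trans ((hK2 (mem_range_self n)).trans (le_max_right _ _))) cw2 cz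
  have a1 : Nn R lam w' g' ≤ 1 := by
    have := ge_of_tendsto' cX (fun n => (En_nonneg hR.le _).trans (hXl n))
    linarith
  have b1 : En R k' ≤ 1 := by
    have := ge_of_tendsto' cY (fun n => (En_nonneg hR.le _).trans (hYl n))
    linarith
  have a0 : 0 ≤ Nn R lam w' g' := (mul_nonneg c0.le (En_nonneg hR.le g')).trans (hc _ _ hw')
  have b0 : 0 ≤ En R k' := En_nonneg hR.le _
  have up : M ≤ PP R w' z' + Sstar * √(1 - Nn R lam w' g') ^ 5 * √(1 - En R k') := by
    have l1 : Tendsto (fun n => Sstar * √(X n) ^ 5 * √(Y n)) atTop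
        (𝓝 (Sstar * √(1 - Nn R lam w' g') ^ 5 * √(1 - En R k'))) :=
      ((cX.sqrt.pow 5).const_mul _).mul cY.sqrt
    refine le_of_tendsto_of_tendsto' cP (cBL.add l1) fun n => ?_
    have h1 := (le_abs_self _).trans (abs_PP_le hR ((hw (θ n)).sub hw') ((hz (θ n)).sub hz'))
    have h2 : Sstar * √(En R fun r => g (θ n) r - g' r) ^ 5 * √(En R fun r => k (θ n) r - k' r) ≤
        Sstar * √(X n) ^ 5 * √(Y n) := by
      gcongr
      · exact hXl n
      · exact hYl n
    linarith
  have lo := hom w' g' z' k' hw' hz'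
  obtain ⟨e1, e2⟩ := mass_one_of_le S0 SM a0 a1 b0 b1 up lo
  refine ⟨M, w', g', z', k', M0, hw', hz', e1, e2, ?_, hom⟩
  rw [e1, e2] at up lo
  simp at up lo
  exact le_antisymm lo up

/-- `(w, z)` is a normalised maximiser of the radial quotient, with maximum `M`. -/
structure Maximizer (R lam M : ℝ) (w g z k : ℝ → ℝ) : Prop where
  pos : 0 < M
  admw : Adm R w g
  admz : Adm R z k
  Nn_one : Nn R lam w g = 1
  En_one : En R k = 1
  PP_eq : PP R w z = M
  le : ∀ w' g' z' k' : ℝ → ℝ, Adm R w' g' → Adm R z' k' →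
    PP R w' z' ≤ M * √(Nn R lam w' g') ^ 5 * √(En R k')

lemma En_add_smul {R : ℝ} {w g v k : ℝ → ℝ} (hw : Adm R w g) (hv : Adm R v k) (t : ℝ) :
    En R (fun r => g r + t * k r) = En R g + t * (2 * ∫ r in (0 : ℝ)..R, g r * k r) + t ^ 2 * En R k := by
  unfold En
  have h1 := hw.mul_int hv
  rw [← intervalIntegral.integral_const_mul, ← intervalIntegral.integral_const_mul,
    ← intervalIntegral.integral_const_mul,
    ← intervalIntegral.integral_add hw.sq ((h1.const_mul 2).const_mul t),
    ← intervalIntegral.integral_add (hw.sq.add ((h1.const_mul 2).const_mul t)) (hv.sq.const_mul (t ^ 2))]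
  congr 1; ext r; ring

lemma Nn_add_smul {R lam : ℝ} (hR : 0 ≤ R) {w g v k : ℝ → ℝ} (hw : Adm R w g) (hv : Adm R v k) (t : ℝ) :
    Nn R lam (fun r => w r + t * v r) (fun r => g r + t * k r) = Nn R lam w g +
      t * (2 * ((∫ r in (0 : ℝ)..R, g r * k r) - lam * ∫ r in (0 : ℝ)..R, w r * v r)) + t ^ 2 * Nn R lam v k := by
  unfold Nn
  have h0 : IntervalIntegrable (fun r => w r * v r) volume 0 R :=
    ContinuousOn.intervalIntegrable (by rw [uIcc_of_le hR]; exact (hw.cont hR).mul (hv.cont hR))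
  have e : ∫ r in (0 : ℝ)..R, (w r + t * v r) ^ 2 = (∫ r in (0 : ℝ)..R, w r ^ 2) +
      t * (2 * ∫ r in (0 : ℝ)..R, w r * v r) + t ^ 2 * ∫ r in (0 : ℝ)..R, v r ^ 2 := by
    rw [← intervalIntegral.integral_const_mul, ← intervalIntegral.integral_const_mul,
      ← intervalIntegral.integral_const_mul,
      ← intervalIntegral.integral_add (hw.sq_int_w hR) ((h0.const_mul 2).const_mul t),
      ← intervalIntegral.integral_add ((hw.sq_int_w hR).add ((h0.const_mul 2).const_mul t))
        ((hv.sq_int_w hR).const_mul (t ^ 2))]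
    congr 1; ext r; ring
  rw [En_add_smul hw hv, e]; ring

lemma pp_convex {x h z : ℝ} (hz : 0 ≤ z) : pp x z + 5 * ((max x 0) ^ 4 * h * z) ≤ pp (x + h) z := by
  unfold pp
  suffices H : (max x 0) ^ 5 + 5 * ((max x 0) ^ 4 * h) ≤ (max (x + h) 0) ^ 5 by nlinarith
  have key : ∀ a b : ℝ, 0 ≤ a → 0 ≤ b → a ^ 5 + 5 * (a ^ 4 * (b - a)) ≤ b ^ 5 := by
    intro a b ha hb
    have : b ^ 5 - (a ^ 5 + 5 * (a ^ 4 * (b - a))) = (b - a) ^ 2 * (b ^ 3 + 2 * a * b ^ 2 + 3 * a ^ 2 * b + 4 * a ^ 3) := by ring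
    have : 0 ≤ (b - a) ^ 2 * (b ^ 3 + 2 * a * b ^ 2 + 3 * a ^ 2 * b + 4 * a ^ 3) := by positivity
    linarith
  have h1 := key (max x 0) (max (x + h) 0) (le_max_right _ _) (le_max_right _ _)
  refine le_trans ?_ h1
  rcases le_total x 0 with hx | hx
  · rw [max_eq_right hx]; simp
  · rw [max_eq_left hx]
    have : x + h ≤ max (x + h) 0 := le_max_left _ _
    have h4 : 0 ≤ x ^ 4 := by positivity
    nlinarith

lemma nonneg_perturbation {M B C P n : ℝ} (m : ℕ) (hn : n = 1) (h : ∀ t : ℝ, M + t * P ≤ M * √(n + t * (2 * B) + t ^ 2 * C) ^ m) :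
    P = m * M * B := by
  subst hn
  have d0 : HasDerivAt (fun t : ℝ => 1 + t * (2 * B) + t ^ 2 * C) (2 * B) 0 := by
    have := (((hasDerivAt_id (0 : ℝ)).mul_const (2 * B)).const_add 1).add (((hasDerivAt_id (0 : ℝ)).pow 2).mul_const C)
    refine this.congr_deriv ?_
    simp
  have d1 := ((d0.sqrt (by norm_num)).pow m).const_mul M
  have d2 := d1.sub (((hasDerivAt_id (0 : ℝ)).mul_const P).const_add M)
  have lm : IsLocalMin ((fun t : ℝ => M * √(1 + t * (2 * B) + t ^ 2 * C) ^ m) - fun t => M + id t * P) 0 := by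
    refine Eventually.of_forall fun t => ?_
    have := h t
    simp
    linarith
  have := lm.hasDerivAt_eq_zero d2
  simp at this
  linarith

namespace Maximizer

variable {R lam M : ℝ} {w g z k : ℝ → ℝ}

lemma euler_z (hR : 0 < R) (h : Maximizer R lam M w g z k) {ζ κ : ℝ → ℝ} (hζ : Adm R ζ κ) :
    PP R w ζ = M * ∫ r in (0 : ℝ)..R, k r * κ r := by
  have := nonneg_perturbation (M := M) (B := ∫ r in (0 : ℝ)..R, k r * κ r) (C := En R κ) (P := PP R w ζ) 1 h.En_one (by
    intro t
    have h1 := h.le w g _ _ h.admw (h.admz.add (hζ.smul t))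
    rw [En_add_smul h.admz hζ, h.Nn_one] at h1
    have e : PP R w (fun r => z r + t * ζ r) = M + t * PP R w ζ := by
      rw [← h.PP_eq]
      unfold PP
      rw [← integral_const_mul, ← integral_add (PP_integrable hR h.admw h.admz)
        ((PP_integrable hR h.admw hζ).const_mul t)]
      congr 1; ext r; unfold pp; ring
    rw [e] at h1
    simpa using h1)
  simpa using this

lemma quad_integrable (hR : 0 < R) {v l y m η η' : ℝ → ℝ} (hw : Adm R v l) (hz : Adm R y m) (hη : Adm R η η') :
    IntegrableOn (fun r => (max (v r) 0) ^ 4 * η r * y r / r ^ 4) (Ioc 0 R) := by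
  refine Integrable.mono' (((hw.bliss hR).1.add (hz.bliss hR).1).add (hη.bliss hR).1) ?_ (Eventually.of_forall fun r => ?_)
  · have c : Continuous fun p : ℝ × ℝ × ℝ => (max p.1 0) ^ 4 * p.2.1 * p.2.2 := by fun_prop
    have := c.comp_aestronglyMeasurable ((hw.aesm hR.le).prodMk ((hη.aesm hR.le).prodMk (hz.aesm hR.le)))
    exact (AEMeasurable.div this.aemeasurable (by fun_prop)).aestronglyMeasurable
  · have h4 : (0 : ℝ) ≤ r ^ 4 := by positivity
    simp only [Pi.add_apply]
    rw [Real.norm_eq_abs, abs_div, abs_of_nonneg h4, ← add_div, ← add_div]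
    gcongr
    set s := max (max |v r| |η r|) |y r| with hs
    have b1 : |v r| ≤ s := (le_max_left _ _).trans (le_max_left _ _)
    have b2 : |η r| ≤ s := (le_max_right _ _).trans (le_max_left _ _)
    have b3 : |y r| ≤ s := le_max_right _ _
    have s0 : 0 ≤ s := (abs_nonneg _).trans b3
    have h6 : ∀ x : ℝ, |x| ^ 6 = x ^ 6 := fun x => Even.pow_abs (n := 6) (by decide) x
    have p : ∀ x : ℝ, 0 ≤ x ^ 6 := fun x => by positivity
    have m0 : 0 ≤ max (v r) 0 := le_max_right _ _
    have m1 : max (v r) 0 ≤ s := max_le ((le_abs_self _).trans b1) s0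
    have e : |max (v r) 0 ^ 4 * η r * y r| ≤ s ^ 6 := by
      rw [abs_mul, abs_mul, abs_of_nonneg (pow_nonneg m0 4)]
      calc max (v r) 0 ^ 4 * |η r| * |y r| ≤ s ^ 4 * s * s := by gcongr
        _ = s ^ 6 := by ring
    refine e.trans ?_
    have q1 := p (v r)
    have q2 := p (η r)
    have q3 := p (y r)
    rcases max_choice (max |v r| |η r|) |y r| with h | h
    · rcases max_choice |v r| |η r| with h' | h' <;> rw [hs, h, h', h6] <;> linarith
    · rw [hs, h, h6]; linarith

lemma euler_w (hR : 0 < R) (h : Maximizer R lam M w g z k) (hz : ∀ r ∈ Icc 0 R, 0 ≤ z r)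
    {η η' : ℝ → ℝ} (hη : Adm R η η') :
    ∫ r in Ioc 0 R, (max (w r) 0) ^ 4 * η r * z r / r ^ 4 =
      M * ((∫ r in (0 : ℝ)..R, g r * η' r) - lam * ∫ r in (0 : ℝ)..R, w r * η r) := by
  have := nonneg_perturbation (M := M)
    (B := (∫ r in (0 : ℝ)..R, g r * η' r) - lam * ∫ r in (0 : ℝ)..R, w r * η r)
    (C := Nn R lam η η') (P := 5 * ∫ r in Ioc 0 R, (max (w r) 0) ^ 4 * η r * z r / r ^ 4) 5 h.Nn_one (by
    intro t
    have h1 := h.le _ _ z k (h.admw.add (hη.smul t)) h.admz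
    rw [Nn_add_smul hR.le h.admw hη, h.En_one, Real.sqrt_one, mul_one] at h1
    refine le_trans ?_ h1
    have i := quad_integrable hR h.admw h.admz hη
    rw [← h.PP_eq]
    unfold PP
    rw [← integral_const_mul, ← integral_const_mul, ← integral_add (PP_integrable hR h.admw h.admz)
      ((i.const_mul 5).const_mul t)]
    refine setIntegral_mono_on ((PP_integrable hR h.admw h.admz).add ((i.const_mul 5).const_mul t))
      (PP_integrable hR (h.admw.add (hη.smul t)) h.admz) measurableSet_Ioc fun r hr => ?_
    have h2 := pp_convex (x := w r) (h := t * η r) (hz r (Ioc_subset_Icc_self hr))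
    have h4 : (0 : ℝ) ≤ r ^ 4 := by positivity
    have h3 := div_le_div_of_nonneg_right h2 h4
    refine (le_of_eq ?_).trans h3
    ring)
  push_cast at this
  linarith

end Maximizer

/-- Green's function of `-d²/dr²` on `(0, R)` with Dirichlet conditions. -/
def Gr (R r s : ℝ) : ℝ := min s r - s * r / R

lemma Adm.of_ac {R : ℝ} (hR : 0 ≤ R) {w g : ℝ → ℝ} (hac : AbsolutelyContinuousOnInterval w 0 R)
    (h0 : w 0 = 0) (hwR : w R = 0) (hd : ∀ᵐ r, r ∈ Ioo 0 R → HasDerivAt w (g r) r)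
    (hsq : IntervalIntegrable (fun r => g r ^ 2) volume 0 R) : Adm R w g := by
  refine ⟨(hac.ftc hR hd).1, hsq, fun r hr => ?_, hwR⟩
  have hac' : AbsolutelyContinuousOnInterval w 0 r := hac.mono (by
    rw [uIcc_of_le hR, uIcc_of_le hr.1]; exact Icc_subset_Icc_right hr.2)
  rw [(hac'.ftc hr.1 (by
    filter_upwards [hd] with s hs hsr using hs ⟨hsr.1, hsr.2.trans_le hr.2⟩)).2, h0, sub_zero]

lemma Gr_nonneg {R r s : ℝ} (hr : r ∈ Icc 0 R) (hs : s ∈ Icc 0 R) : 0 ≤ Gr R r s := by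
  unfold Gr
  rcases (hr.1.trans hr.2).eq_or_lt with h | h
  · have : s = 0 := le_antisymm (h ▸ hs.2) hs.1
    simp [this, hr.1]
  · rw [sub_nonneg, div_le_iff₀ h]
    rcases le_total s r with h1 | h1
    · rw [min_eq_left h1]; nlinarith [hs.1, hr.2]
    · rw [min_eq_right h1]; nlinarith [hr.1, hs.2]

lemma Gr_le {R r s : ℝ} (hr : r ∈ Icc 0 R) (hs : s ∈ Icc 0 R) : Gr R r s ≤ min s r := by
  unfold Gr
  have : 0 ≤ s * r / R := div_nonneg (mul_nonneg hs.1 hr.1) (hr.1.trans hr.2)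
  linarith

lemma Gr_compare {R r r' s : ℝ} (hR : 0 < R) (hr : r ∈ Icc 0 R) (hr' : r' ∈ Icc 0 R) (hs : s ∈ Icc 0 R) :
    r * (R - r) / R ^ 2 * Gr R r' s ≤ Gr R r s := by
  have e : ∀ t, Gr R t s = (min s t * R - s * t) / R := fun t => by unfold Gr; field_simp
  obtain ⟨a, b⟩ := hr
  obtain ⟨a', b'⟩ := hr'
  obtain ⟨c, d⟩ := hs
  have h1 : min s r' * R - s * r' ≤ s * (R - s) := by
    rcases le_total s r' with h | h
    · rw [min_eq_left h]; nlinarith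
    · rw [min_eq_right h]; nlinarith
  have h2 : r * (R - r) * (s * (R - s)) ≤ (min s r * R - s * r) * R ^ 2 := by
    rcases le_total s r with h | h
    · rw [min_eq_left h]
      have q1 : r * (R - s) ≤ R ^ 2 := by nlinarith
      have := mul_le_mul_of_nonneg_left q1 (mul_nonneg c (sub_nonneg.2 b))
      nlinarith
    · rw [min_eq_right h]
      have q1 : s * (R - r) ≤ R ^ 2 := by nlinarith
      have := mul_le_mul_of_nonneg_left q1 (mul_nonneg a (sub_nonneg.2 d))
      nlinarith
  rw [e, e, div_mul_div_comm, div_le_div_iff₀ (by positivity) hR]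
  have h3 := mul_le_mul_of_nonneg_left h1 (mul_nonneg a (sub_nonneg.2 b))
  nlinarith

lemma adm_Gr {R r : ℝ} (hR : 0 < R) (hr : r ∈ Icc 0 R) :
    Adm R (Gr R r) (fun s => (if s ≤ r then 1 else 0) - r / R) := by
  have hm : Measurable fun s : ℝ => (if s ≤ r then (1 : ℝ) else 0) - r / R :=
    (Measurable.ite measurableSet_Iic measurable_const measurable_const).sub_const _
  refine Adm.of_ac hR.le ?_ ?_ ?_ ?_ ?_
  · have l1 : LipschitzOnWith (1 + ‖r / R‖₊) (Gr R r) (uIcc 0 R) := by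
      have : LipschitzWith (1 + ‖r / R‖₊) (Gr R r) := by
        refine LipschitzWith.of_dist_le_mul fun x y => ?_
        rw [Real.dist_eq, Real.dist_eq]
        have e : Gr R r x - Gr R r y = (min x r - min y r) - r / R * (x - y) := by unfold Gr; ring
        rw [e]
        refine (abs_sub _ _).trans ?_
        rw [abs_mul]
        push_cast
        rw [add_mul, one_mul, Real.norm_eq_abs]
        have h1 : |min x r - min y r| ≤ |x - y| := by
          refine (abs_min_sub_min_le_max x r y r).trans ?_
          simp
        linarith
      exact this.lipschitzOnWith
    exact l1.absolutelyContinuousOnInterval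
  · simp [Gr, hr.1]
  · simp [Gr, hr.2]; field_simp; ring
  · filter_upwards [(by simp [ae_iff] : ∀ᵐ s : ℝ, s ≠ r)] with s hs _
    have d2 : HasDerivAt (fun s : ℝ => s * r / R) (r / R) s := by
      have := ((hasDerivAt_id s).mul_const r).div_const R
      refine this.congr_deriv (by simp)
    rcases lt_or_gt_of_ne hs with h | h
    · rw [if_pos h.le]
      refine HasDerivAt.sub ?_ d2
      refine (hasDerivAt_id s).congr_of_eventuallyEq ?_
      filter_upwards [Iio_mem_nhds h] with t ht using min_eq_left (le_of_lt ht)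
    · rw [if_neg (not_le.2 h)]
      refine HasDerivAt.sub ?_ d2
      refine (hasDerivAt_const s r).congr_of_eventuallyEq ?_
      filter_upwards [Ioi_mem_nhds h] with t ht using min_eq_right (le_of_lt ht)
  · rw [intervalIntegrable_iff_integrableOn_Ioc_of_le hR.le]
    refine Measure.integrableOn_of_bounded (M := (1 + |r / R|) ^ 2) (by simp)
      (hm.pow_const 2).aestronglyMeasurable (Eventually.of_forall fun s => ?_)
    rw [norm_pow, Real.norm_eq_abs]
    refine pow_le_pow_left₀ (abs_nonneg _) ((abs_sub _ _).trans ?_) 2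
    gcongr
    split_ifs <;> simp

/-- Reproducing property of Green's function. -/
lemma Adm.inner_Gr {R r : ℝ} (hR : 0 < R) {w g : ℝ → ℝ} (hw : Adm R w g) (hr : r ∈ Icc 0 R) :
    ∫ s in (0 : ℝ)..R, g s * ((if s ≤ r then 1 else 0) - r / R) = w r := by
  have e1 : ∫ s in (0 : ℝ)..R, g s = 0 := by rw [← hw.eq R ⟨hR.le, le_rfl⟩, hw.zero]
  have i1 : IntegrableOn g (Ioc 0 R) := (intervalIntegrable_iff_integrableOn_Ioc_of_le hR.le).1 hw.int
  have i2 : IntegrableOn ((Iic r).indicator g) (Ioc 0 R) := i1.indicator measurableSet_Iic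
  have e2 : ∫ s in Ioc 0 R, (Iic r).indicator g s = w r := by
    rw [hw.eq r hr, intervalIntegral.integral_of_le hr.1, setIntegral_indicator measurableSet_Iic]
    congr 2
    ext s; simp only [mem_inter_iff, mem_Ioc, mem_Iic]
    have := hr.2
    constructor
    · rintro ⟨⟨a, b⟩, c⟩; exact ⟨a, c⟩
    · rintro ⟨a, b⟩; exact ⟨⟨a, b.trans this⟩, b⟩
  rw [intervalIntegral.integral_of_le hR.le] at e1 ⊢
  have e3 : (fun s => g s * ((if s ≤ r then 1 else 0) - r / R)) =
      fun s => (Iic r).indicator g s - r / R * g s := by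
    ext s; by_cases h : s ≤ r <;> simp [h, indicator] <;> ring
  rw [e3, integral_sub i2 (i1.const_mul _), integral_const_mul, e1, e2]; simp

namespace Maximizer

variable {R lam M : ℝ} {w g z k : ℝ → ℝ}

lemma z_eq (hR : 0 < R) (h : Maximizer R lam M w g z k) {r : ℝ} (hr : r ∈ Icc 0 R) :
    z r = M⁻¹ * ∫ s in Ioc 0 R, Gr R r s * ((max (w s) 0) ^ 5 / s ^ 4) := by
  have := h.euler_z hR (adm_Gr hR hr)
  rw [h.admz.inner_Gr hR hr] at this
  rw [eq_inv_mul_iff_mul_eq₀ h.pos.ne', ← this]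
  unfold PP pp
  congr 1; ext s; ring

lemma z_nonneg (hR : 0 < R) (h : Maximizer R lam M w g z k) {r : ℝ} (hr : r ∈ Icc 0 R) : 0 ≤ z r := by
  rw [h.z_eq hR hr]
  refine mul_nonneg (inv_nonneg.2 h.pos.le) (setIntegral_nonneg measurableSet_Ioc fun s hs => ?_)
  exact mul_nonneg (Gr_nonneg hr (Ioc_subset_Icc_self hs)) (by positivity)

/-- The negative part of an admissible function. -/
lemma adm_min_zero (hR : 0 < R) (hw : Adm R w g) :
    ∃ η', Adm R (fun r => min (w r) 0) η' ∧ (∀ᵐ r, r ∈ Ioo 0 R → g r * η' r = η' r ^ 2) := by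
  refine ⟨fun r => if w r < 0 then g r else 0, ?_, Eventually.of_forall fun r _ => ?_⟩
  · have ac : AbsolutelyContinuousOnInterval (fun r => min (w r) 0) 0 R := by
      refine (hw.ac hR.le).lipschitz_comp (F := fun x => min x 0) (K := 1) ?_
      exact LipschitzWith.id.min_const 0
    refine Adm.of_ac hR.le ac (by simp [hw.left hR.le]) (by simp [hw.zero]) ?_ ?_
    · filter_upwards [ac.ae_differentiableAt, hw.ae_hasDerivAt] with r h1 h2 hr
      have d1 := (h1 (by rw [uIcc_of_le hR.le]; exact Ioo_subset_Icc_self hr)).hasDerivAt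
      have d2 := h2 hr
      rcases lt_trichotomy (w r) 0 with h | h | h
      · rw [if_pos h]
        refine d2.congr_of_eventuallyEq ?_
        filter_upwards [d2.continuousAt.eventually_lt_const h] with s hs using min_eq_left hs.le
      · rw [if_neg (by rw [h]; exact lt_irrefl _)]
        have lm : IsLocalMax (fun r => min (w r) 0) r :=
          Eventually.of_forall fun s => by simp [h]
        have := lm.hasDerivAt_eq_zero d1
        rwa [this] at d1
      · rw [if_neg h.not_gt]
        refine (hasDerivAt_const r (0 : ℝ)).congr_of_eventuallyEq ?_
        filter_upwards [d2.continuousAt.eventually_const_lt h] with s hs using min_eq_right hs.le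
    · have e : ∀ᵐ r ∂volume.restrict (Ioc 0 R), (if w r < 0 then g r else 0) ^ 2 = (Ioc 0 R ∩ w ⁻¹' Iio 0).indicator (fun r => g r ^ 2) r := by
        filter_upwards [ae_restrict_mem measurableSet_Ioc] with r hr
        by_cases h : w r < 0 <;> simp [h, indicator, hr.1, hr.2]
      rw [intervalIntegrable_iff_integrableOn_Ioc_of_le hR.le]
      have ms : MeasurableSet (Ioc 0 R ∩ w ⁻¹' Iio 0) := by
        obtain ⟨u, hu, hu2⟩ := _root_.continuousOn_iff'.1 ((hw.cont hR.le).mono Ioc_subset_Icc_self) (Iio 0) isOpen_Iio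
        rw [inter_comm, hu2]
        exact hu.measurableSet.inter measurableSet_Ioc
      have i := ((intervalIntegrable_iff_integrableOn_Ioc_of_le hR.le).1 hw.sq).indicator ms
      exact i.congr (e.mono fun r hr => hr.symm)
  · simp only
    split_ifs <;> ring

lemma w_nonneg (hR : 0 < R) (lam0 : 0 < lam) (hhigh : lam < π ^ 2 / R ^ 2) (h : Maximizer R lam M w g z k)
    {r : ℝ} (hr : r ∈ Icc 0 R) : 0 ≤ w r := by
  obtain ⟨η', hη, he⟩ := adm_min_zero hR h.admw
  have e1 := h.euler_w hR (fun r hr => h.z_nonneg hR hr) hη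
  have e2 : ∫ r in Ioc 0 R, (max (w r) 0) ^ 4 * min (w r) 0 * z r / r ^ 4 = 0 := by
    refine (integral_congr_ae (Eventually.of_forall fun s => ?_)).trans (integral_zero ℝ ℝ)
    rcases le_total (w s) 0 with h | h
    · rw [max_eq_right h]; simp
    · rw [min_eq_right h]; simp
  have e3 : ∫ r in (0 : ℝ)..R, g r * η' r = En R η' := by
    unfold En
    rw [intervalIntegral.integral_of_le hR.le, intervalIntegral.integral_of_le hR.le,
      integral_Ioc_eq_integral_Ioo, integral_Ioc_eq_integral_Ioo]
    exact integral_congr_ae ((ae_restrict_iff' measurableSet_Ioo).2 he)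
  have e4 : ∫ r in (0 : ℝ)..R, w r * min (w r) 0 = ∫ r in (0 : ℝ)..R, (min (w r) 0) ^ 2 := by
    congr 1; ext s
    rcases le_total (w s) 0 with h | h
    · rw [min_eq_left h]; ring
    · rw [min_eq_right h]; ring
  rw [e2, e3, e4] at e1
  obtain ⟨c, c0, hc⟩ := Nn_coercive hR lam0 hhigh
  have h1 := hc _ _ hη
  unfold Nn at h1
  have h2 : En R η' - lam * ∫ r in (0 : ℝ)..R, (min (w r) 0) ^ 2 = 0 := by
    rcases mul_eq_zero.1 e1.symm with h3 | h3
    · exact absurd h3 h.pos.ne'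
    · exact h3
  have h3 : En R η' = 0 := by
    refine le_antisymm ?_ (En_nonneg hR.le _)
    by_contra h4; push Not at h4; nlinarith
  have := hη.eq_zero_of_energy h3 hr
  by_contra h5
  push Not at h5
  rw [min_eq_left h5.le] at this
  linarith

lemma w_eq (hR : 0 < R) (lam0 : 0 < lam) (hhigh : lam < π ^ 2 / R ^ 2) (h : Maximizer R lam M w g z k)
    {r : ℝ} (hr : r ∈ Icc 0 R) :
    IntegrableOn (fun s => Gr R r s * (lam * w s + M⁻¹ * (w s ^ 4 * z s / s ^ 4))) (Ioc 0 R) ∧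
    w r = ∫ s in Ioc 0 R, Gr R r s * (lam * w s + M⁻¹ * (w s ^ 4 * z s / s ^ 4)) := by
  have aG := adm_Gr hR hr
  have e1 := h.euler_w hR (fun r hr => h.z_nonneg hR hr) aG
  have i1 := quad_integrable hR h.admw h.admz aG
  have i2 : IntegrableOn (fun s => w s * Gr R r s) (Ioc 0 R) :=
    (ContinuousOn.integrableOn_Icc ((h.admw.cont hR.le).mul (aG.cont hR.le))).mono_set Ioc_subset_Icc_self
  rw [h.admw.inner_Gr hR hr, intervalIntegral.integral_of_le hR.le] at e1
  have i3 := (i2.const_mul lam).add (i1.const_mul M⁻¹)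
  have e : EqOn (fun s => lam * (w s * Gr R r s) + M⁻¹ * ((max (w s) 0) ^ 4 * Gr R r s * z s / s ^ 4))
      (fun s => Gr R r s * (lam * w s + M⁻¹ * (w s ^ 4 * z s / s ^ 4))) (Ioc 0 R) := by
    intro s hs
    simp only
    rw [max_eq_left (h.w_nonneg hR lam0 hhigh (Ioc_subset_Icc_self hs))]
    ring
  refine ⟨IntegrableOn.congr_fun i3 e measurableSet_Ioc, ?_⟩
  rw [← setIntegral_congr_fun measurableSet_Ioc e, integral_add (i2.const_mul lam) (i1.const_mul M⁻¹),
    integral_const_mul, integral_const_mul, e1]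
  have := h.pos.ne'
  field_simp
  ring

lemma z_eq' (hR : 0 < R) (lam0 : 0 < lam) (hhigh : lam < π ^ 2 / R ^ 2) (h : Maximizer R lam M w g z k)
    {r : ℝ} (hr : r ∈ Icc 0 R) :
    IntegrableOn (fun s => Gr R r s * (M⁻¹ * (w s ^ 5 / s ^ 4))) (Ioc 0 R) ∧
    z r = ∫ s in Ioc 0 R, Gr R r s * (M⁻¹ * (w s ^ 5 / s ^ 4)) := by
  have aG := adm_Gr hR hr
  have i1 := (PP_integrable hR h.admw aG).const_mul M⁻¹
  have e : EqOn (fun s => M⁻¹ * (pp (w s) (Gr R r s) / s ^ 4))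
      (fun s => Gr R r s * (M⁻¹ * (w s ^ 5 / s ^ 4))) (Ioc 0 R) := by
    intro s hs
    simp only [pp]
    rw [max_eq_left (h.w_nonneg hR lam0 hhigh (Ioc_subset_Icc_self hs))]
    ring
  refine ⟨IntegrableOn.congr_fun i1 e measurableSet_Ioc, ?_⟩
  rw [h.z_eq hR hr, ← integral_const_mul]
  refine setIntegral_congr_fun measurableSet_Ioc fun s hs => ?_
  rw [max_eq_left (h.w_nonneg hR lam0 hhigh (Ioc_subset_Icc_self hs))]
  ring

end Maximizer

lemma Gr_rpow {R r α : ℝ} (h0 : 0 < α) (h1 : α < 1) (hr : r ∈ Ioc 0 R) :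
    IntegrableOn (fun s => Gr R r s * s ^ (α - 2)) (Ioc 0 R) ∧
      ∫ s in Ioc 0 R, Gr R r s * s ^ (α - 2) ≤ r ^ α / (α * (1 - α)) := by
  have r0 : 0 < r := hr.1
  have hrI : r ∈ Icc 0 R := Ioc_subset_Icc_self hr
  have un : Ioc 0 R = Ioc 0 r ∪ Ioc r R := (Ioc_union_Ioc_eq_Ioc hr.1.le hr.2).symm
  have j1 : IntegrableOn (fun s : ℝ => s ^ (α - 1)) (Ioc 0 r) :=
    (intervalIntegrable_iff_integrableOn_Ioc_of_le hr.1.le).1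
      (intervalIntegral.intervalIntegrable_rpow' (by linarith))
  have j2 : IntegrableOn (fun s : ℝ => r * s ^ (α - 2)) (Ioc r R) :=
    (intervalIntegrable_iff_integrableOn_Ioc_of_le hr.2).1
      ((intervalIntegral.intervalIntegrable_rpow (Or.inr (by
        rw [uIcc_of_le hr.2]; exact fun h => absurd h.1 (not_le.2 r0)))).const_mul r)
  have meas : ∀ S : Set ℝ, AEStronglyMeasurable (fun s => Gr R r s * s ^ (α - 2)) (volume.restrict S) := by
    intro S
    have : Measurable (fun s => Gr R r s * s ^ (α - 2)) := by unfold Gr; fun_prop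
    exact this.aestronglyMeasurable
  have b1 : ∀ s ∈ Ioc 0 r, 0 ≤ Gr R r s * s ^ (α - 2) ∧ Gr R r s * s ^ (α - 2) ≤ s ^ (α - 1) := by
    intro s hs
    have hs' : s ∈ Icc 0 R := ⟨hs.1.le, hs.2.trans hr.2⟩
    have p : 0 ≤ s ^ (α - 2) := Real.rpow_nonneg hs.1.le _
    refine ⟨mul_nonneg (Gr_nonneg hrI hs') p, ?_⟩
    have e : s ^ (α - 1) = s * s ^ (α - 2) := by
      rw [← Real.rpow_one_add' hs.1.le (by linarith)]; congr 1; ring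
    rw [e]
    exact mul_le_mul_of_nonneg_right ((Gr_le hrI hs').trans (min_le_left _ _)) p
  have b2 : ∀ s ∈ Ioc r R, 0 ≤ Gr R r s * s ^ (α - 2) ∧ Gr R r s * s ^ (α - 2) ≤ r * s ^ (α - 2) := by
    intro s hs
    have hs' : s ∈ Icc 0 R := ⟨(r0.trans hs.1).le, hs.2⟩
    have p : 0 ≤ s ^ (α - 2) := Real.rpow_nonneg hs'.1 _
    exact ⟨mul_nonneg (Gr_nonneg hrI hs') p,
      mul_le_mul_of_nonneg_right ((Gr_le hrI hs').trans (min_le_right _ _)) p⟩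
  have k1 : IntegrableOn (fun s => Gr R r s * s ^ (α - 2)) (Ioc 0 r) :=
    Integrable.mono' j1 (meas _) ((ae_restrict_iff' measurableSet_Ioc).2 (Eventually.of_forall fun s hs => by
      rw [Real.norm_eq_abs, abs_of_nonneg (b1 s hs).1]; exact (b1 s hs).2))
  have k2 : IntegrableOn (fun s => Gr R r s * s ^ (α - 2)) (Ioc r R) :=
    Integrable.mono' j2 (meas _) ((ae_restrict_iff' measurableSet_Ioc).2 (Eventually.of_forall fun s hs => by
      rw [Real.norm_eq_abs, abs_of_nonneg (b2 s hs).1]; exact (b2 s hs).2))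
  refine ⟨un ▸ k1.union k2, ?_⟩
  rw [un, setIntegral_union (by simp) measurableSet_Ioc k1 k2]
  have m1 := setIntegral_mono_on k1 j1 measurableSet_Ioc fun s hs => (b1 s hs).2
  have m2 := setIntegral_mono_on k2 j2 measurableSet_Ioc fun s hs => (b2 s hs).2
  have e1 : ∫ s in Ioc 0 r, s ^ (α - 1) = r ^ α / α := by
    rw [← intervalIntegral.integral_of_le hr.1.le, integral_rpow (Or.inl (by linarith))]
    simp [Real.zero_rpow h0.ne']
  have e2 : ∫ s in Ioc r R, r * s ^ (α - 2) ≤ r ^ α / (1 - α) := by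
    rw [← intervalIntegral.integral_of_le hr.2, intervalIntegral.integral_const_mul,
      integral_rpow (Or.inr ⟨by linarith, by
        rw [uIcc_of_le hr.2]; exact fun h => absurd h.1 (not_le.2 r0)⟩)]
    have e3 : r ^ α = r * r ^ (α - 1) := by
      rw [← Real.rpow_one_add' r0.le (by linarith)]; congr 1; ring
    have e4 : α - 2 + 1 = α - 1 := by ring
    have e5 : 0 ≤ R ^ (α - 1) := Real.rpow_nonneg (r0.le.trans hr.2) _
    rw [e4, e3, mul_div_assoc]
    refine mul_le_mul_of_nonneg_left ?_ r0.le
    rw [← neg_div_neg_eq, neg_sub, neg_sub]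
    have : 0 < 1 - α := by linarith
    gcongr
    linarith
  have e6 : r ^ α / (α * (1 - α)) = r ^ α / α + r ^ α / (1 - α) := by
    have : 1 - α ≠ 0 := by linarith
    have := h0.ne'
    field_simp
    ring
  rw [e6]
  linarith

lemma Gr_integral_le {R r C : ℝ} (hR : 0 < R) (hr : r ∈ Icc 0 R) (hC : 0 ≤ C) :
    IntegrableOn (fun s => Gr R r s * C) (Ioc 0 R) ∧ ∫ s in Ioc 0 R, Gr R r s * C ≤ C * R * r := by
  have i : IntegrableOn (fun s => Gr R r s * C) (Ioc 0 R) :=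
    ((((adm_Gr hR hr).cont hR.le).mul continuousOn_const).integrableOn_Icc).mono_set Ioc_subset_Icc_self
  refine ⟨i, ?_⟩
  have : ∫ s in Ioc 0 R, Gr R r s * C ≤ ∫ s in Ioc 0 R, r * C := by
    refine setIntegral_mono_on i (integrableOn_const (by simp)) measurableSet_Ioc fun s hs => ?_
    exact mul_le_mul_of_nonneg_right ((Gr_le hr (Ioc_subset_Icc_self hs)).trans (min_le_right _ _)) hC
  refine this.trans (le_of_eq ?_)
  rw [setIntegral_const]
  simp [hR.le]
  ring

namespace Maximizer

variable {R lam M : ℝ} {w g z k : ℝ → ℝ}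

lemma source_le (hR : 0 < R) (lam0 : 0 < lam) (hhigh : lam < π ^ 2 / R ^ 2) (h : Maximizer R lam M w g z k)
    {c : ℝ} (hc : 0 < c) : ∃ C : ℝ, 0 ≤ C ∧ ∀ s ∈ Ioc 0 R,
      lam * w s + M⁻¹ * (w s ^ 4 * z s / s ^ 4) ≤ C + c * (w s * s ^ (-2 : ℝ)) := by
  have M0 := h.pos
  have wn := fun {r : ℝ} (hr : r ∈ Icc 0 R) => h.w_nonneg hR lam0 hhigh hr
  have zn := fun {r : ℝ} (hr : r ∈ Icc 0 R) => h.z_nonneg hR hr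
  set ε := √(M * c) with hε
  have ε0 : 0 < ε := Real.sqrt_pos.2 (by positivity)
  have ε2 : ε ^ 2 = M * c := Real.sq_sqrt (by positivity)
  have t1 := (h.admw.sq_div_tendsto hR).eventually_lt_const ε0
  have t2 := (h.admz.sq_div_tendsto hR).eventually_lt_const ε0
  have t3 : ∀ᶠ r : ℝ in 𝓝[>] 0, r < R := nhdsWithin_le_nhds (Iio_mem_nhds hR)
  obtain ⟨r0, hr0, hb⟩ := mem_nhdsGT_iff_exists_Ioc_subset.1 ((t1.and t2).and t3)
  have hr0 : 0 < r0 := hr0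
  have hr0R : r0 < R := (hb ⟨hr0, le_rfl⟩).2
  obtain ⟨Cw, hCw⟩ := (isCompact_Icc (a := (0 : ℝ)) (b := R)).exists_bound_of_continuousOn (h.admw.cont hR.le)
  have cf : ContinuousOn (fun s => M⁻¹ * (w s ^ 4 * z s / s ^ 4)) (Icc r0 R) := by
    have c1 := (h.admw.cont hR.le).mono (Icc_subset_Icc_left hr0.le)
    have c2 := (h.admz.cont hR.le).mono (Icc_subset_Icc_left hr0.le)
    exact continuousOn_const.mul (((c1.pow 4).mul c2).div (continuousOn_id.pow 4) fun s hs =>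
      pow_ne_zero 4 (hr0.trans_le hs.1).ne')
  obtain ⟨Cf, hCf⟩ := (isCompact_Icc (a := r0) (b := R)).exists_bound_of_continuousOn cf
  have Cw0 : 0 ≤ Cw := (norm_nonneg _).trans (hCw R ⟨hR.le, le_rfl⟩)
  have Cf0 : 0 ≤ Cf := (norm_nonneg _).trans (hCf R ⟨hr0R.le, le_rfl⟩)
  refine ⟨lam * Cw + Cf, by positivity, fun s hs => ?_⟩
  have hs' := Ioc_subset_Icc_self hs
  have s0 := hs.1
  have u1 : lam * w s ≤ lam * Cw := by
    gcongr; exact (le_abs_self _).trans (hCw s hs')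
  have ws := wn hs'
  have zs := zn hs'
  have p : 0 ≤ s ^ (-2 : ℝ) := Real.rpow_nonneg s0.le _
  rcases le_total s r0 with hle | hle
  · obtain ⟨⟨v1, v2⟩, -⟩ := hb ⟨s0, hle⟩
    rw [div_lt_iff₀ s0] at v1 v2
    have e : s ^ (-2 : ℝ) = (s ^ 2)⁻¹ := by
      rw [Real.rpow_neg s0.le]; norm_cast
    have v3 : w s ^ 3 * z s ≤ ε ^ 2 * s ^ 2 := by
      have h1 : w s * z s ≤ ε * s := by nlinarith [sq_nonneg (w s - z s)]
      calc w s ^ 3 * z s = w s ^ 2 * (w s * z s) := by ring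
        _ ≤ (ε * s) * (ε * s) := by gcongr
        _ = _ := by ring
    have v4 : M⁻¹ * (w s ^ 4 * z s / s ^ 4) ≤ c * (w s * s ^ (-2 : ℝ)) := by
      rw [e]
      have : M⁻¹ * (w s ^ 4 * z s / s ^ 4) = M⁻¹ * (w s * (w s ^ 3 * z s) / s ^ 4) := by ring
      rw [this]
      calc M⁻¹ * (w s * (w s ^ 3 * z s) / s ^ 4) ≤ M⁻¹ * (w s * (ε ^ 2 * s ^ 2) / s ^ 4) := by gcongr
        _ = _ := by rw [ε2]; field_simp
    linarith
  · have := (le_abs_self _).trans (hCf s ⟨hle, hs.2⟩)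
    have : 0 ≤ c * (w s * s ^ (-2 : ℝ)) := by positivity
    linarith

lemma w_le_rpow (hR : 0 < R) (lam0 : 0 < lam) (hhigh : lam < π ^ 2 / R ^ 2) (h : Maximizer R lam M w g z k) :
    ∃ A : ℝ, 0 ≤ A ∧ ∀ r ∈ Ioc 0 R, w r ≤ A * r ^ (3 / 4 : ℝ) := by
  obtain ⟨C, C0, hC⟩ := h.source_le hR lam0 hhigh (c := 3 / 32) (by norm_num)
  set A := C * R * R ^ (1 / 4 : ℝ) with hA
  have A0 : 0 ≤ A := by positivity
  set b := √(En R g) with hb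
  have b0 : 0 ≤ b := Real.sqrt_nonneg _
  have key : ∀ n : ℕ, ∀ r ∈ Ioc 0 R, w r ≤ 2 * A * r ^ (3 / 4 : ℝ) + b / 2 ^ n * r ^ (1 / 2 : ℝ) := by
    intro n
    induction n with
    | zero =>
      intro r hr
      have h1 := h.admw.sq_le' (Ioc_subset_Icc_self hr)
      have h2 : w r ≤ √(r * En R g) := Real.le_sqrt_of_sq_le h1
      rw [Real.sqrt_mul hr.1.le, ← hb, Real.sqrt_eq_rpow] at h2
      have : 0 ≤ 2 * A * r ^ (3 / 4 : ℝ) := by have := hr.1; positivity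
      rw [pow_zero, div_one]
      linarith
    | succ n ih =>
      intro r hr
      have r0 := hr.1
      have hr' := Ioc_subset_Icc_self hr
      obtain ⟨i0, e0⟩ := h.w_eq hR lam0 hhigh hr'
      obtain ⟨i1, l1⟩ := Gr_integral_le hR hr' C0
      obtain ⟨i2, l2⟩ := Gr_rpow (α := 3 / 4) (by norm_num) (by norm_num) hr
      obtain ⟨i3, l3⟩ := Gr_rpow (α := 1 / 2) (by norm_num) (by norm_num) hr
      have i4 := (i2.const_mul (3 / 32 * (2 * A)))
      have i5 := (i3.const_mul (3 / 32 * (b / 2 ^ n)))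
      have le : ∫ s in Ioc 0 R, Gr R r s * (lam * w s + M⁻¹ * (w s ^ 4 * z s / s ^ 4)) ≤
          ∫ s in Ioc 0 R, (Gr R r s * C + 3 / 32 * (2 * A) * (Gr R r s * s ^ (3 / 4 - 2 : ℝ)) +
            3 / 32 * (b / 2 ^ n) * (Gr R r s * s ^ (1 / 2 - 2 : ℝ))) := by
        refine setIntegral_mono_on i0 ((i1.add i4).add i5) measurableSet_Ioc fun s hs => ?_
        have s0 := hs.1
        have hG := Gr_nonneg hr' (Ioc_subset_Icc_self hs)
        have p : 0 ≤ s ^ (-2 : ℝ) := Real.rpow_nonneg s0.le _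
        have q1 := (hC s hs).trans (add_le_add_right (mul_le_mul_of_nonneg_left
          (mul_le_mul_of_nonneg_right (ih s hs) p) (by norm_num : (0 : ℝ) ≤ 3 / 32)) C)
        have q2 := mul_le_mul_of_nonneg_left q1 hG
        refine q2.trans (le_of_eq ?_)
        have x1 : s ^ (3 / 4 - 2 : ℝ) = s ^ (3 / 4 : ℝ) * s ^ (-2 : ℝ) := by
          rw [← Real.rpow_add s0]; norm_num
        have x2 : s ^ (1 / 2 - 2 : ℝ) = s ^ (1 / 2 : ℝ) * s ^ (-2 : ℝ) := by
          rw [← Real.rpow_add s0]; norm_num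
        rw [x1, x2]; ring
      have i14 : IntegrableOn (fun s => Gr R r s * C + 3 / 32 * (2 * A) * (Gr R r s * s ^ (3 / 4 - 2 : ℝ))) (Ioc 0 R) := i1.add i4
      rw [integral_add i14 i5, integral_add i1 i4, integral_const_mul, integral_const_mul, ← e0] at le
      have z1 : C * R * r ≤ A * r ^ (3 / 4 : ℝ) := by
        have : r = r ^ (1 / 4 : ℝ) * r ^ (3 / 4 : ℝ) := by
          rw [← Real.rpow_add r0]; norm_num
        calc C * R * r = C * R * (r ^ (1 / 4 : ℝ) * r ^ (3 / 4 : ℝ)) := by rw [← this]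
          _ ≤ C * R * (R ^ (1 / 4 : ℝ) * r ^ (3 / 4 : ℝ)) := by
            gcongr; exact hr.2
          _ = _ := by rw [hA]; ring
      have z2 : 3 / 32 * (2 * A) * ∫ s in Ioc 0 R, Gr R r s * s ^ (3 / 4 - 2 : ℝ) ≤ A * r ^ (3 / 4 : ℝ) := by
        refine (mul_le_mul_of_nonneg_left l2 (by positivity)).trans (le_of_eq ?_)
        ring
      have p2 : 0 ≤ b / 2 ^ n * r ^ (1 / 2 : ℝ) := by positivity
      have z3 : 3 / 32 * (b / 2 ^ n) * ∫ s in Ioc 0 R, Gr R r s * s ^ (1 / 2 - 2 : ℝ) ≤ b / 2 ^ (n + 1) * r ^ (1 / 2 : ℝ) := by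
        refine (mul_le_mul_of_nonneg_left l3 (by positivity)).trans ?_
        have e : b / 2 ^ (n + 1) = b / 2 ^ n / 2 := by rw [pow_succ, div_mul_eq_div_div]
        have e' : (r ^ (1 / 2 : ℝ) / (1 / 2 * (1 - 1 / 2)) : ℝ) = 4 * r ^ (1 / 2 : ℝ) := by ring
        rw [e, e']
        linarith
      linarith
  refine ⟨2 * A, by positivity, fun r hr => ?_⟩
  have lim : Tendsto (fun n : ℕ => 2 * A * r ^ (3 / 4 : ℝ) + b / 2 ^ n * r ^ (1 / 2 : ℝ)) atTop
      (𝓝 (2 * A * r ^ (3 / 4 : ℝ) + 0 * r ^ (1 / 2 : ℝ))) := by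
    refine Tendsto.const_add _ (Tendsto.mul_const _ ?_)
    exact tendsto_const_nhds.div_atTop (tendsto_pow_atTop_atTop_of_one_lt (by norm_num))
  have := ge_of_tendsto' lim fun n => key n r hr
  simpa using this

/-- Maximisers vanish linearly at the origin. -/
lemma linear_bound (hR : 0 < R) (lam0 : 0 < lam) (hhigh : lam < π ^ 2 / R ^ 2) (h : Maximizer R lam M w g z k) :
    ∃ C : ℝ, 0 ≤ C ∧ ∀ r ∈ Ioc 0 R, w r ≤ C * r ∧ z r ≤ C * r := by
  have M0 := h.pos
  obtain ⟨A, A0, hA⟩ := h.w_le_rpow hR lam0 hhigh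
  have wn := fun {r : ℝ} (hr : r ∈ Icc 0 R) => h.w_nonneg hR lam0 hhigh hr
  have zn := fun {r : ℝ} (hr : r ∈ Icc 0 R) => h.z_nonneg hR hr
  have rp : ∀ s : ℝ, 0 < s → (s ^ (3 / 4 : ℝ)) ^ 4 = s ^ 3 := by
    intro s hs
    rw [← Real.rpow_natCast, ← Real.rpow_mul hs.le]; norm_num
  have zb : ∃ B : ℝ, 0 ≤ B ∧ ∀ r ∈ Ioc 0 R, z r ≤ B * r := by
    have j1 : IntegrableOn (fun s : ℝ => s ^ (-1 / 4 : ℝ)) (Ioc 0 R) :=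
      (intervalIntegrable_iff_integrableOn_Ioc_of_le hR.le).1
        (intervalIntegral.intervalIntegrable_rpow' (by norm_num))
    refine ⟨M⁻¹ * A ^ 5 * ∫ s in Ioc 0 R, s ^ (-1 / 4 : ℝ), ?_, fun r hr => ?_⟩
    · refine mul_nonneg (by positivity) (setIntegral_nonneg measurableSet_Ioc fun s hs => Real.rpow_nonneg hs.1.le _)
    have hr' := Ioc_subset_Icc_self hr
    obtain ⟨i0, e0⟩ := h.z_eq' hR lam0 hhigh hr'
    have : ∫ s in Ioc 0 R, Gr R r s * (M⁻¹ * (w s ^ 5 / s ^ 4)) ≤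
        ∫ s in Ioc 0 R, (r * (M⁻¹ * A ^ 5)) * s ^ (-1 / 4 : ℝ) := by
      refine setIntegral_mono_on i0 (j1.const_mul _) measurableSet_Ioc fun s hs => ?_
      have s0 := hs.1
      have ws := wn (Ioc_subset_Icc_self hs)
      have y1 : w s ^ 5 / s ^ 4 ≤ A ^ 5 * s ^ (-1 / 4 : ℝ) := by
        rw [div_le_iff₀ (by positivity)]
        have e : s ^ (-1 / 4 : ℝ) * s ^ 4 = s ^ (3 / 4 : ℝ) * (s ^ (3 / 4 : ℝ)) ^ 4 := by
          rw [rp s s0, ← Real.rpow_natCast, ← Real.rpow_natCast, ← Real.rpow_add s0, ← Real.rpow_add s0]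
          norm_num
        calc w s ^ 5 ≤ (A * s ^ (3 / 4 : ℝ)) ^ 5 := by gcongr; exact hA s hs
          _ = A ^ 5 * (s ^ (3 / 4 : ℝ) * (s ^ (3 / 4 : ℝ)) ^ 4) := by ring
          _ = _ := by rw [← e]; ring
      calc Gr R r s * (M⁻¹ * (w s ^ 5 / s ^ 4)) ≤ r * (M⁻¹ * (A ^ 5 * s ^ (-1 / 4 : ℝ))) := by
            gcongr
            · exact hr'.1
            exact (Gr_le hr' (Ioc_subset_Icc_self hs)).trans (min_le_right _ _)
        _ = _ := by ring
    rw [← e0, integral_const_mul] at this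
    linarith
  obtain ⟨B, B0, hB⟩ := zb
  set C := lam * (A * R ^ (3 / 4 : ℝ)) + M⁻¹ * (A ^ 4 * B) with hCdef
  have C0 : 0 ≤ C := by positivity
  have wb : ∀ r ∈ Ioc 0 R, w r ≤ C * R * r := by
    intro r hr
    have hr' := Ioc_subset_Icc_self hr
    obtain ⟨i0, e0⟩ := h.w_eq hR lam0 hhigh hr'
    obtain ⟨i1, l1⟩ := Gr_integral_le hR hr' C0
    rw [e0]
    refine le_trans (setIntegral_mono_on i0 i1 measurableSet_Ioc fun s hs => ?_) l1
    have s0 := hs.1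
    have ws := wn (Ioc_subset_Icc_self hs)
    have zs := zn (Ioc_subset_Icc_self hs)
    refine mul_le_mul_of_nonneg_left ?_ (Gr_nonneg hr' (Ioc_subset_Icc_self hs))
    rw [hCdef]
    gcongr
    · refine (hA s hs).trans ?_
      gcongr
      exact hs.2
    · rw [div_le_iff₀ (by positivity)]
      calc w s ^ 4 * z s ≤ (A * s ^ (3 / 4 : ℝ)) ^ 4 * (B * s) := by
            gcongr
            · exact hA s hs
            · exact hB s hs
        _ = A ^ 4 * B * s ^ 4 := by rw [mul_pow, rp s s0]; ring
  refine ⟨max (C * R) B, by positivity, fun r hr => ⟨(wb r hr).trans ?_, (hB r hr).trans ?_⟩⟩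
  · exact mul_le_mul_of_nonneg_right (le_max_left _ _) hr.1.le
  · exact mul_le_mul_of_nonneg_right (le_max_right _ _) hr.1.le

end Maximizer

lemma green_radial {R K : ℝ} (hR : 0 < R) {f w : ℝ → ℝ}
    (hf : AEStronglyMeasurable f (volume.restrict (Ioc 0 R))) (hK : ∀ s ∈ Ioc 0 R, |f s| ≤ K)
    (hw : ∀ r ∈ Icc 0 R, w r = ∫ s in Ioc 0 R, Gr R r s * (s * f s)) :
    ∃ u : ℝ → ℝ, Continuous u ∧ u R = 0 ∧ (∀ r ∈ Icc 0 R, w r = r * u r) ∧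
      ∀ r ∈ Ioo 0 R, ContinuousAt f r → HasDerivAt u (-((r ^ 2)⁻¹ * ∫ t in (0 : ℝ)..r, t ^ 2 * f t)) r := by
  have K0 : 0 ≤ K := (abs_nonneg _).trans (hK R ⟨hR, le_rfl⟩)
  have int : IntervalIntegrable f volume 0 R := by
    rw [intervalIntegrable_iff_integrableOn_Ioc_of_le hR.le]
    refine Integrable.mono' (integrable_const K) hf ?_
    exact (ae_restrict_iff' measurableSet_Ioc).2 (Eventually.of_forall hK)
  have int1 : IntervalIntegrable (fun s => s * f s) volume 0 R :=
    int.continuousOn_mul continuous_id.continuousOn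
  have int2 : IntervalIntegrable (fun s => s ^ 2 * f s) volume 0 R :=
    int.continuousOn_mul (continuous_pow 2).continuousOn
  set I : ℝ → ℝ := fun r => ∫ t in (0 : ℝ)..r, t ^ 2 * f t with hI
  set J : ℝ → ℝ := fun r => ∫ t in (0 : ℝ)..r, t * f t with hJ
  have cI : ContinuousOn I (Icc 0 R) := by
    have := intervalIntegral.continuousOn_primitive_interval' int2 left_mem_uIcc
    rwa [uIcc_of_le hR.le] at this
  have cJ : ContinuousOn J (Icc 0 R) := by
    have := intervalIntegral.continuousOn_primitive_interval' int1 left_mem_uIcc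
    rwa [uIcc_of_le hR.le] at this
  have bI : ∀ r ∈ Icc 0 R, |I r| ≤ (K * r ^ 2) * r := by
    intro r hr
    have := intervalIntegral.norm_integral_le_of_norm_le_const (a := 0) (b := r) (C := K * r ^ 2)
      (f := fun t => t ^ 2 * f t) (fun t ht => by
        rw [uIoc_of_le hr.1] at ht
        rw [norm_mul, Real.norm_eq_abs, Real.norm_eq_abs, abs_of_nonneg (sq_nonneg t), mul_comm]
        have := hK t ⟨ht.1, ht.2.trans hr.2⟩
        gcongr
        · exact ht.1.le
        · exact ht.2)
    rw [sub_zero, abs_of_nonneg hr.1] at this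
    exact this
  have cIr : ContinuousOn (fun r => I r / r) (Icc 0 R) := by
    intro r hr
    rcases hr.1.eq_or_lt with h0 | h0
    · subst h0
      have b : ∀ r ∈ Icc 0 R, |I r / r| ≤ K * r ^ 2 := by
        intro r hr
        rcases hr.1.eq_or_lt with h | h
        · rw [← h]; simp
        · rw [abs_div, abs_of_pos h, div_le_iff₀ h]; exact bI r hr
      have t : Tendsto (fun r : ℝ => K * r ^ 2) (𝓝[Icc 0 R] 0) (𝓝 0) := by
        have : Continuous fun r : ℝ => K * r ^ 2 := by fun_prop
        simpa using (this.tendsto 0).mono_left nhdsWithin_le_nhds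
      unfold ContinuousWithinAt
      simp only [div_zero]
      exact squeeze_zero_norm' (eventually_nhdsWithin_of_forall b) t
    · exact (cI r hr).div continuousWithinAt_id h0.ne'
  set u0 : ℝ → ℝ := fun r => I r / r + (J R - J r) - I R / R with hu0
  have cu : ContinuousOn u0 (Icc 0 R) := (cIr.add (continuousOn_const.sub cJ)).sub continuousOn_const
  have ext : ∀ r ∈ Icc 0 R, IccExtend hR.le ((Icc 0 R).domRestrict u0) r = u0 r := fun r hr =>
    IccExtend_of_mem hR.le _ hr
  refine ⟨IccExtend hR.le ((Icc 0 R).domRestrict u0), (continuousOn_iff_continuous_domRestrict.1 cu).Icc_extend', ?_, ?_, ?_⟩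
  · rw [ext R ⟨hR.le, le_rfl⟩, hu0]; simp
  · intro r hr
    rw [ext r hr, hw r hr]
    have a1 : ∀ s ∈ Ioc 0 r, Gr R r s * (s * f s) = s ^ 2 * f s - r / R * (s ^ 2 * f s) := fun s hs => by
      unfold Gr; rw [min_eq_left hs.2]; ring
    have a2 : ∀ s ∈ Ioc r R, Gr R r s * (s * f s) = r * (s * f s) - r / R * (s ^ 2 * f s) := fun s hs => by
      unfold Gr; rw [min_eq_right hs.1.le]; ring
    have s1 : uIcc 0 r ⊆ uIcc 0 R := by
      rw [uIcc_of_le hr.1, uIcc_of_le hR.le]; exact Icc_subset_Icc_right hr.2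
    have s2 : uIcc r R ⊆ uIcc 0 R := by
      rw [uIcc_of_le hr.2, uIcc_of_le hR.le]; exact Icc_subset_Icc_left hr.1
    have b1 := int2.mono_set s1
    have b2 := int2.mono_set s2
    have b3 := int1.mono_set s1
    have b4 := int1.mono_set s2
    have g1 : IntervalIntegrable (fun s => Gr R r s * (s * f s)) volume 0 r :=
      (b1.sub (b1.const_mul (r / R))).congr (by rw [uIoc_of_le hr.1]; exact fun s hs => (a1 s hs).symm)
    have g2 : IntervalIntegrable (fun s => Gr R r s * (s * f s)) volume r R :=
      ((b4.const_mul r).sub (b2.const_mul (r / R))).congr (by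
        rw [uIoc_of_le hr.2]; exact fun s hs => (a2 s hs).symm)
    rw [← intervalIntegral.integral_of_le hR.le, ← intervalIntegral.integral_add_adjacent_intervals g1 g2]
    have e1 : ∫ s in (0 : ℝ)..r, Gr R r s * (s * f s) = I r - r / R * I r := by
      rw [hI, ← intervalIntegral.integral_const_mul, ← intervalIntegral.integral_sub b1 (b1.const_mul _)]
      refine intervalIntegral.integral_congr_ae (Eventually.of_forall fun s hs => ?_)
      rw [uIoc_of_le hr.1] at hs
      exact a1 s hs
    have e2 : ∫ s in r..R, Gr R r s * (s * f s) = r * (J R - J r) - r / R * (I R - I r) := by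
      rw [hI, hJ]
      simp only
      rw [intervalIntegral.integral_interval_sub_left int1 b3, intervalIntegral.integral_interval_sub_left int2 b1,
        ← intervalIntegral.integral_const_mul, ← intervalIntegral.integral_const_mul,
        ← intervalIntegral.integral_sub (b4.const_mul _) (b2.const_mul _)]
      refine intervalIntegral.integral_congr_ae (Eventually.of_forall fun s hs => ?_)
      rw [uIoc_of_le hr.2] at hs
      exact a2 s hs
    rw [e1, e2, hu0]
    rcases hr.1.eq_or_lt with h | h
    · subst h
      have : I 0 = 0 := by rw [hI]; simp
      simp [this]
    · simp only
      clear_value I J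
      field_simp
      ring
  · intro r hr hc
    have r0 := hr.1
    have hm : StronglyMeasurableAtFilter f (𝓝 r) := ⟨Ioc 0 R, Ioc_mem_nhds hr.1 hr.2, hf⟩
    have hm' : ∀ h : ℝ → ℝ, Continuous h → StronglyMeasurableAtFilter (fun t => h t * f t) (𝓝 r) := fun h hh =>
      ⟨Ioc 0 R, Ioc_mem_nhds hr.1 hr.2, (hh.aestronglyMeasurable).mul hf⟩
    have s1 : uIcc 0 r ⊆ uIcc 0 R := by
      rw [uIcc_of_le hr.1.le, uIcc_of_le hR.le]; exact Icc_subset_Icc_right hr.2.le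
    have d1 : HasDerivAt I (r ^ 2 * f r) r :=
      intervalIntegral.integral_hasDerivAt_right (int2.mono_set s1) (hm' _ (continuous_pow 2))
        (((continuous_pow 2).continuousAt).mul hc)
    have d2 : HasDerivAt J (r * f r) r :=
      intervalIntegral.integral_hasDerivAt_right (int1.mono_set s1) (hm' _ continuous_id) (continuousAt_id.mul hc)
    have d3 : HasDerivAt u0 (-((r ^ 2)⁻¹ * I r)) r := by
      have := ((d1.div (hasDerivAt_id r) r0.ne').add (d2.const_sub (J R))).sub_const (I R / R)
      refine this.congr_deriv ?_
      clear_value I J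
      simp only [id]
      field_simp
      ring
    refine d3.congr_of_eventuallyEq ?_
    filter_upwards [Icc_mem_nhds hr.1 hr.2] with t ht using ext t ht

/-- The radial profile of the optimal pair, regular up to the origin. -/
theorem exists_radial {R lam : ℝ} (hR : 0 < R) (hlow : 3 / 10 * (π ^ 2 / R ^ 2) < lam)
    (hhigh : lam < π ^ 2 / R ^ 2) :
    ∃ (M : ℝ) (u φ : ℝ → ℝ), 0 < M ∧ Continuous u ∧ Continuous φ ∧ u R = 0 ∧ φ R = 0 ∧
      (∀ r ∈ Ico 0 R, 0 < u r) ∧ (∀ r ∈ Ico 0 R, 0 < φ r) ∧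
      (∀ r ∈ Ioo 0 R, HasDerivAt u
        (-((r ^ 2)⁻¹ * ∫ t in (0 : ℝ)..r, t ^ 2 * (lam * u t + M⁻¹ * (u t ^ 4 * φ t)))) r) ∧
      (∀ r ∈ Ioo 0 R, HasDerivAt φ (-((r ^ 2)⁻¹ * ∫ t in (0 : ℝ)..r, t ^ 2 * (M⁻¹ * u t ^ 5))) r) ∧
      ∫ r in Ioc 0 R, r ^ 2 * (u r ^ 5 * φ r) = M ∧
      ∀ w g z k : ℝ → ℝ, Adm R w g → Adm R z k → PP R w z ≤ M * √(Nn R lam w g) ^ 5 * √(En R k) := by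
  obtain ⟨M, w, g, z, k, M0, aw, az, hN, hE, hP, hle⟩ := exists_maximizer hR hlow hhigh
  have lam0 : 0 < lam := lt_trans (by positivity) hlow
  have h : Maximizer R lam M w g z k := ⟨M0, aw, az, hN, hE, hP, hle⟩
  obtain ⟨C, C0, hC⟩ := h.linear_bound hR lam0 hhigh
  have wn := fun {r : ℝ} (hr : r ∈ Icc 0 R) => h.w_nonneg hR lam0 hhigh hr
  have zn := fun {r : ℝ} (hr : r ∈ Icc 0 R) => h.z_nonneg hR hr
  have cw := aw.cont hR.le
  have cz := az.cont hR.le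
  have s2 : Ioc 0 R ⊆ Icc 0 R := Ioc_subset_Icc_self
  set f : ℝ → ℝ := fun s => lam * (w s / s) + M⁻¹ * ((w s / s) ^ 4 * (z s / s)) with hfdef
  set b : ℝ → ℝ := fun s => M⁻¹ * (w s / s) ^ 5 with hbdef
  have qw : ∀ s ∈ Ioc 0 R, 0 ≤ w s / s ∧ w s / s ≤ C := fun s hs =>
    ⟨div_nonneg (wn (s2 hs)) hs.1.le, (div_le_iff₀ hs.1).2 (hC s hs).1⟩
  have qz : ∀ s ∈ Ioc 0 R, 0 ≤ z s / s ∧ z s / s ≤ C := fun s hs =>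
    ⟨div_nonneg (zn (s2 hs)) hs.1.le, (div_le_iff₀ hs.1).2 (hC s hs).2⟩
  have cqw : ContinuousOn (fun s => w s / s) (Ioc 0 R) :=
    (cw.mono s2).div continuousOn_id fun s hs => hs.1.ne'
  have cqz : ContinuousOn (fun s => z s / s) (Ioc 0 R) :=
    (cz.mono s2).div continuousOn_id fun s hs => hs.1.ne'
  have cf : ContinuousOn f (Ioc 0 R) :=
    (continuousOn_const.mul cqw).add (continuousOn_const.mul ((cqw.pow 4).mul cqz))
  have cb : ContinuousOn b (Ioc 0 R) := continuousOn_const.mul (cqw.pow 5)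
  have fb : ∀ s ∈ Ioc 0 R, |f s| ≤ lam * C + M⁻¹ * (C ^ 4 * C) := by
    intro s hs
    obtain ⟨h1, h2⟩ := qw s hs
    obtain ⟨h3, h4⟩ := qz s hs
    rw [abs_of_nonneg (by rw [hfdef]; positivity)]
    rw [hfdef]; simp only; gcongr
  have bb : ∀ s ∈ Ioc 0 R, |b s| ≤ M⁻¹ * C ^ 5 := by
    intro s hs
    obtain ⟨h1, h2⟩ := qw s hs
    rw [abs_of_nonneg (by rw [hbdef]; positivity)]
    rw [hbdef]; simp only; gcongr
  have srcf : ∀ s ∈ Ioc 0 R, lam * w s + M⁻¹ * (w s ^ 4 * z s / s ^ 4) = s * f s := by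
    intro s hs
    have := hs.1.ne'
    rw [hfdef]; field_simp
  have srcb : ∀ s ∈ Ioc 0 R, M⁻¹ * (w s ^ 5 / s ^ 4) = s * b s := by
    intro s hs
    have := hs.1.ne'
    rw [hbdef]; field_simp
  have ew : ∀ r ∈ Icc 0 R, w r = ∫ s in Ioc 0 R, Gr R r s * (s * f s) := by
    intro r hr
    rw [(h.w_eq hR lam0 hhigh hr).2]
    exact setIntegral_congr_fun measurableSet_Ioc fun s hs => by simp only [srcf s hs]
  have ez : ∀ r ∈ Icc 0 R, z r = ∫ s in Ioc 0 R, Gr R r s * (s * b s) := by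
    intro r hr
    rw [(h.z_eq' hR lam0 hhigh hr).2]
    exact setIntegral_congr_fun measurableSet_Ioc fun s hs => by simp only [srcb s hs]
  obtain ⟨u, cu, uR, hu, du⟩ := green_radial hR (cf.aestronglyMeasurable measurableSet_Ioc) fb ew
  obtain ⟨φ, cφ, φR, hφ, dφ⟩ := green_radial hR (cb.aestronglyMeasurable measurableSet_Ioc) bb ez
  have uw : ∀ s ∈ Ioc 0 R, w s / s = u s := fun s hs => by
    rw [hu s (s2 hs), mul_div_cancel_left₀ _ hs.1.ne']
  have φz : ∀ s ∈ Ioc 0 R, z s / s = φ s := fun s hs => by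
    rw [hφ s (s2 hs), mul_div_cancel_left₀ _ hs.1.ne']
  have cmpw : ∀ r ∈ Icc 0 R, ∀ r' ∈ Icc 0 R, r * (R - r) / R ^ 2 * w r' ≤ w r := by
    intro r hr r' hr'
    obtain ⟨i1, e1⟩ := h.w_eq hR lam0 hhigh hr
    obtain ⟨i2, e2⟩ := h.w_eq hR lam0 hhigh hr'
    rw [e1, e2, ← integral_const_mul]
    refine setIntegral_mono_on (i2.const_mul _) i1 measurableSet_Ioc fun s hs => ?_
    rw [← mul_assoc]
    refine mul_le_mul_of_nonneg_right (Gr_compare hR hr hr' (s2 hs)) ?_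
    have := wn (s2 hs); have := zn (s2 hs)
    positivity
  have cmpz : ∀ r ∈ Icc 0 R, ∀ r' ∈ Icc 0 R, r * (R - r) / R ^ 2 * z r' ≤ z r := by
    intro r hr r' hr'
    obtain ⟨i1, e1⟩ := h.z_eq' hR lam0 hhigh hr
    obtain ⟨i2, e2⟩ := h.z_eq' hR lam0 hhigh hr'
    rw [e1, e2, ← integral_const_mul]
    refine setIntegral_mono_on (i2.const_mul _) i1 measurableSet_Ioc fun s hs => ?_
    rw [← mul_assoc]
    refine mul_le_mul_of_nonneg_right (Gr_compare hR hr hr' (s2 hs)) ?_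
    have := wn (s2 hs); have := zn (s2 hs)
    positivity
  have eM : ∫ r in Ioc 0 R, r ^ 2 * (u r ^ 5 * φ r) = M := by
    rw [← hP]
    refine setIntegral_congr_fun measurableSet_Ioc fun s hs => ?_
    have := hs.1.ne'
    simp only [pp]
    rw [max_eq_left (wn (s2 hs)), ← uw s hs, ← φz s hs]
    field_simp
  have exw : ∃ r' ∈ Ioc 0 R, 0 < w r' ∧ 0 < z r' := by
    by_contra hcon
    push Not at hcon
    refine M0.ne' (eM.symm.trans ?_)
    refine setIntegral_eq_zero_of_forall_eq_zero fun s hs => ?_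
    rw [← uw s hs, ← φz s hs]
    rcases (wn (s2 hs)).eq_or_lt with h0 | h0
    · rw [← h0]; simp
    · rw [le_antisymm (hcon s hs h0) (zn (s2 hs))]; simp
  obtain ⟨r', hr', pw, pz⟩ := exw
  have lowu : ∀ r ∈ Icc 0 R, (R - r) / R ^ 2 * w r' ≤ u r := by
    have A : ∀ r ∈ Ioc 0 R, (R - r) / R ^ 2 * w r' ≤ u r := by
      intro r hr
      rw [← uw r hr, le_div_iff₀ hr.1]
      refine le_trans (le_of_eq ?_) (cmpw r (s2 hr) r' (s2 hr'))
      ring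
    have cl : IsClosed {r : ℝ | (R - r) / R ^ 2 * w r' ≤ u r} := isClosed_le (by fun_prop) cu
    have := cl.closure_subset_iff.2 A
    rwa [closure_Ioc hR.ne] at this
  have lowφ : ∀ r ∈ Icc 0 R, (R - r) / R ^ 2 * z r' ≤ φ r := by
    have A : ∀ r ∈ Ioc 0 R, (R - r) / R ^ 2 * z r' ≤ φ r := by
      intro r hr
      rw [← φz r hr, le_div_iff₀ hr.1]
      refine le_trans (le_of_eq ?_) (cmpz r (s2 hr) r' (s2 hr'))
      ring
    have cl : IsClosed {r : ℝ | (R - r) / R ^ 2 * z r' ≤ φ r} := isClosed_le (by fun_prop) cφ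
    have := cl.closure_subset_iff.2 A
    rwa [closure_Ioc hR.ne] at this
  refine ⟨M, u, φ, M0, cu, cφ, uR, φR, fun r hr => ?_, fun r hr => ?_, fun r hr => ?_, fun r hr => ?_, eM, hle⟩
  · refine lt_of_lt_of_le ?_ (lowu r ⟨hr.1, hr.2.le⟩)
    have := sub_pos.2 hr.2
    positivity
  · refine lt_of_lt_of_le ?_ (lowφ r ⟨hr.1, hr.2.le⟩)
    have := sub_pos.2 hr.2
    positivity
  · refine (du r hr (cf.continuousAt (Ioc_mem_nhds hr.1 hr.2))).congr_deriv ?_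
    congr 2
    refine intervalIntegral.integral_congr_ae (Eventually.of_forall fun s hs => ?_)
    rw [uIoc_of_le hr.1.le] at hs
    have hs' : s ∈ Ioc 0 R := ⟨hs.1, hs.2.trans hr.2.le⟩
    rw [hfdef]
    simp only
    rw [uw s hs', φz s hs']
  · refine (dφ r hr (cb.continuousAt (Ioc_mem_nhds hr.1 hr.2))).congr_deriv ?_
    congr 2
    refine intervalIntegral.integral_congr_ae (Eventually.of_forall fun s hs => ?_)
    rw [uIoc_of_le hr.1.le] at hs
    have hs' : s ∈ Ioc 0 R := ⟨hs.1, hs.2.trans hr.2.le⟩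
    rw [hbdef]
    simp only
    rw [uw s hs']

/-- Averaged source `r⁻³ ∫₀ʳ t² F`, extended continuously to the origin. -/
def avg (F : ℝ → ℝ) (r : ℝ) : ℝ := ∫ t in (0 : ℝ)..1, t ^ 2 * F (r * t)

lemma continuous_avg {F : ℝ → ℝ} (hF : Continuous F) : Continuous (avg F) := by
  unfold avg
  exact intervalIntegral.continuous_parametric_intervalIntegral_of_continuous' (by fun_prop) _ _

lemma avg_zero (F : ℝ → ℝ) : 3 * avg F 0 = F 0 := by
  unfold avg
  simp only [zero_mul]
  rw [intervalIntegral.integral_mul_const, integral_pow]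
  norm_num
  ring

lemma avg_eq (F : ℝ → ℝ) {r : ℝ} (hr : r ≠ 0) : avg F r = (r ^ 3)⁻¹ * ∫ t in (0 : ℝ)..r, t ^ 2 * F t := by
  have := intervalIntegral.smul_integral_comp_mul_left (a := 0) (b := 1) (fun t => t ^ 2 * F t) r
  rw [mul_zero, mul_one, smul_eq_mul] at this
  rw [← this]
  unfold avg
  rw [← intervalIntegral.integral_const_mul, ← intervalIntegral.integral_const_mul]
  congr 1
  ext t
  field_simp

lemma hasDerivAt_avg {F : ℝ → ℝ} (hF : Continuous F) {r : ℝ} (hr : 0 < r) :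
    HasDerivAt (avg F) ((F r - 3 * avg F r) / r) r := by
  have h1 : HasDerivAt (fun r => ∫ t in (0 : ℝ)..r, t ^ 2 * F t) (r ^ 2 * F r) r := by
    have c : Continuous fun t => t ^ 2 * F t := by fun_prop
    exact intervalIntegral.integral_hasDerivAt_right (c.intervalIntegrable _ _)
      c.stronglyMeasurable.stronglyMeasurableAtFilter c.continuousAt
  have h2 : HasDerivAt (fun r : ℝ => r ^ 3) (3 * r ^ 2) r := by simpa using hasDerivAt_pow 3 r
  have h3 := (h2.inv (pow_ne_zero 3 hr.ne')).mul h1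
  have h4 : HasDerivAt (avg F) _ r := h3.congr_of_eventuallyEq (by
    filter_upwards [eventually_gt_nhds hr] with t ht using avg_eq F ht.ne')
  refine h4.congr_deriv ?_
  rw [avg_eq F hr.ne', Pi.inv_apply]
  field_simp
  ring

/-- A radial potential of a continuous radial source. -/
def radPot (c : ℝ) (F : ℝ → ℝ) (x : E3) : ℝ := c - 1 / 2 * ∫ σ in (0 : ℝ)..‖x‖ ^ 2, avg F √σ

lemma hasFDerivAt_radPot (c : ℝ) {F : ℝ → ℝ} (hF : Continuous F) (x : E3) :
    HasFDerivAt (radPot c F) (-(avg F ‖x‖) • innerSL ℝ x) x := by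
  have cc : Continuous fun σ => avg F √σ := (continuous_avg hF).comp Real.continuous_sqrt
  have h1 : HasDerivAt (fun y => ∫ σ in (0 : ℝ)..y, avg F √σ) (avg F √(‖x‖ ^ 2)) (‖x‖ ^ 2) :=
    intervalIntegral.integral_hasDerivAt_right (cc.intervalIntegrable _ _)
      cc.stronglyMeasurable.stronglyMeasurableAtFilter cc.continuousAt
  have h2 := h1.comp_hasFDerivAt x (hasStrictFDerivAt_norm_sq x).hasFDerivAt
  have h3 := (h2.const_mul (1 / 2)).const_sub c
  refine h3.congr_fderiv ?_
  rw [Real.sqrt_sq (norm_nonneg x)]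
  ext v
  simp
  ring

lemma hasFDerivAt_avg_inner {F : ℝ → ℝ} (hF : Continuous F) (y x : E3) :
    HasFDerivAt (fun x : E3 => avg F ‖x‖ * inner ℝ x y)
      (avg F ‖x‖ • innerSL ℝ y + ((F ‖x‖ - 3 * avg F ‖x‖) / ‖x‖ ^ 2 * inner ℝ x y) • innerSL ℝ x) x := by
  have hi : HasFDerivAt (fun x : E3 => inner ℝ x y) (innerSL ℝ y) x := by
    have := (innerSL ℝ y).hasFDerivAt (x := x)
    refine this.congr_of_eventuallyEq (Eventually.of_forall fun z => ?_)
    simp [real_inner_comm]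
  rcases eq_or_ne x 0 with rfl | hx
  · simp only [norm_zero, inner_zero_left, mul_zero, zero_smul, add_zero]
    rw [hasFDerivAt_iff_isLittleO_nhds_zero]
    have c0 : Tendsto (fun z : E3 => avg F ‖z‖ - avg F 0) (𝓝 0) (𝓝 0) := by
      have : Continuous fun z : E3 => avg F ‖z‖ - avg F 0 :=
        ((continuous_avg hF).comp continuous_norm).sub continuous_const
      simpa using this.tendsto 0
    have o1 : (fun z : E3 => avg F ‖z‖ - avg F 0) =o[𝓝 0] fun _ => (1 : ℝ) :=
      (Asymptotics.isLittleO_one_iff ℝ).2 c0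
    have o2 : (fun z : E3 => (inner ℝ z y : ℝ)) =O[𝓝 0] fun z => ‖z‖ :=
      Asymptotics.IsBigO.of_bound ‖y‖ (Eventually.of_forall fun z => by
        rw [norm_norm, mul_comm]; exact norm_inner_le_norm z y)
    have := (o1.mul_isBigO o2)
    simp only [one_mul] at this
    refine (this.norm_right.trans_isBigO ?_).congr_left fun z => ?_
    · simpa using (Asymptotics.isBigO_refl (fun z : E3 => z) (𝓝 0)).norm_left
    · simp [real_inner_comm]
      ring
  · have hn : 0 < ‖x‖ := norm_pos_iff.2 hx
    have h1 : HasDerivAt (fun s => avg F √s)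
        ((F √(‖x‖ ^ 2) - 3 * avg F √(‖x‖ ^ 2)) / √(‖x‖ ^ 2) * (1 / (2 * √(‖x‖ ^ 2)))) (‖x‖ ^ 2) :=
      (hasDerivAt_avg hF (Real.sqrt_pos.2 (by positivity))).comp _ (Real.hasDerivAt_sqrt (by positivity))
    have h2 := h1.comp_hasFDerivAt x (hasStrictFDerivAt_norm_sq x).hasFDerivAt
    rw [Real.sqrt_sq hn.le] at h2
    have h3 := h2.mul hi
    have e : ∀ z : E3, avg F ‖z‖ * inner ℝ z y =
        (((fun s => avg F √s) ∘ fun z : E3 => ‖z‖ ^ 2) * fun z : E3 => (inner ℝ z y : ℝ)) z := fun z => by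
      simp [Real.sqrt_sq (norm_nonneg z)]
    refine (h3.congr_of_eventuallyEq (Eventually.of_forall e)).congr_fderiv ?_
    ext v
    simp [Real.sqrt_sq hn.le]
    field_simp

lemma fderiv_radPot_apply (c : ℝ) {F : ℝ → ℝ} (hF : Continuous F) (x y : E3) :
    fderiv ℝ (radPot c F) x y = -(avg F ‖x‖ * inner ℝ x y) := by
  rw [(hasFDerivAt_radPot c hF x).fderiv]; simp

lemma contDiff_radPot (c : ℝ) {F : ℝ → ℝ} (hF : Continuous F) : ContDiff ℝ 2 (radPot c F) := by
  have cm : Continuous fun r => F r - 3 * avg F r := by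
    have := continuous_avg hF; fun_prop
  rw [show (2 : WithTop ℕ∞) = 1 + 1 by norm_num, contDiff_succ_iff_fderiv_apply]
  refine ⟨fun x => (hasFDerivAt_radPot c hF x).differentiableAt, by simp, fun y => ?_⟩
  simp only [fderiv_radPot_apply c hF]
  refine ContDiff.neg ?_
  rw [show (1 : WithTop ℕ∞) = 0 + 1 by norm_num, contDiff_succ_iff_fderiv_apply]
  refine ⟨fun x => (hasFDerivAt_avg_inner hF y x).differentiableAt, by simp, fun v => ?_⟩
  rw [contDiff_zero]
  have e : (fun x : E3 => fderiv ℝ (fun x : E3 => avg F ‖x‖ * inner ℝ x y) x v) = fun x : E3 =>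
      avg F ‖x‖ * inner ℝ y v + (F ‖x‖ - 3 * avg F ‖x‖) / ‖x‖ ^ 2 * (inner ℝ x y * inner ℝ x v) := by
    ext x
    rw [(hasFDerivAt_avg_inner hF y x).fderiv]
    simp
    ring
  rw [e]
  refine (((continuous_avg hF).comp continuous_norm).mul continuous_const).add ?_
  rw [continuous_iff_continuousAt]
  intro x
  rcases eq_or_ne x 0 with rfl | hx
  · unfold ContinuousAt
    simp only [inner_zero_left, mul_zero]
    have t : Tendsto (fun x : E3 => |F ‖x‖ - 3 * avg F ‖x‖| * (‖y‖ * ‖v‖)) (𝓝 0) (𝓝 0) := by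
      have : Continuous fun x : E3 => |F ‖x‖ - 3 * avg F ‖x‖| * (‖y‖ * ‖v‖) :=
        ((cm.comp continuous_norm).abs).mul continuous_const
      have := this.tendsto 0
      rwa [norm_zero, avg_zero, sub_self, abs_zero, zero_mul] at this
    refine squeeze_zero_norm (fun x => ?_) t
    rw [norm_mul, norm_div, Real.norm_eq_abs, norm_mul, norm_pow, norm_norm]
    rcases eq_or_ne x 0 with rfl | hx
    · simp; positivity
    have hn : 0 < ‖x‖ := norm_pos_iff.2 hx
    rw [div_mul_eq_mul_div, div_le_iff₀ (by positivity)]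
    have h1 := norm_inner_le_norm (𝕜 := ℝ) x y
    have h2 := norm_inner_le_norm (𝕜 := ℝ) x v
    calc _ ≤ |F ‖x‖ - 3 * avg F ‖x‖| * ((‖x‖ * ‖y‖) * (‖x‖ * ‖v‖)) := by gcongr
      _ = _ := by ring
  · have hn : ‖x‖ ^ 2 ≠ 0 := pow_ne_zero 2 (norm_ne_zero_iff.2 hx)
    have c1 : ContinuousAt (fun x : E3 => F ‖x‖ - 3 * avg F ‖x‖) x := (cm.comp continuous_norm).continuousAt
    exact (c1.div (continuous_norm.pow 2).continuousAt hn).mul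
      ((continuous_id.inner continuous_const).mul (continuous_id.inner continuous_const)).continuousAt

lemma lap_radPot (c : ℝ) {F : ℝ → ℝ} (hF : Continuous F) (x : E3) : lap (radPot c F) x = -F ‖x‖ := by
  unfold lap
  have e : ∀ i : Fin 3, fderiv ℝ (fun y => fderiv ℝ (radPot c F) y (EuclideanSpace.single i 1)) x
      (EuclideanSpace.single i 1) = -(avg F ‖x‖ + (F ‖x‖ - 3 * avg F ‖x‖) / ‖x‖ ^ 2 * x i ^ 2) := by
    intro i
    simp only [fderiv_radPot_apply c hF]
    have := (hasFDerivAt_avg_inner hF (EuclideanSpace.single i 1) x).fun_neg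
    rw [this.fderiv]
    simp [EuclideanSpace.inner_single_right]
    ring
  simp only [e]
  rw [Finset.sum_neg_distrib, Finset.sum_add_distrib, ← Finset.mul_sum, ← EuclideanSpace.real_norm_sq_eq]
  rcases eq_or_ne x 0 with rfl | hx
  · simp [avg_zero]
  · have hn : ‖x‖ ^ 2 ≠ 0 := pow_ne_zero 2 (norm_ne_zero_iff.2 hx)
    rw [div_mul_cancel₀ _ hn]
    simp

lemma eq_radPot {R : ℝ} {F U : ℝ → ℝ} (hF : Continuous F) (hU : Continuous U)
    (hd : ∀ r ∈ Ioo 0 R, HasDerivAt U (-((r ^ 2)⁻¹ * ∫ t in (0 : ℝ)..r, t ^ 2 * F t)) r)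
    {x : E3} (hx : ‖x‖ < R) : U ‖x‖ = radPot (U 0) F x := by
  rcases (norm_nonneg x).eq_or_lt with h | h
  · rw [← h]; unfold radPot; rw [← h]; simp
  set r := ‖x‖ with hr
  have cc : Continuous fun σ => avg F √σ := (continuous_avg hF).comp Real.continuous_sqrt
  have d1 : ∀ y, HasDerivAt (fun y => ∫ σ in (0 : ℝ)..y, avg F √σ) (avg F √y) y := fun y =>
    intervalIntegral.integral_hasDerivAt_right (cc.intervalIntegrable _ _)
      cc.stronglyMeasurable.stronglyMeasurableAtFilter cc.continuousAt
  have d2 : ∀ s ∈ Ioo 0 r, HasDerivAt (fun s => U s + 1 / 2 * ∫ σ in (0 : ℝ)..s ^ 2, avg F √σ) 0 s := by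
    intro s hs
    have a1 := (d1 (s ^ 2)).comp s (hasDerivAt_pow 2 s)
    have a2 := (hd s ⟨hs.1, hs.2.trans hx⟩).add (a1.const_mul (1 / 2))
    refine a2.congr_deriv ?_
    rw [Real.sqrt_sq hs.1.le, avg_eq F hs.1.ne']
    have := hs.1.ne'
    field_simp
    ring
  have cD : Continuous fun s => U s + 1 / 2 * ∫ σ in (0 : ℝ)..s ^ 2, avg F √σ := by
    have : Continuous fun y => ∫ σ in (0 : ℝ)..y, avg F √σ :=
      continuous_iff_continuousAt.2 fun y => (d1 y).continuousAt
    exact hU.add (continuous_const.mul (this.comp (continuous_pow 2)))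
  obtain ⟨c, -, hc⟩ := exists_hasDerivAt_eq_slope _ _ h cD.continuousOn d2
  rw [eq_comm, div_eq_zero_iff] at hc
  have := hc.resolve_right (by linarith [h])
  simp at this
  unfold radPot
  rw [← hr]
  linarith

/-- Radial functions with a continuous radial source are classical solutions of the Poisson equation. -/
lemma radial_poisson {R : ℝ} {F U : ℝ → ℝ} (hF : Continuous F) (hU : Continuous U)
    (hd : ∀ r ∈ Ioo 0 R, HasDerivAt U (-((r ^ 2)⁻¹ * ∫ t in (0 : ℝ)..r, t ^ 2 * F t)) r) :
    ContDiffOn ℝ 2 (fun x : E3 => U ‖x‖) (ball 0 R) ∧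
      ∀ x ∈ ball (0 : E3) R, -lap (fun x : E3 => U ‖x‖) x = F ‖x‖ := by
  have e : EqOn (fun x : E3 => U ‖x‖) (radPot (U 0) F) (ball 0 R) := fun x hx =>
    eq_radPot hF hU hd (by simpa using hx)
  refine ⟨(contDiff_radPot _ hF).contDiffOn.congr e, fun x hx => ?_⟩
  have : lap (fun x : E3 => U ‖x‖) x = lap (radPot (U 0) F) x := by
    unfold lap
    refine Finset.sum_congr rfl fun i _ => ?_
    have e1 : (fun x : E3 => U ‖x‖) =ᶠ[𝓝 x] radPot (U 0) F := by
      filter_upwards [isOpen_ball.mem_nhds hx] with y hy using e hy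
    have e2 : (fun y => fderiv ℝ (fun x : E3 => U ‖x‖) y (EuclideanSpace.single i 1)) =ᶠ[𝓝 x]
        fun y => fderiv ℝ (radPot (U 0) F) y (EuclideanSpace.single i 1) := by
      filter_upwards [e1.fderiv (𝕜 := ℝ)] with y hy
      rw [hy]
    rw [e2.fderiv_eq]
  rw [this, lap_radPot _ hF, neg_neg]

/-- Area of the unit sphere, `3 |B₁|`. -/
def kap : ℝ := 3 * volume.real (ball (0 : E3) 1)

lemma kap_pos : 0 < kap := by
  unfold kap
  have : 0 < volume.real (ball (0 : E3) 1) :=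
    ENNReal.toReal_pos (measure_ball_pos _ _ one_pos).ne' measure_ball_lt_top.ne
  positivity

lemma integral_ball_radial (R : ℝ) (f : ℝ → ℝ) :
    ∫ x in ball (0 : E3) R, f ‖x‖ = kap * ∫ r in Ioc 0 R, r ^ 2 * f r := by
  have h := integral_fun_norm_addHaar (volume : Measure E3) ((Iio R).indicator f)
  have e1 : ∫ x in ball (0 : E3) R, f ‖x‖ = ∫ x : E3, (Iio R).indicator f ‖x‖ := by
    rw [← integral_indicator measurableSet_ball]
    congr 1
    ext x
    by_cases hx : ‖x‖ < R <;> simp [indicator, hx]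
  have e2 : ∫ y in Ioi (0 : ℝ), y ^ 2 * (Iio R).indicator f y = ∫ r in Ioc 0 R, r ^ 2 * f r := by
    rw [integral_Ioc_eq_integral_Ioo, ← integral_indicator measurableSet_Ioi, ← integral_indicator measurableSet_Ioo]
    congr 1
    ext r
    by_cases h0 : 0 < r <;> by_cases hr : r < R <;> simp [indicator, h0, hr]
  rw [e1, h]
  simp only [finrank_euclideanSpace, Fintype.card_fin, smul_eq_mul, nsmul_eq_mul]
  rw [show 3 - 1 = 2 by norm_num, e2]
  unfold kap
  push_cast
  ring

/-- The optimal radial pair gives a positive classical solution of (P). -/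
theorem exists_solution {R q lam : ℝ} (hR : 0 < R) (hq : 0 < q) (hlow : 3 / 10 * (π ^ 2 / R ^ 2) < lam)
    (hhigh : lam < π ^ 2 / R ^ 2) :
    ∃ (M : ℝ) (u φ : E3 → ℝ), 0 < M ∧ IsSolP R q lam u φ ∧ (∀ x ∈ ball (0 : E3) R, 0 < u x) ∧
      (∀ x ∈ ball (0 : E3) R, 0 < φ x) ∧
      q * ∫ x in ball (0 : E3) R, |u x| ^ 5 * φ x = kap / √(q * M) ∧
      ∀ w g z k : ℝ → ℝ, Adm R w g → Adm R z k → PP R w z ≤ M * √(Nn R lam w g) ^ 5 * √(En R k) := by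
  obtain ⟨M, U, Φ, M0, cU, cΦ, UR, ΦR, pU, pΦ, dU, dΦ, eM, hle⟩ := exists_radial hR hlow hhigh
  set α := (√√(q * M))⁻¹ with hα
  have qM : 0 < q * M := mul_pos hq M0
  have s1 : 0 < √(q * M) := Real.sqrt_pos.2 qM
  have s2 : 0 < √√(q * M) := Real.sqrt_pos.2 s1
  have α0 : 0 < α := inv_pos.2 s2
  have α2 : α ^ 2 = (√(q * M))⁻¹ := by rw [hα, inv_pow, Real.sq_sqrt s1.le]
  have α4 : α ^ 4 = (q * M)⁻¹ := by
    rw [show α ^ 4 = (α ^ 2) ^ 2 by ring, α2, inv_pow, Real.sq_sqrt qM.le]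
  have Mα : M⁻¹ = q * α ^ 4 := by rw [α4]; field_simp
  clear_value α
  have posx : ∀ x ∈ ball (0 : E3) R, 0 < U ‖x‖ ∧ 0 < Φ ‖x‖ := fun x hx =>
    have hx' : ‖x‖ ∈ Ico 0 R := ⟨norm_nonneg x, by simpa using hx⟩
    ⟨pU _ hx', pΦ _ hx'⟩
  have P1 := radial_poisson (R := R) (F := fun r => lam * (α * U r) + q * ((α * U r) ^ 4 * (α * Φ r)))
    (U := fun r => α * U r) (by fun_prop) (by fun_prop) (fun r hr => by
      refine ((dU r hr).const_mul α).congr_deriv ?_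
      have : (fun t => t ^ 2 * (lam * (α * U t) + q * ((α * U t) ^ 4 * (α * Φ t)))) =
          fun t => α * (t ^ 2 * (lam * U t + M⁻¹ * (U t ^ 4 * Φ t))) := by
        ext t; rw [Mα]; ring
      rw [this, intervalIntegral.integral_const_mul]
      ring)
  have P2 := radial_poisson (R := R) (F := fun r => q * (α * U r) ^ 5)
    (U := fun r => α * Φ r) (by fun_prop) (by fun_prop) (fun r hr => by
      refine ((dΦ r hr).const_mul α).congr_deriv ?_
      have : (fun t => t ^ 2 * (q * (α * U t) ^ 5)) =
          fun t => α * (t ^ 2 * (M⁻¹ * U t ^ 5)) := by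
        ext t; rw [Mα]; ring
      rw [this, intervalIntegral.integral_const_mul]
      ring)
  refine ⟨M, fun x => α * U ‖x‖, fun x => α * Φ ‖x‖, M0, ⟨P1.1, P2.1, by fun_prop, by fun_prop, ?_, ?_, ?_, ?_⟩,
    ?_, ?_, ?_, hle⟩
  · intro x hx
    rw [P1.2 x hx, abs_of_pos (mul_pos α0 (posx x hx).1)]
    ring
  · intro x hx
    rw [P2.2 x hx, abs_of_pos (mul_pos α0 (posx x hx).1)]
  · intro x hx
    have : ‖x‖ = R := by simpa using hx
    simp only [this, UR, mul_zero]
  · intro x hx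
    have : ‖x‖ = R := by simpa using hx
    simp only [this, ΦR, mul_zero]
  · exact fun x hx => mul_pos α0 (posx x hx).1
  · exact fun x hx => mul_pos α0 (posx x hx).2
  · have e := integral_ball_radial R (fun r => |α * U r| ^ 5 * (α * Φ r))
    rw [e]
    have : ∫ r in Ioc 0 R, r ^ 2 * (|α * U r| ^ 5 * (α * Φ r)) = α ^ 6 * M := by
      rw [← eM, ← integral_const_mul]
      refine setIntegral_congr_fun measurableSet_Ioc fun r hr => ?_
      have h0 : 0 ≤ U r := by
        rcases hr.2.eq_or_lt with h | h
        · rw [h, UR]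
        · exact (pU r ⟨hr.1.le, h⟩).le
      rw [abs_of_nonneg (mul_nonneg α0.le h0)]
      ring
    rw [this, div_eq_mul_inv, ← α2]
    have : q * (kap * (α ^ 6 * M)) = kap * α ^ 2 * (q * α ^ 4 * M) := by ring
    rw [this, ← Mα]
    field_simp

/-- Signed distance to the plane `⟨x, e⟩ = c`. -/
def sd (e : E3) (c : ℝ) (x : E3) : ℝ := inner ℝ x e - c

/-- Reflection in the plane `⟨x, e⟩ = c`. -/
def rf (e : E3) (c : ℝ) (x : E3) : E3 := x - (2 * sd e c x) • e

section reflection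

variable {e : E3} {c : ℝ}

lemma sd_rf (he : ‖e‖ = 1) (x : E3) : sd e c (rf e c x) = -sd e c x := by
  have : inner ℝ e e = (1 : ℝ) := by rw [real_inner_self_eq_norm_sq, he]; norm_num
  unfold rf
  rw [sd, inner_sub_left, real_inner_smul_left, this]
  unfold sd
  ring

lemma rf_rf (he : ‖e‖ = 1) (x : E3) : rf e c (rf e c x) = x := by
  rw [rf, sd_rf he, rf]
  module

lemma rf_of_sd_eq_zero {x : E3} (h : sd e c x = 0) : rf e c x = x := by
  rw [rf, h]; simp

lemma norm_sub_rf_sq (he : ‖e‖ = 1) (x y : E3) :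
    ‖x - rf e c y‖ ^ 2 = ‖x - y‖ ^ 2 + 4 * sd e c x * sd e c y := by
  have : x - rf e c y = (x - y) + (2 * sd e c y) • e := by unfold rf; module
  rw [this, norm_add_sq_real, norm_smul, he, real_inner_smul_right, inner_sub_left]
  simp only [Real.norm_eq_abs, mul_one, sq_abs, sd]
  ring

lemma dist_rf_rf (he : ‖e‖ = 1) (x y : E3) : dist (rf e c x) (rf e c y) = dist x y := by
  rw [dist_eq_norm, dist_eq_norm]
  have h : ‖rf e c x - rf e c y‖ ^ 2 = ‖x - y‖ ^ 2 := by
    rw [norm_sub_rf_sq he, sd_rf he, norm_sub_rev, norm_sub_rf_sq he, norm_sub_rev]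
    ring
  exact (sq_eq_sq₀ (norm_nonneg _) (norm_nonneg _)).1 h

lemma dist_rf_left (he : ‖e‖ = 1) (x y : E3) : dist (rf e c x) y = dist x (rf e c y) := by
  rw [← dist_rf_rf he, rf_rf he]

lemma norm_rf_sq (he : ‖e‖ = 1) (x : E3) : ‖rf e c x‖ ^ 2 = ‖x‖ ^ 2 - 4 * c * sd e c x := by
  have h := norm_sub_rf_sq (c := c) he 0 x
  simp only [zero_sub, norm_neg] at h
  rw [h]
  simp [sd]
  ring

lemma dist_le_dist_rf (he : ‖e‖ = 1) {x y : E3} (h : 0 ≤ sd e c x * sd e c y) :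
    dist x y ≤ dist x (rf e c y) := by
  rw [dist_eq_norm, dist_eq_norm]
  refine (sq_le_sq₀ (norm_nonneg _) (norm_nonneg _)).1 ?_
  rw [norm_sub_rf_sq he]
  linarith

lemma dist_rf_le_dist (he : ‖e‖ = 1) {x y : E3} (h : sd e c x * sd e c y ≤ 0) :
    dist x (rf e c y) ≤ dist x y := by
  rw [dist_eq_norm, dist_eq_norm]
  refine (sq_le_sq₀ (norm_nonneg _) (norm_nonneg _)).1 ?_
  rw [norm_sub_rf_sq he]
  linarith

lemma isometry_rf (he : ‖e‖ = 1) : Isometry (rf e c) := Isometry.of_dist_eq (dist_rf_rf he)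

lemma measurePreserving_rf (he : ‖e‖ = 1) : MeasurePreserving (rf e c) := by
  have h1 : MeasurePreserving (rf e 0) := by
    let l : E3 ≃ₗᵢ[ℝ] E3 := (ℝ ∙ e)ᗮ.reflection
    have : rf e 0 = l := by
      ext1 x
      simp only [l]
      rw [Submodule.reflection_orthogonal_apply, Submodule.reflection_singleton_apply]
      simp [rf, sd, he, real_inner_comm, mul_smul, two_smul]
    rw [this]
    exact l.measurePreserving
  have h2 := (measurePreserving_add_right (volume : Measure E3) ((2 * c) • e)).comp h1
  have : rf e c = (fun x => x + (2 * c) • e) ∘ rf e 0 := by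
    ext1 x
    simp only [Function.comp, rf, sd]
    module
  rwa [this]

/-- Polarization with respect to the half space `⟨x, e⟩ ≤ c`. -/
def pol (e : E3) (c : ℝ) (f : E3 → ℝ) (x : E3) : ℝ :=
  if sd e c x ≤ 0 then max (f x) (f (rf e c x)) else min (f x) (f (rf e c x))

lemma pol_neg (he : ‖e‖ = 1) (f : E3 → ℝ) {x : E3} (h : sd e c x ≤ 0) :
    pol e c f x = max (f x) (f (rf e c x)) ∧ pol e c f (rf e c x) = min (f x) (f (rf e c x)) := by
  refine ⟨if_pos h, ?_⟩
  unfold pol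
  rw [sd_rf he, rf_rf he]
  rcases h.eq_or_lt with h0 | h0
  · rw [h0, rf_of_sd_eq_zero h0]; simp
  · rw [if_neg (by linarith), min_comm]

lemma pol_pos (he : ‖e‖ = 1) (f : E3 → ℝ) {x : E3} (h : 0 ≤ sd e c x) :
    pol e c f x = min (f x) (f (rf e c x)) ∧ pol e c f (rf e c x) = max (f x) (f (rf e c x)) := by
  have := pol_neg (c := c) he f (x := rf e c x) (by rw [sd_rf he]; linarith)
  rw [rf_rf he] at this
  exact ⟨by rw [this.2, min_comm], by rw [this.1, max_comm]⟩

lemma pol_nonneg {f : E3 → ℝ} (hf : ∀ x, 0 ≤ f x) (x : E3) : 0 ≤ pol e c f x := by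
  unfold pol
  split_ifs
  · exact le_max_of_le_left (hf x)
  · exact le_min (hf _) (hf _)

lemma pol_zero_outside (he : ‖e‖ = 1) (hc : 0 ≤ c) {R : ℝ} {f : E3 → ℝ} (hf : ∀ x, 0 ≤ f x)
    (h0 : ∀ x, R ≤ ‖x‖ → f x = 0) (x : E3) (hx : R ≤ ‖x‖) : pol e c f x = 0 := by
  unfold pol
  split_ifs with h
  · have : ‖x‖ ≤ ‖rf e c x‖ := by
      refine (sq_le_sq₀ (norm_nonneg _) (norm_nonneg _)).1 ?_
      rw [norm_rf_sq he]
      nlinarith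
    rw [h0 x hx, h0 _ (hx.trans this), max_self]
  · rw [h0 x hx, min_eq_left (hf _)]

lemma pol_lipschitz (he : ‖e‖ = 1) {L : NNReal} {f : E3 → ℝ} (hf : LipschitzWith L f) :
    LipschitzWith L (pol e c f) := by
  refine LipschitzWith.of_le_add_mul L fun x y => ?_
  have l := fun a b => hf.le_add_mul a b
  have L0 : (0 : ℝ) ≤ L := L.2
  have l1 := l x y
  have l2 := l (rf e c x) (rf e c y)
  have l3 := l x (rf e c y)
  have l4 := l (rf e c x) y
  have l1' := l y x
  rw [dist_rf_rf he] at l2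
  rw [dist_rf_left he] at l4
  rcases le_total (sd e c x) 0 with hx | hx <;> rcases le_total (sd e c y) 0 with hy | hy
  · rw [(pol_neg he f hx).1, (pol_neg he f hy).1]
    refine max_le ?_ ?_
    · linarith [le_max_left (f y) (f (rf e c y))]
    · linarith [le_max_right (f y) (f (rf e c y))]
  · have := mul_le_mul_of_nonneg_left (dist_rf_le_dist he (mul_nonpos_of_nonpos_of_nonneg hx hy)) L0
    rw [(pol_neg he f hx).1, (pol_pos he f hy).1, ← min_add_add_right]
    refine le_min (max_le ?_ ?_) (max_le ?_ ?_) <;> linarith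
  · rw [(pol_pos he f hx).1, (pol_neg he f hy).1]
    linarith [le_max_left (f y) (f (rf e c y)), min_le_left (f x) (f (rf e c x))]
  · rw [(pol_pos he f hx).1, (pol_pos he f hy).1, ← min_add_add_right]
    refine le_min ?_ ?_
    · linarith [min_le_left (f x) (f (rf e c x))]
    · linarith [min_le_right (f x) (f (rf e c x))]

lemma pol_pair_cases (he : ‖e‖ = 1) (f : E3 → ℝ) (x : E3) :
    (pol e c f x = f x ∧ pol e c f (rf e c x) = f (rf e c x)) ∨
      (pol e c f x = f (rf e c x) ∧ pol e c f (rf e c x) = f x) := by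
  rcases le_total (sd e c x) 0 with hx | hx
  · rw [(pol_neg he f hx).1, (pol_neg he f hx).2]
    rcases le_total (f x) (f (rf e c x)) with h | h <;> simp [h]
  · rw [(pol_pos he f hx).1, (pol_pos he f hx).2]
    rcases le_total (f x) (f (rf e c x)) with h | h <;> simp [h]

lemma integral_symm (he : ‖e‖ = 1) {F : E3 → ℝ} (hF : Integrable F) :
    Integrable (fun x => F x + F (rf e c x)) ∧ ∫ x, (F x + F (rf e c x)) = 2 * ∫ x, F x := by
  have mp := measurePreserving_rf (c := c) he
  have emb : MeasurableEmbedding (rf e c) := (isometry_rf he).isClosedEmbedding.measurableEmbedding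
  have i2 : Integrable (fun x => F (rf e c x)) := mp.integrable_comp_of_integrable hF
  refine ⟨hF.add i2, ?_⟩
  rw [integral_add hF i2, mp.integral_comp emb]
  ring

lemma integral_pol_comp (he : ‖e‖ = 1) {f : E3 → ℝ} (G : ℝ → ℝ) (h1 : Integrable fun x => G (f x))
    (h2 : Integrable fun x => G (pol e c f x)) : ∫ x, G (pol e c f x) = ∫ x, G (f x) := by
  have e1 := (integral_symm (c := c) he h1).2
  have e2 := (integral_symm (c := c) he h2).2
  have : ∀ x, G (pol e c f x) + G (pol e c f (rf e c x)) = G (f x) + G (f (rf e c x)) := fun x => by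
    rcases pol_pair_cases (c := c) he f x with ⟨a, b⟩ | ⟨a, b⟩ <;> rw [a, b]
    ring
  simp only [this] at e2
  linarith

lemma integral_le_pol (he : ‖e‖ = 1) {f h : E3 → ℝ} (f0 : ∀ x, 0 ≤ f x)
    (h1 : Integrable fun x => f x ^ 5 * h x) (h2 : Integrable fun x => pol e c f x ^ 5 * pol e c h x) :
    ∫ x, f x ^ 5 * h x ≤ ∫ x, pol e c f x ^ 5 * pol e c h x := by
  obtain ⟨i1, e1⟩ := integral_symm (c := c) he h1
  obtain ⟨i2, e2⟩ := integral_symm (c := c) he h2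
  have key : ∀ a a' b b' : ℝ, 0 ≤ a → 0 ≤ a' → a ^ 5 * b + a' ^ 5 * b' ≤
      max a a' ^ 5 * max b b' + min a a' ^ 5 * min b b' := by
    intro a a' b b' ha ha'
    rcases le_total a a' with h | h <;> rcases le_total b b' with k | k
    · simp only [max_eq_right h, min_eq_left h, max_eq_right k, min_eq_left k]; linarith
    · simp only [max_eq_right h, min_eq_left h, max_eq_left k, min_eq_right k]
      nlinarith [mul_nonneg (sub_nonneg.2 (pow_le_pow_left₀ ha h 5)) (sub_nonneg.2 k)]
    · simp only [max_eq_left h, min_eq_right h, max_eq_right k, min_eq_left k]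
      nlinarith [mul_nonneg (sub_nonneg.2 (pow_le_pow_left₀ ha' h 5)) (sub_nonneg.2 k)]
    · simp only [max_eq_left h, min_eq_right h, max_eq_left k, min_eq_right k]; linarith
  have := integral_mono i1 i2 fun x => by
    have k := key (f x) (f (rf e c x)) (h x) (h (rf e c x)) (f0 _) (f0 _)
    simp only
    rcases le_total (sd e c x) 0 with hx | hx
    · rw [(pol_neg he f hx).1, (pol_neg he f hx).2, (pol_neg he h hx).1, (pol_neg he h hx).2]
      exact k
    · rw [(pol_pos he f hx).1, (pol_pos he f hx).2, (pol_pos he h hx).1, (pol_pos he h hx).2]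
      linarith
  linarith

/-- Nonlocal Dirichlet energy at scale `δ`. -/
def nlE (δ : ℝ) (f : E3 → ℝ) : ENNReal :=
  ∫⁻ p : E3 × E3, ENNReal.ofReal ((if dist p.1 p.2 < δ then 1 else 0) * (f p.1 - f p.2) ^ 2)

lemma measurable_nlE (δ : ℝ) {f : E3 → ℝ} (hf : Continuous f) : Measurable fun p : E3 × E3 =>
    ENNReal.ofReal ((if dist p.1 p.2 < δ then 1 else 0) * (f p.1 - f p.2) ^ 2) := by
  refine ENNReal.measurable_ofReal.comp (Measurable.mul ?_ ?_)
  · exact Measurable.ite (isOpen_lt (by fun_prop) continuous_const).measurableSet measurable_const measurable_const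
  · exact (Continuous.measurable (by fun_prop))

lemma nlE_pol_le (he : ‖e‖ = 1) (δ : ℝ) {f : E3 → ℝ} (hf : Continuous f) (hp : Continuous (pol e c f)) :
    nlE δ (pol e c f) ≤ nlE δ f := by
  set K : E3 → E3 → ℝ := fun x y => if dist x y < δ then 1 else 0 with hK
  have K0 : ∀ x y, 0 ≤ K x y := fun x y => by rw [hK]; simp only; split_ifs <;> norm_num
  have Kmono : ∀ x y x' y', dist x y ≤ dist x' y' → K x' y' ≤ K x y := fun x y x' y' h => by
    rw [hK]; simp only
    split_ifs with h1 h2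
    · exact le_rfl
    · exact absurd (h.trans_lt h1) h2
    · norm_num
    · exact le_rfl
  have mp := measurePreserving_rf (c := c) he
  have mpi : MeasurePreserving (id : E3 → E3) := MeasurePreserving.id _
  have four : ∀ g : E3 → ℝ, Continuous g → 4 * nlE δ g = ∫⁻ p : E3 × E3, ENNReal.ofReal (
      K p.1 p.2 * ((g p.1 - g p.2) ^ 2 + (g (rf e c p.1) - g (rf e c p.2)) ^ 2) +
      K p.1 (rf e c p.2) * ((g p.1 - g (rf e c p.2)) ^ 2 + (g (rf e c p.1) - g p.2) ^ 2)) := by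
    intro g hg
    have m := measurable_nlE δ hg
    have m1 := m.comp (mp.prod mp).measurable
    have m2 := m.comp (mpi.prod mp).measurable
    have m3 := m.comp (mp.prod mpi).measurable
    simp only [Function.comp_def] at m1 m2 m3
    have a1 : nlE δ g = ∫⁻ p, _ := ((mp.prod mp).lintegral_comp m).symm
    have a2 : nlE δ g = ∫⁻ p, _ := ((mpi.prod mp).lintegral_comp m).symm
    have a3 : nlE δ g = ∫⁻ p, _ := ((mp.prod mpi).lintegral_comp m).symm
    have : 4 * nlE δ g = nlE δ g + nlE δ g + nlE δ g + nlE δ g := by ring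
    rw [this]
    conv_lhs => enter [1, 1, 2]; rw [a1]
    conv_lhs => enter [1, 2]; rw [a2]
    conv_lhs => enter [2]; rw [a3]
    unfold nlE
    rw [← lintegral_add_left m, ← lintegral_add_right _ m2, ← lintegral_add_right _ m3]
    refine lintegral_congr fun p => ?_
    simp only [Prod.map, id]
    have k1 : (if dist (rf e c p.1) (rf e c p.2) < δ then (1 : ℝ) else 0) = K p.1 p.2 := by
      rw [dist_rf_rf he]
    have k2 : (if dist (rf e c p.1) p.2 < δ then (1 : ℝ) else 0) = K p.1 (rf e c p.2) := by
      rw [dist_rf_left he]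
    have k3 : (if dist p.1 p.2 < δ then (1 : ℝ) else 0) = K p.1 p.2 := rfl
    have k4 : (if dist p.1 (rf e c p.2) < δ then (1 : ℝ) else 0) = K p.1 (rf e c p.2) := rfl
    rw [k1, k2, k3, k4]
    have := K0 p.1 p.2
    have := K0 p.1 (rf e c p.2)
    rw [← ENNReal.ofReal_add (by positivity) (by positivity), ← ENNReal.ofReal_add (by positivity) (by positivity),
      ← ENNReal.ofReal_add (by positivity) (by positivity)]
    congr 1
    ring
  have key : ∀ a a' b b' k1 k2 : ℝ, k2 ≤ k1 →
      k1 * ((max a a' - max b b') ^ 2 + (min a a' - min b b') ^ 2) +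
        k2 * ((max a a' - min b b') ^ 2 + (min a a' - max b b') ^ 2) ≤
      k1 * ((a - b) ^ 2 + (a' - b') ^ 2) + k2 * ((a - b') ^ 2 + (a' - b) ^ 2) := by
    intro a a' b b' k1 k2 hk
    rcases le_total a a' with h | h <;> rcases le_total b b' with k | k
    · simp only [max_eq_right h, min_eq_left h, max_eq_right k, min_eq_left k]; linarith
    · simp only [max_eq_right h, min_eq_left h, max_eq_left k, min_eq_right k]
      nlinarith [mul_nonneg (sub_nonneg.2 hk) (mul_nonneg (sub_nonneg.2 h) (sub_nonneg.2 k))]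
    · simp only [max_eq_left h, min_eq_right h, max_eq_right k, min_eq_left k]
      nlinarith [mul_nonneg (sub_nonneg.2 hk) (mul_nonneg (sub_nonneg.2 h) (sub_nonneg.2 k))]
    · simp only [max_eq_left h, min_eq_right h, max_eq_left k, min_eq_right k]; linarith
  have h4 : 4 * nlE δ (pol e c f) ≤ 4 * nlE δ f := by
    rw [four _ hp, four _ hf]
    refine lintegral_mono fun p => ENNReal.ofReal_le_ofReal ?_
    obtain ⟨x, y⟩ := p
    simp only
    have q1 := fun h => Kmono _ _ _ _ (dist_le_dist_rf (c := c) he (x := x) (y := y) h)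
    have q2 := fun h => Kmono _ _ _ _ (dist_rf_le_dist (c := c) he (x := x) (y := y) h)
    rcases le_total (sd e c x) 0 with hx | hx <;> rcases le_total (sd e c y) 0 with hy | hy
    · rw [(pol_neg he f hx).1, (pol_neg he f hx).2, (pol_neg he f hy).1, (pol_neg he f hy).2]
      exact key _ _ _ _ _ _ (q1 (mul_nonneg_of_nonpos_of_nonpos hx hy))
    · rw [(pol_neg he f hx).1, (pol_neg he f hx).2, (pol_pos he f hy).1, (pol_pos he f hy).2]
      have := key (f x) (f (rf e c x)) (f y) (f (rf e c y)) _ _ (q2 (mul_nonpos_of_nonpos_of_nonneg hx hy))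
      have := key (f x) (f (rf e c x)) (f (rf e c y)) (f y) _ _ (q2 (mul_nonpos_of_nonpos_of_nonneg hx hy))
      rw [max_comm (f (rf e c y)), min_comm (f (rf e c y))] at this
      linarith
    · rw [(pol_pos he f hx).1, (pol_pos he f hx).2, (pol_neg he f hy).1, (pol_neg he f hy).2]
      have := key (f x) (f (rf e c x)) (f (rf e c y)) (f y) _ _ (q2 (mul_nonpos_of_nonneg_of_nonpos hx hy))
      rw [max_comm (f (rf e c y)), min_comm (f (rf e c y))] at this
      linarith
    · rw [(pol_pos he f hx).1, (pol_pos he f hx).2, (pol_pos he f hy).1, (pol_pos he f hy).2]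
      have := key (f x) (f (rf e c x)) (f y) (f (rf e c y)) _ _ (q1 (mul_nonneg hx hy))
      linarith
  exact (ENNReal.mul_le_mul_iff_right (by norm_num) (by norm_num)).1 h4

end reflection

/-- Pairs of Lipschitz functions that are competitors for the rearrangement of `(f₀, h₀)`. -/
structure Cls (R : ℝ) (L : NNReal) (f₀ h₀ f h : E3 → ℝ) : Prop where
  lf : LipschitzWith L f
  lh : LipschitzWith L h
  f_nonneg : ∀ x, 0 ≤ f x
  h_nonneg : ∀ x, 0 ≤ h x
  f_out : ∀ x, R ≤ ‖x‖ → f x = 0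
  h_out : ∀ x, R ≤ ‖x‖ → h x = 0
  sq : ∫ x, f x ^ 2 = ∫ x, f₀ x ^ 2
  nf : ∀ δ, nlE δ f ≤ nlE δ f₀
  nh : ∀ δ, nlE δ h ≤ nlE δ h₀
  prod : ∫ x, f₀ x ^ 5 * h₀ x ≤ ∫ x, f x ^ 5 * h x

lemma integrable_of_zero_outside {R : ℝ} {F : E3 → ℝ} (hF : Continuous F) (h0 : ∀ x, R ≤ ‖x‖ → F x = 0) :
    Integrable F :=
  hF.integrable_of_hasCompactSupport (HasCompactSupport.intro (isCompact_closedBall 0 R) fun x hx =>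
    h0 x (by simp only [mem_closedBall, dist_zero_right, not_le] at hx; exact hx.le))

lemma bound_of_zero_outside {R : ℝ} (hR : 0 < R) {L : NNReal} {F : E3 → ℝ} (hF : LipschitzWith L F)
    (h0 : ∀ x, R ≤ ‖x‖ → F x = 0) (x : E3) : F x ≤ L * (2 * R) := by
  have L0 : (0 : ℝ) ≤ L := L.2
  rcases le_total R ‖x‖ with h | h
  · rw [h0 x h]; positivity
  · have n : ‖R • EuclideanSpace.single (0 : Fin 3) (1 : ℝ)‖ = R := by
      rw [norm_smul, PiLp.norm_single]; simp [abs_of_pos hR]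
    have := hF.le_add_mul x (R • EuclideanSpace.single (0 : Fin 3) (1 : ℝ))
    rw [h0 _ n.ge, zero_add] at this
    refine this.trans (mul_le_mul_of_nonneg_left ?_ L0)
    rw [dist_eq_norm]
    refine (norm_sub_le _ _).trans ?_
    rw [n]; linarith

lemma exists_subseq_tendsto {R : ℝ} (hR : 0 < R) {L : NNReal} (f : ℕ → E3 → ℝ)
    (hf : ∀ n, LipschitzWith L (f n)) (hn : ∀ n x, 0 ≤ f n x) (h0 : ∀ n x, R ≤ ‖x‖ → f n x = 0) :
    ∃ k : ℕ → ℕ, StrictMono k ∧ ∃ g : E3 → ℝ, ∀ x, Tendsto (fun n => f (k n) x) atTop (𝓝 (g x)) := by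
  have : CompactSpace (closedBall (0 : E3) R) := isCompact_iff_compactSpace.1 (isCompact_closedBall _ _)
  let A : Set (BoundedContinuousFunction (closedBall (0 : E3) R) ℝ) :=
    {F | LipschitzWith L F ∧ ∀ x, F x ∈ Icc 0 ((L : ℝ) * (2 * R))}
  have hA : IsCompact A := by
    refine BoundedContinuousFunction.arzela_ascoli₂ (Icc 0 ((L : ℝ) * (2 * R))) isCompact_Icc A ?_
      (fun F x hF => hF.2 x) ?_
    · have : A = (⋂ x, ⋂ y, {F | dist (F x) (F y) ≤ L * dist x y}) ∩ ⋂ x, {F | F x ∈ Icc 0 ((L : ℝ) * (2 * R))} := by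
        ext F
        simp [A, lipschitzWith_iff_dist_le_mul]
      rw [this]
      refine IsClosed.inter (isClosed_iInter fun x => isClosed_iInter fun y => ?_) (isClosed_iInter fun x => ?_)
      · exact isClosed_le (Continuous.dist (continuous_eval_const _)
          (continuous_eval_const _)) continuous_const
      · exact isClosed_Icc.preimage (continuous_eval_const _)
    · exact (LipschitzWith.uniformEquicontinuous _ L fun F => F.2.1).equicontinuous
  let F : ℕ → BoundedContinuousFunction (closedBall (0 : E3) R) ℝ := fun n =>
    BoundedContinuousFunction.mkOfCompact ⟨fun x => f n x, (hf n).continuous.comp continuous_subtype_val⟩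
  have hF : ∀ n, F n ∈ A := fun n => by
    refine ⟨fun x y => ?_, fun x => ⟨hn n x, bound_of_zero_outside hR (hf n) (h0 n) x⟩⟩
    exact hf n x y
  obtain ⟨G, -, k, hk, hG⟩ := hA.tendsto_subseq hF
  refine ⟨k, hk, ?_⟩
  have : ∀ x, ∃ y, Tendsto (fun n => f (k n) x) atTop (𝓝 y) := fun x => by
    by_cases hx : x ∈ closedBall (0 : E3) R
    · refine ⟨G ⟨x, hx⟩, ?_⟩
      exact ((continuous_eval_const (F := BoundedContinuousFunction (closedBall (0 : E3) R) ℝ) (⟨x, hx⟩ : closedBall (0 : E3) R)).tendsto G).comp hG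
    · refine ⟨0, ?_⟩
      have : ∀ n, f n x = 0 := fun n => h0 n x (by
        simp only [mem_closedBall, dist_zero_right, not_le] at hx; exact hx.le)
      simp [this]
  choose g hg using this
  exact ⟨g, hg⟩

lemma tendsto_integral_of_zero_outside {R C : ℝ} {F : ℕ → E3 → ℝ} {G : E3 → ℝ} (hF : ∀ n, Continuous (F n))
    (h0 : ∀ n x, R ≤ ‖x‖ → F n x = 0) (hC : ∀ n x, ‖x‖ ≤ R → |F n x| ≤ C)
    (h : ∀ x, Tendsto (fun n => F n x) atTop (𝓝 (G x))) :
    Tendsto (fun n => ∫ x, F n x) atTop (𝓝 (∫ x, G x)) := by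
  refine tendsto_integral_of_dominated_convergence ((closedBall (0 : E3) R).indicator fun _ => C)
    (fun n => (hF n).aestronglyMeasurable) ?_ (fun n => Eventually.of_forall fun x => ?_) (Eventually.of_forall h)
  · exact (integrable_indicator_iff measurableSet_closedBall).2 (integrableOn_const measure_closedBall_lt_top.ne)
  · rw [Real.norm_eq_abs]
    by_cases hx : x ∈ closedBall (0 : E3) R
    · rw [indicator_of_mem hx]
      exact hC n x (by simpa using hx)
    · rw [indicator_of_notMem hx, h0 n x, abs_zero]
      simp only [mem_closedBall, dist_zero_right, not_le] at hx; exact hx.le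

lemma nlE_le_of_tendsto {δ : ℝ} {f : ℕ → E3 → ℝ} {g : E3 → ℝ} {C : ENNReal} (hf : ∀ n, Continuous (f n))
    (h : ∀ x, Tendsto (fun n => f n x) atTop (𝓝 (g x))) (hC : ∀ n, nlE δ (f n) ≤ C) : nlE δ g ≤ C := by
  have : nlE δ g = ∫⁻ p : E3 × E3, liminf (fun n =>
      ENNReal.ofReal ((if dist p.1 p.2 < δ then 1 else 0) * (f n p.1 - f n p.2) ^ 2)) atTop := by
    refine lintegral_congr fun p => (Tendsto.liminf_eq ?_).symm
    exact ENNReal.tendsto_ofReal ((((h p.1).sub (h p.2)).pow 2).const_mul _)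
  rw [this]
  refine (lintegral_liminf_le fun n => measurable_nlE δ (hf n)).trans ?_
  exact liminf_le_of_le (by isBoundedDefault) fun b hb => by
    obtain ⟨n, hn⟩ := hb.exists
    exact hn.trans (hC n)

namespace Cls

variable {R : ℝ} {L : NNReal} {f₀ h₀ : E3 → ℝ}

lemma of_tendsto (hR : 0 < R) {f h : ℕ → E3 → ℝ} {g k : E3 → ℝ} (H : ∀ n, Cls R L f₀ h₀ (f n) (h n))
    (hf : ∀ x, Tendsto (fun n => f n x) atTop (𝓝 (g x))) (hh : ∀ x, Tendsto (fun n => h n x) atTop (𝓝 (k x))) :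
    Cls R L f₀ h₀ g k := by
  have lip : ∀ {f : ℕ → E3 → ℝ} {g : E3 → ℝ}, (∀ n, LipschitzWith L (f n)) →
      (∀ x, Tendsto (fun n => f n x) atTop (𝓝 (g x))) → LipschitzWith L g := fun hL ht =>
    LipschitzWith.of_dist_le_mul fun x y =>
      le_of_tendsto ((ht x).dist (ht y)) (Eventually.of_forall fun n => (hL n).dist_le_mul x y)
  have bf : ∀ n x, f n x ≤ L * (2 * R) := fun n => bound_of_zero_outside hR (H n).lf (H n).f_out
  have bh : ∀ n x, h n x ≤ L * (2 * R) := fun n => bound_of_zero_outside hR (H n).lh (H n).h_out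
  have C0 : 0 ≤ (L : ℝ) * (2 * R) := ((H 0).f_nonneg 0).trans (bf 0 0)
  refine ⟨lip (fun n => (H n).lf) hf, lip (fun n => (H n).lh) hh, fun x => ge_of_tendsto' (hf x) fun n => (H n).f_nonneg x,
    fun x => ge_of_tendsto' (hh x) fun n => (H n).h_nonneg x, fun x hx => ?_, fun x hx => ?_, ?_,
    fun δ => nlE_le_of_tendsto (fun n => (H n).lf.continuous) hf fun n => (H n).nf δ,
    fun δ => nlE_le_of_tendsto (fun n => (H n).lh.continuous) hh fun n => (H n).nh δ, ?_⟩
  · refine tendsto_nhds_unique (hf x) ?_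
    simp [fun n => (H n).f_out x hx]
  · refine tendsto_nhds_unique (hh x) ?_
    simp [fun n => (H n).h_out x hx]
  · refine tendsto_nhds_unique (tendsto_integral_of_zero_outside (R := R) (C := (L * (2 * R)) ^ 2)
      (F := fun n x => f n x ^ 2) (fun n => (H n).lf.continuous.pow 2) (fun n x hx => ?_) (fun n x _ => ?_)
      fun x => (hf x).pow 2) ?_
    · simp [(H n).f_out x hx]
    · rw [abs_of_nonneg (by positivity)]
      exact pow_le_pow_left₀ ((H n).f_nonneg x) (bf n x) 2
    · simp [fun n => (H n).sq]
  · refine ge_of_tendsto' (tendsto_integral_of_zero_outside (R := R) (C := (L * (2 * R)) ^ 5 * (L * (2 * R)))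
      (F := fun n x => f n x ^ 5 * h n x) (fun n => ((H n).lf.continuous.pow 5).mul (H n).lh.continuous)
      (fun n x hx => ?_) (fun n x _ => ?_) fun x => ((hf x).pow 5).mul (hh x)) fun n => (H n).prod
    · simp [(H n).f_out x hx]
    · have := (H n).f_nonneg x
      have := (H n).h_nonneg x
      rw [abs_of_nonneg (by positivity)]
      exact mul_le_mul (pow_le_pow_left₀ (by assumption) (bf n x) 5) (bh n x) (by assumption) (by positivity)

variable {f h : E3 → ℝ}

lemma polar (H : Cls R L f₀ h₀ f h) {e : E3} {c : ℝ} (he : ‖e‖ = 1) (hc : 0 ≤ c) :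
    Cls R L f₀ h₀ (pol e c f) (pol e c h) := by
  have o1 := pol_zero_outside he hc H.f_nonneg H.f_out
  have o2 := pol_zero_outside he hc H.h_nonneg H.h_out
  have l1 := pol_lipschitz (c := c) he H.lf
  have l2 := pol_lipschitz (c := c) he H.lh
  refine ⟨l1, l2, pol_nonneg H.f_nonneg, pol_nonneg H.h_nonneg, o1, o2, ?_,
    fun δ => (nlE_pol_le he δ H.lf.continuous l1.continuous).trans (H.nf δ),
    fun δ => (nlE_pol_le he δ H.lh.continuous l2.continuous).trans (H.nh δ), H.prod.trans ?_⟩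
  · rw [← H.sq]
    refine integral_pol_comp he (fun t => t ^ 2) ?_ ?_
    · exact integrable_of_zero_outside (R := R) (H.lf.continuous.pow 2) fun x hx => by simp [H.f_out x hx]
    · exact integrable_of_zero_outside (R := R) (l1.continuous.pow 2) fun x hx => by simp [o1 x hx]
  · refine integral_le_pol he H.f_nonneg ?_ ?_
    · exact integrable_of_zero_outside (R := R) ((H.lf.continuous.pow 5).mul H.lh.continuous)
        fun x hx => by simp [H.f_out x hx]
    · exact integrable_of_zero_outside (R := R) ((l1.continuous.pow 5).mul l2.continuous)
        fun x hx => by simp [o1 x hx]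

lemma exists_min (hR : 0 < R) (H : Cls R L f₀ h₀ f h) : ∃ f h, Cls R L f₀ h₀ f h ∧
    ∀ f' h', Cls R L f₀ h₀ f' h' → ∫ x, (f x + h x) * ‖x‖ ^ 2 ≤ ∫ x, (f' x + h' x) * ‖x‖ ^ 2 := by
  let S : Set ℝ := {t | ∃ f h, Cls R L f₀ h₀ f h ∧ t = ∫ x, (f x + h x) * ‖x‖ ^ 2}
  have bdd : BddBelow S := ⟨0, by
    rintro t ⟨f, h, K, rfl⟩
    exact integral_nonneg fun x => mul_nonneg (add_nonneg (K.f_nonneg x) (K.h_nonneg x)) (by positivity)⟩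
  obtain ⟨t, -, ht, hS⟩ := exists_seq_tendsto_sInf (S := S) ⟨_, f, h, H, rfl⟩ bdd
  choose f h hfh hI using hS
  obtain ⟨k, hk, g, hg⟩ := exists_subseq_tendsto hR f (fun n => (hfh n).lf) (fun n => (hfh n).f_nonneg)
    (fun n => (hfh n).f_out)
  obtain ⟨l, hl, g', hg'⟩ := exists_subseq_tendsto hR (fun n => h (k n)) (fun n => (hfh _).lh)
    (fun n => (hfh _).h_nonneg) (fun n => (hfh _).h_out)
  have hg2 : ∀ x, Tendsto (fun n => f (k (l n)) x) atTop (𝓝 (g x)) := fun x => (hg x).comp hl.tendsto_atTop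
  have K := of_tendsto hR (fun n => hfh (k (l n))) hg2 hg'
  refine ⟨g, g', K, fun f' h' K' => ?_⟩
  have lim : Tendsto (fun n => ∫ x, (f (k (l n)) x + h (k (l n)) x) * ‖x‖ ^ 2) atTop
      (𝓝 (∫ x, (g x + g' x) * ‖x‖ ^ 2)) := by
    refine tendsto_integral_of_zero_outside (R := R) (C := (L * (2 * R) + L * (2 * R)) * R ^ 2)
      (F := fun n x => (f (k (l n)) x + h (k (l n)) x) * ‖x‖ ^ 2)
      (fun n => ((hfh _).lf.continuous.add (hfh _).lh.continuous).mul (continuous_norm.pow 2))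
      (fun n x hx => by simp [(hfh _).f_out x hx, (hfh _).h_out x hx]) (fun n x hx => ?_)
      fun x => ((hg2 x).add (hg' x)).mul_const _
    have a1 := (hfh (k (l n))).f_nonneg x
    have a2 := (hfh (k (l n))).h_nonneg x
    have a3 := bound_of_zero_outside hR (hfh (k (l n))).lf (hfh _).f_out x
    have a4 := bound_of_zero_outside hR (hfh (k (l n))).lh (hfh _).h_out x
    rw [abs_of_nonneg (by positivity)]
    gcongr
  have lim2 : Tendsto (fun n => t (k (l n))) atTop (𝓝 (sInf S)) := ht.comp (hk.tendsto_atTop.comp hl.tendsto_atTop)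
  simp only [← hI] at lim
  rw [tendsto_nhds_unique lim lim2]
  exact csInf_le bdd ⟨f', h', K', rfl⟩

lemma le_of_min (H : Cls R L f₀ h₀ f h)
    (hm : ∀ f' h', Cls R L f₀ h₀ f' h' → ∫ x, (f x + h x) * ‖x‖ ^ 2 ≤ ∫ x, (f' x + h' x) * ‖x‖ ^ 2)
    {p q : E3} (hpq : ‖p‖ < ‖q‖) : f q ≤ f p ∧ h q ≤ h p := by
  have hne : 0 < ‖q - p‖ := norm_pos_iff.2 fun h0 => by rw [sub_eq_zero.1 h0] at hpq; exact lt_irrefl _ hpq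
  set e : E3 := ‖q - p‖⁻¹ • (q - p) with hedef
  have he : ‖e‖ = 1 := by rw [hedef, norm_smul, norm_inv, norm_norm, inv_mul_cancel₀ hne.ne']
  have hqp : q - p = ‖q - p‖ • e := by rw [hedef, smul_smul, mul_inv_cancel₀ hne.ne', one_smul]
  set c : ℝ := inner ℝ ((1 / 2 : ℝ) • (p + q)) e with hcdef
  have hc : 0 < c := by
    rw [hcdef, hedef, real_inner_smul_left, real_inner_smul_right]
    have : inner ℝ (p + q) (q - p) = ‖q‖ ^ 2 - ‖p‖ ^ 2 := by
      rw [inner_add_left, inner_sub_right, inner_sub_right, real_inner_self_eq_norm_sq, real_inner_self_eq_norm_sq,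
        real_inner_comm]
      ring
    rw [this]
    have : 0 < ‖q‖ ^ 2 - ‖p‖ ^ 2 := by nlinarith [norm_nonneg p]
    positivity
  have hsd : sd e c p = -(‖q - p‖ / 2) := by
    have : sd e c p = -(1 / 2) * inner ℝ (q - p) e := by
      rw [sd, hcdef, real_inner_smul_left, inner_add_left, inner_sub_left]; ring
    rw [this, hqp, real_inner_smul_left, real_inner_self_eq_norm_sq, he, norm_smul, he, norm_norm]
    ring
  have hrf : rf e c p = q := by
    rw [rf, hsd]
    have : (2 * -(‖q - p‖ / 2)) • e = -(q - p) := by rw [hqp, norm_smul, norm_norm, he]; module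
    rw [this]; abel
  have K := H.polar he hc.le
  set G : E3 → ℝ := fun x => (f x + h x) * ‖x‖ ^ 2
  set G' : E3 → ℝ := fun x => (pol e c f x + pol e c h x) * ‖x‖ ^ 2
  have iG : Integrable G := integrable_of_zero_outside (R := R)
    ((H.lf.continuous.add H.lh.continuous).mul (continuous_norm.pow 2))
    fun x hx => by simp [G, H.f_out x hx, H.h_out x hx]
  have iG' : Integrable G' := integrable_of_zero_outside (R := R)
    ((K.lf.continuous.add K.lh.continuous).mul (continuous_norm.pow 2))
    fun x hx => by simp [G', K.f_out x hx, K.h_out x hx]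
  obtain ⟨j1, e1⟩ := integral_symm (c := c) he iG
  obtain ⟨j2, e2⟩ := integral_symm (c := c) he iG'
  set D : E3 → ℝ := fun x => 4 * c * (sd e c x * ((f x - pol e c f x) + (h x - pol e c h x)))
  have hD : ∀ x, D x = (G x + G (rf e c x)) - (G' x + G' (rf e c x)) := fun x => by
    have s : ∀ f : E3 → ℝ, pol e c f (rf e c x) = f x + f (rf e c x) - pol e c f x := fun f => by
      rcases pol_pair_cases (c := c) he f x with ⟨a, b⟩ | ⟨a, b⟩ <;> rw [a, b] <;> ring
    simp only [G, G', D, s, norm_rf_sq he]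
    ring
  have iD : Integrable D := (j1.sub j2).congr (Eventually.of_forall fun x => (hD x).symm)
  have intD : ∫ x, D x = 2 * (∫ x, G x) - 2 * ∫ x, G' x := by
    rw [← e1, ← e2, ← integral_sub j1 j2]
    exact integral_congr_ae (Eventually.of_forall hD)
  have sgn : ∀ f : E3 → ℝ, ∀ x, 0 ≤ sd e c x * (f x - pol e c f x) := fun f x => by
    rcases le_total (sd e c x) 0 with hx | hx
    · rw [(pol_neg he f hx).1]
      exact mul_nonneg_of_nonpos_of_nonpos hx (sub_nonpos.2 (le_max_left _ _))
    · rw [(pol_pos he f hx).1]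
      exact mul_nonneg hx (sub_nonneg.2 (min_le_left _ _))
  have D0 : ∀ x, 0 ≤ D x := fun x => by
    have := sgn f x
    have := sgn h x
    simp only [D]
    rw [mul_add (sd e c x)]
    positivity
  have cD : Continuous D := by
    have := H.lf.continuous
    have := H.lh.continuous
    have := K.lf.continuous
    have := K.lh.continuous
    have : Continuous (sd e c) := by unfold sd; fun_prop
    fun_prop
  have z : ∫ x, D x = 0 := le_antisymm (by rw [intD]; linarith [hm _ _ K]) (integral_nonneg D0)
  have z2 := (cD.ae_eq_iff_eq volume continuous_zero).1 ((integral_eq_zero_iff_of_nonneg D0 iD).1 z)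
  have z3 : D p = 0 := congrFun z2 p
  have sp : sd e c p < 0 := by rw [hsd]; linarith
  have z4 : (f p - pol e c f p) + (h p - pol e c h p) = 0 := by
    have : 4 * c * (sd e c p * ((f p - pol e c f p) + (h p - pol e c h p))) = 0 := z3
    simpa [hc.ne', sp.ne] using this
  rw [(pol_neg he f sp.le).1, (pol_neg he h sp.le).1, hrf] at z4
  constructor
  · linarith [le_max_right (f p) (f q), le_max_left (f p) (f q), le_max_left (h p) (h q)]
  · linarith [le_max_left (f p) (f q), le_max_left (h p) (h q), le_max_right (h p) (h q)]

end Cls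

lemma radial_of_antitone {f : E3 → ℝ} (hf : Continuous f) (h : ∀ p q : E3, ‖p‖ < ‖q‖ → f q ≤ f p) {p q : E3}
    (hpq : ‖p‖ = ‖q‖) : f p = f q := by
  have key : ∀ p q : E3, ‖p‖ = ‖q‖ → f q ≤ f p := fun p q hpq => by
    rcases eq_or_ne q 0 with rfl | hq
    · rw [norm_zero, norm_eq_zero] at hpq
      rw [hpq]
    · have t : Tendsto (fun t : ℝ => f (t • q)) (𝓝[>] 1) (𝓝 (f q)) := by
        have : Continuous fun t : ℝ => f (t • q) := by fun_prop
        simpa using (this.tendsto 1).mono_left nhdsWithin_le_nhds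
      refine le_of_tendsto t ?_
      filter_upwards [self_mem_nhdsWithin] with t ht
      refine h _ _ ?_
      have ht : 1 < t := ht
      rw [hpq, norm_smul, Real.norm_eq_abs, abs_of_pos (by linarith)]
      have := norm_pos_iff.2 hq
      nlinarith
  exact le_antisymm (key q p hpq.symm) (key p q hpq)

/-- Existence of a radial competitor. -/
lemma exists_radial_competitor {R : ℝ} (hR : 0 < R) {L : NNReal} {f₀ h₀ : E3 → ℝ} (l1 : LipschitzWith L f₀)
    (l2 : LipschitzWith L h₀) (n1 : ∀ x, 0 ≤ f₀ x) (n2 : ∀ x, 0 ≤ h₀ x) (o1 : ∀ x, R ≤ ‖x‖ → f₀ x = 0)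
    (o2 : ∀ x, R ≤ ‖x‖ → h₀ x = 0) : ∃ f h, Cls R L f₀ h₀ f h ∧ (∀ x y, ‖x‖ = ‖y‖ → f x = f y) ∧
      ∀ x y, ‖x‖ = ‖y‖ → h x = h y := by
  have H : Cls R L f₀ h₀ f₀ h₀ := ⟨l1, l2, n1, n2, o1, o2, rfl, fun _ => le_rfl, fun _ => le_rfl, le_rfl⟩
  obtain ⟨f, h, K, hm⟩ := H.exists_min hR
  exact ⟨f, h, K, fun x y => radial_of_antitone K.lf.continuous fun p q hpq => (K.le_of_min hm hpq).1,
    fun x y => radial_of_antitone K.lh.continuous fun p q hpq => (K.le_of_min hm hpq).2⟩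

/-- Mean of the squared difference quotients at scale `δ`. -/
def dq (δ : ℝ) (f : E3 → ℝ) : ENNReal :=
  ∫⁻ ζ in ball (0 : E3) 1, ∫⁻ x, ENNReal.ofReal ((f (x + δ • ζ) - f x) ^ 2)

lemma nlE_eq_dq {δ : ℝ} (hδ : 0 < δ) {f : E3 → ℝ} (hf : Continuous f) :
    nlE δ f = ENNReal.ofReal (δ ^ 3) * dq δ f := by
  have s1 : nlE δ f = ∫⁻ x, ∫⁻ y, ENNReal.ofReal ((if dist x y < δ then 1 else 0) * (f x - f y) ^ 2) := by
    unfold nlE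
    rw [Measure.volume_eq_prod, lintegral_prod _ (measurable_nlE δ hf).aemeasurable]
  have s2 : ∀ x : E3, ∫⁻ y, ENNReal.ofReal ((if dist x y < δ then 1 else 0) * (f x - f y) ^ 2) =
      ∫⁻ z, ENNReal.ofReal ((if ‖z‖ < δ then 1 else 0) * (f (x + z) - f x) ^ 2) := fun x => by
    rw [← lintegral_add_left_eq_self _ x]
    refine lintegral_congr fun z => ?_
    rw [dist_self_add_right]
    congr 2
    ring
  have m1 : Measurable fun p : E3 × E3 =>
      ENNReal.ofReal ((if ‖p.2‖ < δ then 1 else 0) * (f (p.1 + p.2) - f p.1) ^ 2) := by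
    refine ENNReal.measurable_ofReal.comp (Measurable.mul ?_ ?_)
    · exact Measurable.ite (isOpen_lt (by fun_prop) continuous_const).measurableSet measurable_const measurable_const
    · exact (Continuous.measurable (by fun_prop))
  have m2 : Measurable fun z : E3 =>
      ∫⁻ x, ENNReal.ofReal ((if ‖z‖ < δ then 1 else 0) * (f (x + z) - f x) ^ 2) :=
    m1.lintegral_prod_left'
  rw [s1]
  simp_rw [s2]
  rw [lintegral_lintegral_swap m1.aemeasurable]
  have s3 := lintegral_map (μ := (volume : Measure E3)) m2 (measurable_const_smul δ)
  rw [Measure.map_addHaar_smul _ hδ.ne', lintegral_smul_measure, smul_eq_mul] at s3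
  have s4 : ∫⁻ z : E3, ∫⁻ x, ENNReal.ofReal ((if ‖δ • z‖ < δ then 1 else 0) * (f (x + δ • z) - f x) ^ 2) = dq δ f := by
    rw [dq, ← lintegral_indicator measurableSet_ball]
    refine lintegral_congr fun z => ?_
    have : ‖δ • z‖ < δ ↔ z ∈ ball (0 : E3) 1 := by
      rw [norm_smul, Real.norm_eq_abs, abs_of_pos hδ, mem_ball_zero_iff]
      constructor <;> intro h <;> nlinarith
    by_cases hz : z ∈ ball (0 : E3) 1
    · rw [indicator_of_mem hz]
      simp only [this, hz, if_true, one_mul]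
    · rw [indicator_of_notMem hz]
      simp only [this, hz, if_false, zero_mul, ENNReal.ofReal_zero, lintegral_zero]
  rw [s4] at s3
  rw [← s3, ← mul_assoc, ← ENNReal.ofReal_mul (by positivity), finrank_euclideanSpace_fin,
    abs_of_pos (by positivity), mul_inv_cancel₀ (by positivity), ENNReal.ofReal_one, one_mul]

lemma sq_sub_le {f : E3 → ℝ} (hf : ContDiff ℝ 1 f) (x z : E3) : ENNReal.ofReal ((f (x + z) - f x) ^ 2) ≤
    ∫⁻ t in Ioc (0 : ℝ) 1, ENNReal.ofReal ((fderiv ℝ f (x + t • z) z) ^ 2) := by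
  set g : ℝ → ℝ := fun t => fderiv ℝ f (x + t • z) z
  have cg : Continuous g := ((hf.continuous_fderiv one_ne_zero).comp (by fun_prop)).clm_apply continuous_const
  have e1 : ∫ t in (0 : ℝ)..1, g t = f (x + z) - f x := by
    have := intervalIntegral.integral_eq_sub_of_hasDerivAt (f := fun t : ℝ => f (x + t • z)) (f' := g) (a := 0) (b := 1)
      (fun t _ => by
        have h1 := ((hf.differentiable one_ne_zero) (x + t • z)).hasFDerivAt
        have h2 : HasDerivAt (fun t : ℝ => x + t • z) z t := by
          simpa using ((hasDerivAt_id t).smul_const z).const_add x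
        exact h1.comp_hasDerivAt t h2) (cg.intervalIntegrable _ _)
    simpa using this
  rw [← e1]
  set m := ∫ t in (0 : ℝ)..1, g t with hm
  have e2 : m ^ 2 ≤ ∫ t in (0 : ℝ)..1, g t ^ 2 := by
    have p : 0 ≤ ∫ t in (0 : ℝ)..1, (g t - m) ^ 2 := intervalIntegral.integral_nonneg zero_le_one fun t _ => sq_nonneg _
    have : ∫ t in (0 : ℝ)..1, (g t - m) ^ 2 = (∫ t in (0 : ℝ)..1, g t ^ 2) - m ^ 2 := by
      have : ∀ t, (g t - m) ^ 2 = g t ^ 2 - (2 * m * g t - m ^ 2) := fun t => by ring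
      simp only [this]
      have c1 : Continuous fun t => g t ^ 2 := cg.pow 2
      have c2 : Continuous fun t => 2 * m * g t := continuous_const.mul cg
      have c3 : Continuous fun t => 2 * m * g t - m ^ 2 := c2.sub continuous_const
      rw [intervalIntegral.integral_sub (c1.intervalIntegrable _ _) (c3.intervalIntegrable _ _),
        intervalIntegral.integral_sub (c2.intervalIntegrable _ _) (continuous_const.intervalIntegrable _ _), intervalIntegral.integral_const_mul, ← hm]
      simp
      ring
    linarith
  refine (ENNReal.ofReal_le_ofReal e2).trans ?_
  have c1 : Continuous fun t => g t ^ 2 := cg.pow 2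
  rw [intervalIntegral.integral_of_le zero_le_one, ofReal_integral_eq_lintegral_ofReal
    c1.integrableOn_Ioc (Eventually.of_forall fun t => sq_nonneg _)]

lemma lintegral_sq_sub_le {f : E3 → ℝ} (hf : ContDiff ℝ 1 f) (z : E3) :
    ∫⁻ x, ENNReal.ofReal ((f (x + z) - f x) ^ 2) ≤ ∫⁻ x, ENNReal.ofReal ((fderiv ℝ f x z) ^ 2) := by
  have cf := hf.continuous_fderiv one_ne_zero
  refine (lintegral_mono fun x => sq_sub_le hf x z).trans ?_
  rw [lintegral_lintegral_swap]
  · have : ∀ t : ℝ, ∫⁻ x, ENNReal.ofReal ((fderiv ℝ f (x + t • z) z) ^ 2) =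
        ∫⁻ x, ENNReal.ofReal ((fderiv ℝ f x z) ^ 2) := fun t =>
      lintegral_add_right_eq_self (fun x => ENNReal.ofReal ((fderiv ℝ f x z) ^ 2)) (t • z)
    simp only [this]
    simp
  · have : Continuous fun p : E3 × ℝ => fderiv ℝ f (p.1 + p.2 • z) z := by fun_prop
    exact (ENNReal.measurable_ofReal.comp (this.pow 2).measurable).aemeasurable

/-- The constant in the average of a squared linear form over the unit ball. -/
def c1 : ENNReal := ∫⁻ ζ in ball (0 : E3) 1, ENNReal.ofReal ((inner ℝ (EuclideanSpace.single (0 : Fin 3) (1 : ℝ)) ζ) ^ 2)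

lemma c1_ne_top : c1 ≠ ⊤ := by
  refine ne_top_of_le_ne_top (b := ∫⁻ ζ in ball (0 : E3) 1, 1) ?_ ?_
  · simp
  · refine setLIntegral_mono' measurableSet_ball fun ζ hζ => ?_
    rw [← ENNReal.ofReal_one]
    refine ENNReal.ofReal_le_ofReal ?_
    rw [mem_ball_zero_iff] at hζ
    have := abs_real_inner_le_norm (EuclideanSpace.single (0 : Fin 3) (1 : ℝ)) ζ
    rw [PiLp.norm_single, norm_one, one_mul] at this
    rw [sq_le_one_iff_abs_le_one]
    linarith

lemma c1_ne_zero : c1 ≠ 0 := by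
  set e := EuclideanSpace.single (0 : Fin 3) (1 : ℝ) with he
  have ne : ‖e‖ = 1 := by rw [he, PiLp.norm_single, norm_one]
  have h : ENNReal.ofReal (1 / 16) * volume (ball ((1 / 2 : ℝ) • e) (1 / 4)) ≤ c1 := by
    rw [← setLIntegral_const, c1]
    refine (setLIntegral_mono' measurableSet_ball fun ζ hζ => ?_).trans
      (lintegral_mono_set (ball_subset_ball' (by rw [dist_zero_right, norm_smul, ne]; norm_num)))
    refine ENNReal.ofReal_le_ofReal ?_
    rw [mem_ball_iff_norm] at hζ
    have h1 : inner ℝ e ζ = inner ℝ e (ζ - (1 / 2 : ℝ) • e) + 1 / 2 := by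
      rw [inner_sub_right, real_inner_smul_right, real_inner_self_eq_norm_sq, ne]; ring
    have h2 := abs_real_inner_le_norm e (ζ - (1 / 2 : ℝ) • e)
    rw [ne, one_mul] at h2
    have h3 := (abs_le.1 (h2.trans hζ.le)).1
    rw [← he, h1]
    nlinarith
  intro h0
  rw [h0, nonpos_iff_eq_zero, mul_eq_zero] at h
  rcases h with h | h
  · norm_num at h
  · exact (measure_ball_pos volume _ (by norm_num)).ne' h

lemma lintegral_inner_sq (v : E3) : ∫⁻ ζ in ball (0 : E3) 1, ENNReal.ofReal ((inner ℝ v ζ) ^ 2) =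
    c1 * ENNReal.ofReal (‖v‖ ^ 2) := by
  set e := EuclideanSpace.single (0 : Fin 3) (1 : ℝ) with he
  have ne : ‖e‖ = 1 := by rw [he, PiLp.norm_single, norm_one]
  have hv : ‖v‖ = ‖‖v‖ • e‖ := by rw [norm_smul, norm_norm, ne, mul_one]
  let T : E3 ≃ₗᵢ[ℝ] E3 := (ℝ ∙ (v - ‖v‖ • e))ᗮ.reflection
  have hT : T v = ‖v‖ • e := Submodule.reflection_sub hv
  have mp : MeasurePreserving T := T.measurePreserving
  have m : Measurable fun ζ : E3 => (ball (0 : E3) 1).indicator (fun ζ => ENNReal.ofReal ((inner ℝ (‖v‖ • e) ζ) ^ 2)) ζ :=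
    (Measurable.indicator (ENNReal.measurable_ofReal.comp (Continuous.measurable (by fun_prop))) measurableSet_ball)
  rw [c1, ← he, ← lintegral_indicator measurableSet_ball, mul_comm, ← lintegral_const_mul' _ _ ENNReal.ofReal_ne_top,
    ← lintegral_indicator measurableSet_ball]
  have e1 := mp.lintegral_comp m
  calc _ = ∫⁻ ζ, (ball (0 : E3) 1).indicator (fun ζ => ENNReal.ofReal ((inner ℝ (‖v‖ • e) ζ) ^ 2)) (T ζ) := by
        refine lintegral_congr fun ζ => ?_
        have : T ζ ∈ ball (0 : E3) 1 ↔ ζ ∈ ball (0 : E3) 1 := by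
          rw [mem_ball_zero_iff, mem_ball_zero_iff, T.norm_map]
        by_cases h : ζ ∈ ball (0 : E3) 1
        · rw [indicator_of_mem h, indicator_of_mem (this.2 h), ← hT, T.inner_map_map]
        · rw [indicator_of_notMem h, indicator_of_notMem (fun k => h (this.1 k))]
    _ = _ := e1
    _ = _ := by
        refine lintegral_congr fun ζ => ?_
        by_cases h : ζ ∈ ball (0 : E3) 1
        · rw [indicator_of_mem h, indicator_of_mem h, real_inner_smul_left, mul_pow, ENNReal.ofReal_mul (by positivity)]
        · rw [indicator_of_notMem h, indicator_of_notMem h]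

lemma lintegral_clm_sq (a : E3 →L[ℝ] ℝ) : ∫⁻ ζ in ball (0 : E3) 1, ENNReal.ofReal ((a ζ) ^ 2) =
    c1 * ENNReal.ofReal (‖a‖ ^ 2) := by
  have := lintegral_inner_sq ((InnerProductSpace.toDual ℝ E3).symm a)
  simpa using this

lemma lintegral_fderiv_sq (f : E3 → ℝ) :
    ∫⁻ ζ in ball (0 : E3) 1, ∫⁻ x, ENNReal.ofReal ((fderiv ℝ f x ζ) ^ 2) =
      c1 * ∫⁻ x, ENNReal.ofReal (‖fderiv ℝ f x‖ ^ 2) := by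
  rw [lintegral_lintegral_swap, ← lintegral_const_mul' _ _ c1_ne_top]
  · exact lintegral_congr fun x => lintegral_clm_sq _
  · have m : Measurable fun p : E3 × E3 => fderiv ℝ f p.2 p.1 := by
      have c : Continuous fun q : (E3 →L[ℝ] ℝ) × E3 => q.1 q.2 := by fun_prop
      exact c.measurable.comp (((measurable_fderiv ℝ f).comp measurable_snd).prodMk measurable_fst)
    exact (ENNReal.measurable_ofReal.comp (m.pow_const 2)).aemeasurable

lemma dq_le {f : E3 → ℝ} (hf : ContDiff ℝ 1 f) {δ : ℝ} : dq δ f ≤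
    ENNReal.ofReal (δ ^ 2) * (c1 * ∫⁻ x, ENNReal.ofReal (‖fderiv ℝ f x‖ ^ 2)) := by
  rw [← lintegral_fderiv_sq, ← lintegral_const_mul' _ _ ENNReal.ofReal_ne_top, dq]
  refine lintegral_mono fun ζ => (lintegral_sq_sub_le hf _).trans ?_
  rw [← lintegral_const_mul' _ _ ENNReal.ofReal_ne_top]
  refine lintegral_mono fun x => ?_
  rw [← ENNReal.ofReal_mul (by positivity), map_smul, smul_eq_mul, mul_pow]

lemma le_liminf_dq {f : E3 → ℝ} {L : NNReal} (hf : LipschitzWith L f) {δ : ℕ → ℝ} (hδ : Tendsto δ atTop (𝓝[>] 0)) :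
    c1 * (∫⁻ x, ENNReal.ofReal (‖fderiv ℝ f x‖ ^ 2)) ≤
      liminf (fun n => ENNReal.ofReal ((δ n ^ 2)⁻¹) * dq (δ n) f) atTop := by
  have hδ0 : Tendsto δ atTop (𝓝[≠] 0) := hδ.mono_right (nhdsWithin_mono _ fun x hx => ne_of_gt hx)
  rw [← lintegral_fderiv_sq]
  have cf := hf.continuous
  have m : ∀ n, Measurable fun p : E3 × E3 =>
      ENNReal.ofReal ((δ n ^ 2)⁻¹) * ENNReal.ofReal ((f (p.2 + δ n • p.1) - f p.2) ^ 2) := fun n =>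
    (ENNReal.measurable_ofReal.comp (Continuous.measurable (by fun_prop))).const_mul _
  have s1 : ∀ ζ, ∫⁻ x, ENNReal.ofReal ((fderiv ℝ f x ζ) ^ 2) ≤ liminf (fun n => ∫⁻ x,
      ENNReal.ofReal ((δ n ^ 2)⁻¹) * ENNReal.ofReal ((f (x + δ n • ζ) - f x) ^ 2)) atTop := fun ζ => by
    have mm : ∀ n, Measurable fun x =>
        ENNReal.ofReal ((δ n ^ 2)⁻¹) * ENNReal.ofReal ((f (x + δ n • ζ) - f x) ^ 2) := fun n =>
      (ENNReal.measurable_ofReal.comp (Continuous.measurable (by fun_prop))).const_mul _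
    refine le_trans (le_of_eq ?_) (lintegral_liminf_le mm)
    refine lintegral_congr_ae ?_
    filter_upwards [hf.ae_differentiableAt (μ := volume)] with x hx
    refine (Tendsto.liminf_eq ?_).symm
    have t1 := (hx.hasFDerivAt.hasLineDerivAt ζ).tendsto_slope_zero.comp hδ0
    have t2 := ENNReal.tendsto_ofReal (t1.pow 2)
    refine t2.congr fun n => ?_
    simp only [Function.comp, smul_eq_mul]
    rw [← ENNReal.ofReal_mul (by positivity), mul_pow, inv_pow]
  refine (lintegral_mono fun ζ => s1 ζ).trans ?_
  refine (lintegral_liminf_le fun n => (m n).lintegral_prod_right').trans (le_of_eq ?_)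
  congr 1
  ext1 n
  simp_rw [lintegral_const_mul' _ _ ENNReal.ofReal_ne_top]
  rw [dq]

/-- Comparison of Dirichlet energies from comparison of the nonlocal ones. -/
lemma lintegral_fderiv_le {f f₀ : E3 → ℝ} {L : NNReal} (hf : LipschitzWith L f) (hf₀ : ContDiff ℝ 1 f₀)
    (h : ∀ δ, nlE δ f ≤ nlE δ f₀) :
    ∫⁻ x, ENNReal.ofReal (‖fderiv ℝ f x‖ ^ 2) ≤ ∫⁻ x, ENNReal.ofReal (‖fderiv ℝ f₀ x‖ ^ 2) := by
  have k : ∀ δ, 0 < δ → dq δ f ≤ dq δ f₀ := fun δ hδ => by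
    have := h δ
    rw [nlE_eq_dq hδ hf.continuous, nlE_eq_dq hδ hf₀.continuous] at this
    exact (ENNReal.mul_le_mul_iff_right (ENNReal.ofReal_pos.2 (by positivity)).ne' ENNReal.ofReal_ne_top).1 this
  have hδ : Tendsto (fun n : ℕ => (1 : ℝ) / (n + 1)) atTop (𝓝[>] 0) :=
    tendsto_nhdsWithin_iff.2 ⟨tendsto_one_div_add_atTop_nhds_zero_nat, Eventually.of_forall fun n => by
      simp only [mem_Ioi]; positivity⟩
  have := le_liminf_dq hf hδ
  refine (ENNReal.mul_le_mul_iff_right c1_ne_zero c1_ne_top).1 (this.trans ?_)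
  refine liminf_le_of_le (by isBoundedDefault) fun b hb => ?_
  obtain ⟨n, hn⟩ := hb.exists
  have p : (0 : ℝ) < 1 / (n + 1) := by positivity
  refine hn.trans ?_
  refine (mul_le_mul_right ((k _ p).trans (dq_le hf₀)) _).trans (le_of_eq ?_)
  rw [← mul_assoc, ← ENNReal.ofReal_mul (by positivity), inv_mul_cancel₀ (by positivity), ENNReal.ofReal_one, one_mul]

lemma adm_of_radial {R : ℝ} (hR : 0 < R) {L : NNReal} {F : ℝ → ℝ} (hF : LipschitzWith L F) (h0 : F R = 0) :
    Adm R (fun r => r * F r) (deriv fun r => r * F r) ∧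
      En R (deriv fun r => r * F r) = ∫ r in (0 : ℝ)..R, r ^ 2 * deriv F r ^ 2 := by
  obtain ⟨C, hC⟩ := (isCompact_Icc (a := (0 : ℝ)) (b := R)).exists_bound_of_continuousOn hF.continuous.continuousOn
  have C0 : 0 ≤ C := (norm_nonneg _).trans (hC 0 ⟨le_rfl, hR.le⟩)
  have L0 : (0 : ℝ) ≤ L := L.2
  have lw : LipschitzOnWith (R.toNNReal * L + C.toNNReal) (fun r => r * F r) (Icc 0 R) := by
    refine LipschitzOnWith.of_dist_le_mul fun x hx y hy => ?_
    have l := hF.dist_le_mul x y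
    have c := hC y hy
    push_cast
    rw [Real.coe_toNNReal _ hR.le, Real.coe_toNNReal _ C0]
    rw [Real.dist_eq] at *
    rw [Real.norm_eq_abs] at c
    have : x * F x - y * F y = x * (F x - F y) + (x - y) * F y := by ring
    rw [this]
    refine (abs_add_le _ _).trans ?_
    rw [abs_mul, abs_mul, abs_of_nonneg hx.1, add_mul]
    refine add_le_add ?_ ?_
    · rw [mul_assoc]
      exact mul_le_mul hx.2 l (abs_nonneg _) hR.le
    · rw [mul_comm]
      exact mul_le_mul_of_nonneg_right c (abs_nonneg _)
  have lq : LipschitzOnWith (C.toNNReal * (R.toNNReal * L + C.toNNReal) + (R * C).toNNReal * L)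
      (fun r => r * F r * F r) (Icc 0 R) := by
    refine LipschitzOnWith.of_dist_le_mul fun x hx y hy => ?_
    have l := hF.dist_le_mul x y
    have l2 := lw.dist_le_mul x hx y hy
    have c := hC y hy
    have cx := hC x hx
    push_cast at *
    rw [Real.coe_toNNReal _ hR.le, Real.coe_toNNReal _ C0] at l2
    rw [Real.coe_toNNReal _ hR.le, Real.coe_toNNReal _ C0, Real.coe_toNNReal (R * C) (by positivity)]
    rw [Real.dist_eq] at *
    rw [Real.norm_eq_abs] at c cx
    have : x * F x * F x - y * F y * F y = F x * (x * F x - y * F y) + (y * F y) * (F x - F y) := by ring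
    rw [this]
    refine (abs_add_le _ _).trans ?_
    rw [abs_mul, abs_mul, abs_mul, abs_of_nonneg hy.1, add_mul, mul_assoc C, mul_assoc (R * C)]
    gcongr
    exact hy.2
  refine ⟨Adm.of_lipschitz hR.le lw (by simp) (by simp [h0]) (measurable_deriv _) fun r _ => rfl, ?_⟩
  have dae : ∀ᵐ r : ℝ, DifferentiableAt ℝ F r := hF.ae_differentiableAt
  have bd : ∀ r, |deriv F r| ≤ L := fun r => norm_deriv_le_of_lipschitz hF
  have ac : AbsolutelyContinuousOnInterval (fun r => r * F r * F r) 0 R := by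
    apply LipschitzOnWith.absolutelyContinuousOnInterval; rwa [uIcc_of_le hR.le]
  have f1 := ac.integral_deriv_eq_sub
  simp only [h0, mul_zero, zero_mul, sub_zero] at f1
  have i1 := ac.intervalIntegrable_deriv
  have i2 : IntervalIntegrable (fun r => r ^ 2 * deriv F r ^ 2) volume 0 R := by
    rw [intervalIntegrable_iff_integrableOn_Ioc_of_le hR.le]
    refine Measure.integrableOn_of_bounded (M := R ^ 2 * L ^ 2) (by simp)
      (((measurable_id.pow_const 2).mul ((measurable_deriv F).pow_const 2)).aestronglyMeasurable) ?_
    refine (ae_restrict_iff' measurableSet_Ioc).2 (Eventually.of_forall fun r hr => ?_)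
    simp only [Real.norm_eq_abs, abs_mul, abs_pow]
    gcongr
    · rw [abs_of_pos hr.1]; exact hr.2
    · exact bd r
  have : En R (deriv fun r => r * F r) = ∫ r in (0 : ℝ)..R, (deriv (fun r => r * F r * F r) r + r ^ 2 * deriv F r ^ 2) := by
    unfold En
    refine intervalIntegral.integral_congr_ae ?_
    filter_upwards [dae] with r hr _
    have d1 : HasDerivAt (fun r => r * F r) (1 * F r + r * deriv F r) r := (hasDerivAt_id r).mul hr.hasDerivAt
    rw [d1.deriv, (d1.fun_mul hr.hasDerivAt).deriv]
    ring
  rw [this, intervalIntegral.integral_add i1 i2, f1, zero_add]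

lemma radial_deriv_sq_le {f : E3 → ℝ} (hf : ∀ x y, ‖x‖ = ‖y‖ → f x = f y) {x : E3} (hx : x ≠ 0)
    (hd : DifferentiableAt ℝ f x) :
    deriv (fun r : ℝ => f (r • EuclideanSpace.single (0 : Fin 3) (1 : ℝ))) ‖x‖ ^ 2 ≤ ‖fderiv ℝ f x‖ ^ 2 := by
  have nx := norm_pos_iff.2 hx
  have ne : ‖EuclideanSpace.single (0 : Fin 3) (1 : ℝ)‖ = 1 := by rw [PiLp.norm_single, norm_one]
  have n1 : ‖‖x‖⁻¹ • x‖ = 1 := by rw [norm_smul, norm_inv, norm_norm, inv_mul_cancel₀ nx.ne']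
  have e : (fun r : ℝ => f (r • EuclideanSpace.single (0 : Fin 3) (1 : ℝ))) = fun r => f (r • (‖x‖⁻¹ • x)) := by
    ext1 r
    refine hf _ _ ?_
    rw [norm_smul, norm_smul, ne, n1]
  have d : HasDerivAt (fun r : ℝ => r • (‖x‖⁻¹ • x)) (‖x‖⁻¹ • x) ‖x‖ := by
    simpa using (hasDerivAt_id ‖x‖).smul_const (‖x‖⁻¹ • x)
  have hd' : HasFDerivAt f (fderiv ℝ f x) (‖x‖ • (‖x‖⁻¹ • x)) := by
    rw [smul_smul, mul_inv_cancel₀ nx.ne', one_smul]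
    exact hd.hasFDerivAt
  have d2 : HasDerivAt (fun r : ℝ => f (r • (‖x‖⁻¹ • x))) (fderiv ℝ f x (‖x‖⁻¹ • x)) ‖x‖ := hd'.comp_hasDerivAt _ d
  rw [e, d2.deriv]
  refine sq_le_sq' ?_ ?_
  · have := (fderiv ℝ f x).le_opNorm (‖x‖⁻¹ • x)
    rw [n1, mul_one, Real.norm_eq_abs] at this
    exact (abs_le.1 this).1
  · have := (fderiv ℝ f x).le_opNorm (‖x‖⁻¹ • x)
    rw [n1, mul_one, Real.norm_eq_abs] at this
    exact (abs_le.1 this).2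

/-- A Lipschitz radial competitor and its profile. -/
lemma profile {R : ℝ} (hR : 0 < R) {L : NNReal} {f f₀ : E3 → ℝ} (lf : LipschitzWith L f)
    (hf : ∀ x y, ‖x‖ = ‖y‖ → f x = f y) (out : ∀ x, R ≤ ‖x‖ → f x = 0) (hf₀ : ContDiff ℝ 1 f₀)
    (cs : HasCompactSupport f₀) (h : ∀ δ, nlE δ f ≤ nlE δ f₀) :
    ∃ F : ℝ → ℝ, LipschitzWith L F ∧ F R = 0 ∧ (∀ x, f x = F ‖x‖) ∧
      kap * (∫ r in (0 : ℝ)..R, r ^ 2 * deriv F r ^ 2) ≤ ∫ x, ‖fderiv ℝ f₀ x‖ ^ 2 := by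
  have ne : ‖EuclideanSpace.single (0 : Fin 3) (1 : ℝ)‖ = 1 := by rw [PiLp.norm_single, norm_one]
  set e := EuclideanSpace.single (0 : Fin 3) (1 : ℝ)
  refine ⟨fun r => f (r • e), ?_, out _ (by rw [norm_smul, ne, Real.norm_eq_abs, abs_of_pos hR, mul_one]),
    fun x => hf _ _ (by rw [norm_smul, norm_norm, ne, mul_one]), ?_⟩
  · refine LipschitzWith.of_dist_le_mul fun x y => (lf.dist_le_mul _ _).trans (le_of_eq ?_)
    rw [dist_eq_norm, dist_eq_norm, ← sub_smul, norm_smul, ne, mul_one]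
  set F : ℝ → ℝ := fun r => f (r • e) with hF
  rw [intervalIntegral.integral_of_le hR.le, ← integral_ball_radial R fun r => deriv F r ^ 2]
  have cd := hf₀.continuous_fderiv one_ne_zero
  have i0 : Integrable fun x => ‖fderiv ℝ f₀ x‖ ^ 2 := by
    have cn : Continuous fun x => ‖fderiv ℝ f₀ x‖ ^ 2 := cd.norm.pow 2
    have c3 : HasCompactSupport (fderiv ℝ f₀) := cs.fderiv (𝕜 := ℝ)
    have c4 : HasCompactSupport fun x => ‖fderiv ℝ f₀ x‖ ^ 2 := by
      refine c3.mono fun x hx => ?_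
      rw [Function.mem_support] at *
      intro h
      rw [h] at hx
      simp at hx
    exact cn.integrable_of_hasCompactSupport c4
  have key := lintegral_fderiv_le lf hf₀ h
  rw [← ofReal_integral_eq_lintegral_ofReal i0 (Eventually.of_forall fun x => sq_nonneg _)] at key
  have mF : Measurable fun x : E3 => deriv F ‖x‖ ^ 2 := ((measurable_deriv F).comp measurable_norm).pow_const 2
  rw [integral_eq_lintegral_of_nonneg_ae (Eventually.of_forall fun x => sq_nonneg _) mF.aestronglyMeasurable]
  refine ENNReal.toReal_le_of_le_ofReal (integral_nonneg fun x => sq_nonneg _) (le_trans ?_ key)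
  refine (setLIntegral_le_lintegral _ _).trans (lintegral_mono_ae ?_)
  filter_upwards [lf.ae_differentiableAt (μ := volume), (by simp [ae_iff] : ∀ᵐ x : E3, x ≠ 0)] with x hx hx0
  exact ENNReal.ofReal_le_ofReal (radial_deriv_sq_le hf hx0 hx)

/-- The sharp inequality for nonnegative smooth functions. -/
lemma smooth_ineq {R lam M : ℝ} (hR : 0 < R) (hM : 0 < M)
    (H : ∀ w g z k : ℝ → ℝ, Adm R w g → Adm R z k → PP R w z ≤ M * √(Nn R lam w g) ^ 5 * √(En R k))
    {f₀ h₀ : E3 → ℝ} (c1 : ContDiff ℝ 1 f₀) (c2 : ContDiff ℝ 1 h₀) (n1 : ∀ x, 0 ≤ f₀ x) (n2 : ∀ x, 0 ≤ h₀ x)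
    (o1 : ∀ x, R ≤ ‖x‖ → f₀ x = 0) (o2 : ∀ x, R ≤ ‖x‖ → h₀ x = 0) :
    ∫ x, f₀ x ^ 5 * h₀ x ≤ M / kap ^ 2 *
      √((∫ x, ‖fderiv ℝ f₀ x‖ ^ 2) - lam * ∫ x, f₀ x ^ 2) ^ 5 * √(∫ x, ‖fderiv ℝ h₀ x‖ ^ 2) := by
  have s1 : HasCompactSupport f₀ := HasCompactSupport.intro (isCompact_closedBall 0 R) fun x hx =>
    o1 x (by simp only [mem_closedBall, dist_zero_right, not_le] at hx; exact hx.le)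
  have s2 : HasCompactSupport h₀ := HasCompactSupport.intro (isCompact_closedBall 0 R) fun x hx =>
    o2 x (by simp only [mem_closedBall, dist_zero_right, not_le] at hx; exact hx.le)
  obtain ⟨L1, l1⟩ := c1.lipschitzWith_of_hasCompactSupport s1 one_ne_zero
  obtain ⟨L2, l2⟩ := c2.lipschitzWith_of_hasCompactSupport s2 one_ne_zero
  obtain ⟨f, h, K, rf, rh⟩ := exists_radial_competitor hR (l1.weaken (le_max_left L1 L2))
    (l2.weaken (le_max_right L1 L2)) n1 n2 o1 o2
  obtain ⟨F, lF, FR, eF, bF⟩ := profile hR K.lf rf K.f_out c1 s1 K.nf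
  obtain ⟨G, lG, GR, eG, bG⟩ := profile hR K.lh rh K.h_out c2 s2 K.nh
  obtain ⟨aF, EF⟩ := adm_of_radial hR lF FR
  obtain ⟨aG, EG⟩ := adm_of_radial hR lG GR
  have k0 := kap_pos
  have key := H _ _ _ _ aF aG
  have F0 : ∀ r, 0 ≤ r → 0 ≤ F r := fun r hr => by
    have := K.f_nonneg (r • EuclideanSpace.single (0 : Fin 3) (1 : ℝ))
    rwa [eF, norm_smul, PiLp.norm_single, norm_one, Real.norm_eq_abs, abs_of_nonneg hr, mul_one] at this
  have full : ∀ g : E3 → ℝ, (∀ x, R ≤ ‖x‖ → g x = 0) → ∫ x in ball (0 : E3) R, g x = ∫ x, g x := fun g hg =>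
    setIntegral_eq_integral_of_forall_compl_eq_zero fun x hx => hg x (by simpa using hx)
  have eP : kap * PP R (fun r => r * F r) (fun r => r * G r) = ∫ x, f x ^ 5 * h x := by
    rw [← full _ fun x hx => by simp [K.f_out x hx]]
    simp only [eF, eG]
    rw [integral_ball_radial R fun r => F r ^ 5 * G r, PP]
    congr 1
    refine setIntegral_congr_fun measurableSet_Ioc fun r hr => ?_
    have r0 : 0 < r := hr.1
    simp only [pp]
    rw [max_eq_left (mul_nonneg r0.le (F0 r r0.le))]
    field
  have eQ : kap * ∫ r in (0 : ℝ)..R, (r * F r) ^ 2 = ∫ x, f₀ x ^ 2 := by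
    rw [← K.sq, ← full _ fun x hx => by simp [K.f_out x hx]]
    simp only [eF]
    rw [integral_ball_radial R fun r => F r ^ 2, intervalIntegral.integral_of_le hR.le]
    simp only [mul_pow]
  set Q := (∫ x, ‖fderiv ℝ f₀ x‖ ^ 2) - lam * ∫ x, f₀ x ^ 2
  set T := ∫ x, ‖fderiv ℝ h₀ x‖ ^ 2
  have q1 : Nn R lam (fun r => r * F r) (deriv fun r => r * F r) ≤ Q / kap := by
    rw [le_div_iff₀ k0, Nn, EF]
    have : lam * (kap * ∫ r in (0 : ℝ)..R, (r * F r) ^ 2) = lam * ∫ x, f₀ x ^ 2 := by rw [eQ]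
    simp only [Q]
    linarith
  have q2 : En R (deriv fun r => r * G r) ≤ T / kap := by
    rw [le_div_iff₀ k0, EG]
    linarith
  have s5 : √(Q / kap) ^ 5 * √(T / kap) = √Q ^ 5 * √T / kap ^ 3 := by
    rw [Real.sqrt_div' _ k0.le, Real.sqrt_div' _ k0.le, div_pow, div_mul_div_comm, ← pow_succ]
    congr 1
    rw [show (5 + 1) = 2 * 3 from rfl, pow_mul, Real.sq_sqrt k0.le]
  calc _ ≤ ∫ x, f x ^ 5 * h x := K.prod
    _ = kap * PP R (fun r => r * F r) (fun r => r * G r) := eP.symm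
    _ ≤ kap * (M * √(Q / kap) ^ 5 * √(T / kap)) := by
        refine mul_le_mul_of_nonneg_left (key.trans ?_) k0.le
        gcongr
    _ = _ := by
        rw [mul_assoc M, s5]
        field

/-- A continuous cutoff on `ℝ` vanishing on `[-ε, ε]` and tending to one off the origin. -/
def kcut (ε t : ℝ) : ℝ := min 1 (max 0 (|t| / ε - 1))

/-- A continuous approximation of the sign function vanishing on `[-ε, ε]`. -/
def scut (ε t : ℝ) : ℝ := max 0 (min 1 (t / ε - 1)) - max 0 (min 1 (-t / ε - 1))

/-- The primitive of `k` vanishing at the origin. -/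
def prim (k : ℝ → ℝ) (t : ℝ) : ℝ := ∫ s in (0:ℝ)..t, k s

lemma continuous_kcut (ε : ℝ) : Continuous (kcut ε) := by unfold kcut; fun_prop

lemma continuous_scut (ε : ℝ) : Continuous (scut ε) := by unfold scut; fun_prop

lemma abs_kcut_le (ε t : ℝ) : |kcut ε t| ≤ 1 := by
  unfold kcut
  rw [abs_le]
  exact ⟨by have := le_min (zero_le_one' ℝ) (le_max_left 0 (|t| / ε - 1)); linarith, min_le_left _ _⟩

lemma kcut_nonneg (ε t : ℝ) : 0 ≤ kcut ε t := le_min (zero_le_one' ℝ) (le_max_left _ _)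

lemma abs_scut_le (ε t : ℝ) : |scut ε t| ≤ 1 := by
  unfold scut
  have h1 := le_max_left 0 (min 1 (t / ε - 1))
  have h2 := le_max_left 0 (min 1 (-t / ε - 1))
  have h3 : max 0 (min 1 (t / ε - 1)) ≤ 1 := max_le zero_le_one (min_le_left _ _)
  have h4 : max 0 (min 1 (-t / ε - 1)) ≤ 1 := max_le zero_le_one (min_le_left _ _)
  rw [abs_le]; constructor <;> linarith

lemma kcut_eq_zero {ε t : ℝ} (hε : 0 < ε) (ht : |t| ≤ ε) : kcut ε t = 0 := by
  have : |t| / ε ≤ 1 := by rwa [div_le_one hε]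
  unfold kcut
  rw [max_eq_left (by linarith), min_eq_right zero_le_one]

lemma scut_of_le {ε t : ℝ} (hε : 0 < ε) (ht : t ≤ ε) : max 0 (min 1 (t / ε - 1)) = 0 := by
  have : t / ε ≤ 1 := by rwa [div_le_one hε]
  exact max_eq_left ((min_le_right _ _).trans (by linarith))

lemma scut_eq_zero {ε t : ℝ} (hε : 0 < ε) (ht : |t| ≤ ε) : scut ε t = 0 := by
  rw [abs_le] at ht
  unfold scut
  rw [scut_of_le hε ht.2, scut_of_le hε (by linarith), sub_zero]

lemma scut_nonneg {ε t : ℝ} (hε : 0 < ε) (ht : 0 ≤ t) : 0 ≤ scut ε t := by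
  unfold scut
  rw [scut_of_le hε (t := -t) (by linarith), sub_zero]
  exact le_max_left _ _

lemma scut_nonpos {ε t : ℝ} (hε : 0 < ε) (ht : t ≤ 0) : scut ε t ≤ 0 := by
  unfold scut
  rw [scut_of_le hε (t := t) (by linarith), zero_sub]
  exact neg_nonpos.2 (le_max_left _ _)

/-- The cutoff scales `1 / (n + 1)`. -/
def eps (n : ℕ) : ℝ := 1 / ((n : ℝ) + 1)

lemma eps_pos (n : ℕ) : 0 < eps n := by unfold eps; positivity

lemma eventually_le_div_eps {t : ℝ} (ht : 0 < t) : ∀ᶠ n in atTop, 1 ≤ t / eps n - 1 := by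
  obtain ⟨N, hN⟩ := exists_nat_gt (2 / t)
  filter_upwards [eventually_ge_atTop N] with n hn
  have h1 : (N : ℝ) ≤ n := by exact_mod_cast hn
  have h2 : 2 / t * t = 2 := div_mul_cancel₀ _ ht.ne'
  unfold eps
  rw [div_div_eq_mul_div, div_one]
  nlinarith

lemma tendsto_kcut {t : ℝ} (ht : t ≠ 0) : Tendsto (fun n => kcut (eps n) t) atTop (𝓝 1) := by
  refine tendsto_const_nhds.congr' ?_
  filter_upwards [eventually_le_div_eps (abs_pos.2 ht)] with n hn
  unfold kcut
  exact (min_eq_left (hn.trans (le_max_right _ _))).symm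

lemma tendsto_scut_pos {t : ℝ} (ht : 0 < t) : Tendsto (fun n => scut (eps n) t) atTop (𝓝 1) := by
  refine tendsto_const_nhds.congr' ?_
  filter_upwards [eventually_le_div_eps ht] with n hn
  unfold scut
  rw [scut_of_le (eps_pos n) (t := -t) (by linarith [eps_pos n]), min_eq_left hn]
  norm_num

lemma tendsto_scut_neg {t : ℝ} (ht : t < 0) : Tendsto (fun n => scut (eps n) t) atTop (𝓝 (-1)) := by
  refine tendsto_const_nhds.congr' ?_
  filter_upwards [eventually_le_div_eps (neg_pos.2 ht)] with n hn
  unfold scut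
  rw [scut_of_le (eps_pos n) (t := t) (by linarith [eps_pos n]), min_eq_left hn]
  norm_num

lemma hasDerivAt_prim {k : ℝ → ℝ} (hk : Continuous k) (t : ℝ) : HasDerivAt (prim k) (k t) t :=
  intervalIntegral.integral_hasDerivAt_right (hk.intervalIntegrable _ _)
    hk.stronglyMeasurable.stronglyMeasurableAtFilter hk.continuousAt

lemma contDiff_prim {k : ℝ → ℝ} (hk : Continuous k) : ContDiff ℝ 1 (prim k) := by
  rw [contDiff_one_iff_deriv]
  refine ⟨fun t => (hasDerivAt_prim hk t).differentiableAt, ?_⟩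
  rwa [funext fun t => (hasDerivAt_prim hk t).deriv]

lemma prim_eq_zero {k : ℝ → ℝ} {ε t : ℝ} (h : ∀ s, |s| ≤ ε → k s = 0) (ht : |t| ≤ ε) : prim k t = 0 := by
  unfold prim
  rw [intervalIntegral.integral_congr (g := fun _ => (0:ℝ)) ?_, intervalIntegral.integral_zero]
  intro s hs
  refine h s (le_trans ?_ ht)
  rw [mem_uIcc] at hs
  rcases hs with hs | hs
  · rw [abs_of_nonneg hs.1]; exact hs.2.trans (le_abs_self _)
  · rw [abs_of_nonpos hs.2]; exact (neg_le_neg hs.1).trans (neg_le_abs _)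

lemma abs_prim_le {k : ℝ → ℝ} (h : ∀ s, |k s| ≤ 1) (t : ℝ) : |prim k t| ≤ |t| := by
  have := intervalIntegral.norm_integral_le_of_norm_le_const (a := 0) (b := t) (C := 1) (f := k)
    fun s _ => h s
  simpa [prim] using this

lemma tendsto_prim {k : ℕ → ℝ → ℝ} {κ : ℝ → ℝ} (hk : ∀ n, Continuous (k n)) (h1 : ∀ n s, |k n s| ≤ 1)
    (hl : ∀ s, s ≠ 0 → Tendsto (fun n => k n s) atTop (𝓝 (κ s))) (t : ℝ) :
    Tendsto (fun n => prim (k n) t) atTop (𝓝 (prim κ t)) := by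
  refine intervalIntegral.tendsto_integral_filter_of_dominated_convergence (fun _ => 1)
    (Eventually.of_forall fun n => (hk n).aestronglyMeasurable)
    (Eventually.of_forall fun n => Eventually.of_forall fun s _ => h1 n s)
    intervalIntegrable_const ?_
  filter_upwards [(by simp [ae_iff] : ∀ᵐ s : ℝ, s ≠ 0)] with s hs _ using hl s hs

lemma tendsto_prim_kcut (t : ℝ) : Tendsto (fun n => prim (kcut (eps n)) t) atTop (𝓝 t) := by
  have := tendsto_prim (κ := fun _ => 1) (fun n => continuous_kcut (eps n)) (fun n => abs_kcut_le _)
    (fun s hs => tendsto_kcut hs) t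
  simpa [prim] using this

lemma tendsto_prim_scut (t : ℝ) : Tendsto (fun n => prim (scut (eps n)) t) atTop (𝓝 |t|) := by
  have := tendsto_prim (κ := fun s => if 0 < s then 1 else -1) (fun n => continuous_scut (eps n))
    (fun n => abs_scut_le _)
    (fun s hs => by
      rcases hs.lt_or_gt with h | h
      · simpa [h.not_gt] using tendsto_scut_neg h
      · simpa [h] using tendsto_scut_pos h) t
  convert this using 2
  unfold prim
  rcases le_total 0 t with h | h
  · rw [intervalIntegral.integral_congr_ae (g := fun _ => (1:ℝ)), abs_of_nonneg h]
    · simp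
    · refine Eventually.of_forall fun s hs => ?_
      rw [uIoc_of_le h] at hs
      simp [hs.1]
  · rw [intervalIntegral.integral_congr (g := fun _ => (-1:ℝ)), abs_of_nonpos h]
    · simp
    · intro s hs
      rw [uIcc_of_ge h] at hs
      simp [hs.2.not_gt]

lemma prim_scut_nonneg {ε : ℝ} (hε : 0 < ε) (t : ℝ) : 0 ≤ prim (scut ε) t := by
  unfold prim
  rcases le_total 0 t with h | h
  · exact intervalIntegral.integral_nonneg h fun s hs => scut_nonneg hε hs.1
  · rw [intervalIntegral.integral_symm, ← intervalIntegral.integral_neg]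
    exact intervalIntegral.integral_nonneg h fun s hs => neg_nonneg.2 (scut_nonpos hε hs.2)

/-- Extension by zero of a function on a ball. -/
def ext0 (R : ℝ) (h : E3 → ℝ) : E3 → ℝ := (ball (0:E3) R).indicator h

lemma ext0_of_le {R : ℝ} {h : E3 → ℝ} {x : E3} (hx : R ≤ ‖x‖) : ext0 R h x = 0 :=
  indicator_of_notMem (by simpa using hx) _

lemma ext0_of_mem {R : ℝ} {h : E3 → ℝ} {x : E3} (hx : x ∈ ball (0:E3) R) : ext0 R h x = h x :=
  indicator_of_mem hx _

lemma ext0_eventuallyEq {R : ℝ} {h : E3 → ℝ} {x : E3} (hx : x ∈ ball (0:E3) R) : ext0 R h =ᶠ[𝓝 x] h := by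
  filter_upwards [isOpen_ball.mem_nhds hx] with y hy using ext0_of_mem hy

section
variable {R ε : ℝ} {v h : E3 → ℝ}

lemma ext0_eventually_zero (hv : ContinuousOn v (closedBall 0 R)) (h0 : ∀ x ∈ sphere (0:E3) R, v x = 0)
    (hε : 0 < ε) (hh : ∀ x ∈ ball (0:E3) R, |v x| ≤ ε → h x = 0) {x : E3} (hx : x ∉ ball (0:E3) R) :
    ext0 R h =ᶠ[𝓝 x] fun _ => 0 := by
  by_cases hc : x ∈ closedBall (0:E3) R
  · have hs : v x = 0 := h0 x (by
      rw [mem_ball, not_lt] at hx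
      exact le_antisymm hc hx)
    have ht := (hv x hc).tendsto
    rw [hs] at ht
    have := ht (Metric.ball_mem_nhds (0:ℝ) hε)
    rw [mem_map, mem_nhdsWithin_iff_eventually] at this
    filter_upwards [this] with y hy
    by_cases hyb : y ∈ ball (0:E3) R
    · rw [ext0_of_mem hyb]
      have := hy (ball_subset_closedBall hyb)
      rw [mem_preimage, mem_ball, Real.dist_eq, sub_zero] at this
      exact hh y hyb this.le
    · exact indicator_of_notMem hyb _
  · filter_upwards [isClosed_closedBall.isOpen_compl.mem_nhds hc] with y hy
    exact indicator_of_notMem (fun h => hy (ball_subset_closedBall h)) _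

lemma contDiff_ext0 {n : WithTop ℕ∞} (hv : ContinuousOn v (closedBall 0 R))
    (h0 : ∀ x ∈ sphere (0:E3) R, v x = 0)
    (hε : 0 < ε) (hh : ∀ x ∈ ball (0:E3) R, |v x| ≤ ε → h x = 0) (hd : ContDiffOn ℝ n h (ball 0 R)) :
    ContDiff ℝ n (ext0 R h) := by
  rw [contDiff_iff_contDiffAt]
  intro x
  by_cases hx : x ∈ ball (0:E3) R
  · exact ((hd x hx).contDiffAt (isOpen_ball.mem_nhds hx)).congr_of_eventuallyEq (ext0_eventuallyEq hx)
  · exact contDiffAt_const.congr_of_eventuallyEq (ext0_eventually_zero hv h0 hε hh hx)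

lemma fderiv_ext0 (hv : ContinuousOn v (closedBall 0 R)) (h0 : ∀ x ∈ sphere (0:E3) R, v x = 0)
    (hε : 0 < ε) (hh : ∀ x ∈ ball (0:E3) R, |v x| ≤ ε → h x = 0) (x : E3) :
    fderiv ℝ (ext0 R h) x = (ball (0:E3) R).indicator (fderiv ℝ h) x := by
  by_cases hx : x ∈ ball (0:E3) R
  · rw [indicator_of_mem hx, (ext0_eventuallyEq hx).fderiv_eq]
  · rw [indicator_of_notMem hx, (ext0_eventually_zero hv h0 hε hh hx).fderiv_eq, fderiv_fun_const]
    rfl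

/-- The integral over the ball of a partial derivative of a function vanishing near the boundary. -/
lemma integral_fderiv_eq_zero (hv : ContinuousOn v (closedBall 0 R))
    (h0 : ∀ x ∈ sphere (0:E3) R, v x = 0) (hε : 0 < ε)
    (hh : ∀ x ∈ ball (0:E3) R, |v x| ≤ ε → h x = 0) (hd : ContDiffOn ℝ 1 h (ball 0 R)) (e : E3) :
    IntegrableOn (fun x => fderiv ℝ h x e) (ball 0 R) ∧ ∫ x in ball (0:E3) R, fderiv ℝ h x e = 0 := by
  have hc := contDiff_ext0 hv h0 hε hh hd
  have hs : HasCompactSupport (ext0 R h) := HasCompactSupport.intro (isCompact_closedBall (0:E3) R)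
    fun x hx => ext0_of_le (by
      rw [mem_closedBall, dist_zero_right, not_le] at hx; exact hx.le)
  have i1 : Integrable (ext0 R h) := hc.continuous.integrable_of_hasCompactSupport hs
  have hs' : HasCompactSupport fun x => fderiv ℝ (ext0 R h) x e := hs.fderiv_apply (𝕜 := ℝ) e
  have i2 : Integrable fun x => fderiv ℝ (ext0 R h) x e :=
    ((hc.continuous_fderiv one_ne_zero).clm_apply continuous_const).integrable_of_hasCompactSupport hs'
  have key := integral_mul_fderiv_eq_neg_fderiv_mul_of_integrable (μ := (volume : Measure E3))
    (f := fun _ => (1:ℝ)) (g := ext0 R h) (v := e)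
    (by simp) (by simpa using i2) (by simpa using i1)
    (fun x _ => differentiableAt_const _) fun x _ => hc.differentiable one_ne_zero x
  have e1 : (fun x => fderiv ℝ (ext0 R h) x e) = (ball (0:E3) R).indicator fun x => fderiv ℝ h x e := by
    ext x
    rw [fderiv_ext0 hv h0 hε hh]
    by_cases hx : x ∈ ball (0:E3) R <;> simp [indicator, hx]
  rw [e1] at i2
  refine ⟨(integrable_indicator_iff measurableSet_ball).1 i2, ?_⟩
  rw [← integral_indicator measurableSet_ball, ← e1]
  simpa using key

end

lemma norm_fderiv_sq (v : E3 → ℝ) (x : E3) :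
    ‖fderiv ℝ v x‖ ^ 2 = ∑ i : Fin 3, (fderiv ℝ v x (EuclideanSpace.single i 1)) ^ 2 := by
  rw [← (InnerProductSpace.toDual ℝ E3).symm.norm_map, EuclideanSpace.real_norm_sq_eq]
  refine Finset.sum_congr rfl fun i _ => ?_
  rw [← InnerProductSpace.toDual_symm_apply (𝕜 := ℝ) (y := fderiv ℝ v x), EuclideanSpace.inner_single_right]
  simp

lemma norm_gradient (v : E3 → ℝ) (x : E3) : ‖gradient v x‖ = ‖fderiv ℝ v x‖ := by
  unfold gradient
  exact (InnerProductSpace.toDual ℝ E3).symm.norm_map _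

/-- The gradient of a `C¹` function vanishes almost everywhere on its zero set. -/
lemma ae_fderiv_eq_zero {U : Set E3} (hU : IsOpen U) {v : E3 → ℝ} (hv : ContDiffOn ℝ 1 v U) :
    ∀ᵐ x ∂(volume.restrict U), v x = 0 → fderiv ℝ v x = 0 := by
  rw [ae_restrict_iff' hU.measurableSet, ae_iff]
  refine measure_null_of_locally_null _ fun x hx => ?_
  have hxU : x ∈ U := by
    by_contra hc
    exact hx fun h => absurd h hc
  obtain ⟨K, t, ht, hL⟩ := ((hv x hxU).contDiffAt (hU.mem_nhds hxU)).exists_lipschitzOnWith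
  obtain ⟨s, hst, hs, hxs⟩ := _root_.mem_nhds_iff.1 ht
  have hA : LipschitzOnWith K (fun y => |v y|) s := by
    have := (lipschitzWith_one_norm (E := ℝ)).comp_lipschitzOnWith (hL.mono hst)
    simpa [Function.comp_def] using this
  have hae := hA.ae_differentiableWithinAt hs.measurableSet (μ := volume)
  rw [ae_restrict_iff' hs.measurableSet, ae_iff] at hae
  refine ⟨s ∩ {y | ¬ (y ∈ U → v y = 0 → fderiv ℝ v y = 0)},
    inter_mem (mem_nhdsWithin_of_mem_nhds (hs.mem_nhds hxs)) self_mem_nhdsWithin, ?_⟩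
  refine measure_mono_null ?_ hae
  rintro y ⟨hys, hy⟩ hd
  refine hy fun hyU hv0 => ?_
  have hdy : DifferentiableAt ℝ (fun y => |v y|) y := (hd hys).differentiableAt (hs.mem_nhds hys)
  have hm : IsLocalMin (fun y => |v y|) y := Eventually.of_forall fun z => by simp [hv0]
  have h0 := hm.fderiv_eq_zero
  have hl : HasFDerivAt (fun y => |v y|) (0 : E3 →L[ℝ] ℝ) y := h0 ▸ hdy.hasFDerivAt
  rw [hasFDerivAt_iff_isLittleO] at hl
  refine HasFDerivAt.fderiv ?_
  rw [hasFDerivAt_iff_isLittleO]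
  refine (Asymptotics.isLittleO_norm_left.1 (hl.congr_left fun z => ?_))
  simp [hv0]

lemma integral_prim_identity {R : ℝ} {v f : E3 → ℝ} (hv : ContDiffOn ℝ 2 v (ball 0 R))
    (hc : ContinuousOn v (closedBall 0 R)) (h0 : ∀ x ∈ sphere (0:E3) R, v x = 0)
    (hf : ContinuousOn f (closedBall 0 R)) (he : ∀ x ∈ ball (0:E3) R, -lap v x = f x)
    {k : ℝ → ℝ} {ε : ℝ} (hk : Continuous k) (hε : 0 < ε)
    (h : ∀ s, |s| ≤ ε → k s = 0) :
    IntegrableOn (fun x => k (v x) * ‖fderiv ℝ v x‖ ^ 2) (ball 0 R) ∧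
    ∫ x in ball (0:E3) R, k (v x) * ‖fderiv ℝ v x‖ ^ 2 = ∫ x in ball (0:E3) R, prim k (v x) * f x := by
  have hd1 : ContDiffOn ℝ 1 (fderiv ℝ v) (ball 0 R) := hv.fderiv_of_isOpen isOpen_ball (by norm_num)
  have hv1 : ContDiffOn ℝ 1 v (ball 0 R) := hv.of_le (by norm_num)
  have hp : ContDiffOn ℝ 1 (fun x => prim k (v x)) (ball 0 R) := (contDiff_prim hk).comp_contDiffOn hv1
  have hg : ∀ i : Fin 3, ContDiffOn ℝ 1 (fun x => fderiv ℝ v x (EuclideanSpace.single i 1)) (ball 0 R) :=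
    fun i => hd1.clm_apply contDiffOn_const
  have key := fun i : Fin 3 => integral_fderiv_eq_zero hc h0 hε
    (h := fun x => prim k (v x) * fderiv ℝ v x (EuclideanSpace.single i 1))
    (fun x _ hx => by simp [prim_eq_zero h hx]) (hp.mul (hg i)) (EuclideanSpace.single i 1)
  have e : ∀ x ∈ ball (0:E3) R, ∑ i : Fin 3,
      fderiv ℝ (fun x => prim k (v x) * fderiv ℝ v x (EuclideanSpace.single i 1)) x
        (EuclideanSpace.single i 1) = k (v x) * ‖fderiv ℝ v x‖ ^ 2 - prim k (v x) * f x := by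
    intro x hx
    have dv : DifferentiableAt ℝ v x := (hv1.differentiableOn one_ne_zero x hx).differentiableAt
      (isOpen_ball.mem_nhds hx)
    have dp : HasFDerivAt (fun x => prim k (v x)) (k (v x) • fderiv ℝ v x) x :=
      (hasDerivAt_prim hk (v x)).comp_hasFDerivAt x dv.hasFDerivAt
    have dg : ∀ i : Fin 3, DifferentiableAt ℝ (fun x => fderiv ℝ v x (EuclideanSpace.single i 1)) x :=
      fun i => ((hg i).differentiableOn one_ne_zero x hx).differentiableAt (isOpen_ball.mem_nhds hx)
    rw [norm_fderiv_sq, ← he x hx, lap, mul_neg, sub_neg_eq_add, Finset.mul_sum, Finset.mul_sum,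
      ← Finset.sum_add_distrib]
    refine Finset.sum_congr rfl fun i _ => ?_
    have := dp.fun_mul (dg i).hasFDerivAt
    rw [this.fderiv]
    simp only [_root_.add_apply, _root_.smul_apply, smul_eq_mul]
    ring
  have hpf : IntegrableOn (fun x => prim k (v x) * f x) (ball 0 R) :=
    (((contDiff_prim hk).continuous.comp_continuousOn hc).mul hf |>.integrableOn_compact
      (isCompact_closedBall _ _)).mono_set ball_subset_closedBall
  have hsum : IntegrableOn (fun x => k (v x) * ‖fderiv ℝ v x‖ ^ 2 - prim k (v x) * f x) (ball 0 R) :=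
    (integrableOn_congr_fun e measurableSet_ball).1 (integrable_finsetSum _ fun i _ => (key i).1)
  have hI : IntegrableOn (fun x => k (v x) * ‖fderiv ℝ v x‖ ^ 2) (ball 0 R) := by
    exact (hsum.add hpf).congr (Eventually.of_forall fun x => by simp)
  refine ⟨hI, ?_⟩
  rw [← sub_eq_zero, ← integral_sub hI hpf, ← setIntegral_congr_fun measurableSet_ball e,
    integral_finsetSum _ fun i _ => (key i).1]
  exact Finset.sum_eq_zero fun i _ => (key i).2

/-- Finite Dirichlet energy and the energy identity for classical solutions of `-Δv = f`. -/
theorem energy_identity {R : ℝ} {v f : E3 → ℝ} (hv : ContDiffOn ℝ 2 v (ball 0 R))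
    (hc : ContinuousOn v (closedBall 0 R)) (h0 : ∀ x ∈ sphere (0:E3) R, v x = 0)
    (hf : ContinuousOn f (closedBall 0 R)) (he : ∀ x ∈ ball (0:E3) R, -lap v x = f x) :
    IntegrableOn (fun x => ‖fderiv ℝ v x‖ ^ 2) (ball 0 R) ∧
    ∫ x in ball (0:E3) R, ‖fderiv ℝ v x‖ ^ 2 = ∫ x in ball (0:E3) R, v x * f x := by
  have key := fun n => integral_prim_identity hv hc h0 hf he (continuous_kcut (eps n)) (eps_pos n)
    fun s hs => kcut_eq_zero (eps_pos n) hs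
  have hvf : ContinuousOn (fun x => v x * f x) (closedBall 0 R) := hc.mul hf
  have hI : IntegrableOn (fun x => v x * f x) (ball 0 R) :=
    (hvf.integrableOn_compact (isCompact_closedBall _ _)).mono_set ball_subset_closedBall
  have lim1 : Tendsto (fun n => ∫ x in ball (0:E3) R, prim (kcut (eps n)) (v x) * f x) atTop
      (𝓝 (∫ x in ball (0:E3) R, v x * f x)) := by
    refine tendsto_integral_of_dominated_convergence (fun x => ‖v x * f x‖) (fun n => ?_) hI.norm
      (fun n => Eventually.of_forall fun x => ?_)
      (Eventually.of_forall fun x => (tendsto_prim_kcut (v x)).mul_const _)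
    · exact (((contDiff_prim (continuous_kcut (eps n))).continuous.comp_continuousOn hc).mul hf
        |>.mono ball_subset_closedBall).aestronglyMeasurable measurableSet_ball
    · rw [norm_mul, norm_mul]
      exact mul_le_mul_of_nonneg_right (abs_prim_le (abs_kcut_le _) _) (norm_nonneg _)
  have hD : ContinuousOn (fun x => ‖fderiv ℝ v x‖ ^ 2) (ball 0 R) :=
    ((hv.continuousOn_fderiv_of_isOpen isOpen_ball (by norm_num)).norm).pow 2
  have hlim : ∀ᵐ x ∂(volume.restrict (ball (0:E3) R)),
      Tendsto (fun n => kcut (eps n) (v x) * ‖fderiv ℝ v x‖ ^ 2) atTop (𝓝 (‖fderiv ℝ v x‖ ^ 2)) := by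
    filter_upwards [ae_fderiv_eq_zero isOpen_ball (hv.of_le (by norm_num))] with x hx
    by_cases h : v x = 0
    · simp [hx h]
    · simpa using (tendsto_kcut h).mul_const (‖fderiv ℝ v x‖ ^ 2)
  have hm := hD.aestronglyMeasurable (μ := volume) measurableSet_ball
  have hint : IntegrableOn (fun x => ‖fderiv ℝ v x‖ ^ 2) (ball 0 R) := by
    refine ⟨hm, ?_⟩
    rw [hasFiniteIntegral_iff_ofReal (Eventually.of_forall fun x => by positivity)]
    have e1 : ∀ n, ∫⁻ x in ball (0:E3) R, ENNReal.ofReal (kcut (eps n) (v x) * ‖fderiv ℝ v x‖ ^ 2)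
        = ENNReal.ofReal (∫ x in ball (0:E3) R, prim (kcut (eps n)) (v x) * f x) := by
      intro n
      rw [← (key n).2, ofReal_integral_eq_lintegral_ofReal (key n).1]
      exact Eventually.of_forall fun x => mul_nonneg (kcut_nonneg _ _) (by positivity)
    have e2 := (ENNReal.continuous_ofReal.tendsto _).comp lim1
    have e3 : ∫⁻ x in ball (0:E3) R, ENNReal.ofReal (‖fderiv ℝ v x‖ ^ 2) ≤
        liminf (fun n => ∫⁻ x in ball (0:E3) R,
          ENNReal.ofReal (kcut (eps n) (v x) * ‖fderiv ℝ v x‖ ^ 2)) atTop := by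
      refine le_trans (le_of_eq (lintegral_congr_ae ?_)) (lintegral_liminf_le'
        fun n => (key n).1.aestronglyMeasurable.aemeasurable.ennreal_ofReal)
      filter_upwards [hlim] with x hx
      exact (((ENNReal.continuous_ofReal.tendsto _).comp hx).liminf_eq).symm
    simp only [e1] at e3
    exact (e3.trans_eq e2.liminf_eq).trans_lt ENNReal.ofReal_lt_top
  refine ⟨hint, tendsto_nhds_unique ?_ lim1⟩
  simp only [← (key _).2]
  refine tendsto_integral_of_dominated_convergence (fun x => ‖fderiv ℝ v x‖ ^ 2)
    (fun n => (key n).1.aestronglyMeasurable) hint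
    (fun n => Eventually.of_forall fun x => ?_) hlim
  rw [norm_mul, norm_pow, norm_norm]
  exact mul_le_of_le_one_left (by positivity) (abs_kcut_le _ _)

lemma ext0_cutoff {R : ℝ} {v : E3 → ℝ} (hv : ContDiffOn ℝ 2 v (ball 0 R)) (hc : ContinuousOn v (closedBall 0 R))
    (h0 : ∀ x ∈ sphere (0:E3) R, v x = 0)
    (hi : IntegrableOn (fun x => ‖fderiv ℝ v x‖ ^ 2) (ball 0 R)) (n : ℕ) :
    ContDiff ℝ 1 (ext0 R fun x => prim (scut (eps n)) (v x)) ∧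
    (∀ x, 0 ≤ ext0 R (fun x => prim (scut (eps n)) (v x)) x) ∧
    (∀ x, |ext0 R (fun x => prim (scut (eps n)) (v x)) x| ≤ |ext0 R v x|) ∧
    ∫ x, ‖fderiv ℝ (ext0 R fun x => prim (scut (eps n)) (v x)) x‖ ^ 2 ≤
      ∫ x in ball (0:E3) R, ‖fderiv ℝ v x‖ ^ 2 := by
  have hv1 : ContDiffOn ℝ 1 v (ball 0 R) := hv.of_le (by norm_num)
  have hk := continuous_scut (eps n)
  have hz : ∀ s, |s| ≤ eps n → scut (eps n) s = 0 := fun s hs => scut_eq_zero (eps_pos n) hs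
  have hh : ∀ x ∈ ball (0:E3) R, |v x| ≤ eps n → prim (scut (eps n)) (v x) = 0 :=
    fun x _ hx => prim_eq_zero hz hx
  refine ⟨contDiff_ext0 hc h0 (eps_pos n) hh ((contDiff_prim hk).comp_contDiffOn hv1), fun x => ?_,
    fun x => ?_, ?_⟩
  · exact indicator_nonneg (fun x _ => prim_scut_nonneg (eps_pos n) _) x
  · by_cases hx : x ∈ ball (0:E3) R
    · rw [ext0_of_mem hx, ext0_of_mem hx]
      exact abs_prim_le (abs_scut_le _) _
    · simp [ext0, hx]
  · have e : (fun x => ‖fderiv ℝ (ext0 R fun x => prim (scut (eps n)) (v x)) x‖ ^ 2) =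
        (ball (0:E3) R).indicator fun x => scut (eps n) (v x) ^ 2 * ‖fderiv ℝ v x‖ ^ 2 := by
      ext x
      rw [fderiv_ext0 hc h0 (eps_pos n) hh]
      by_cases hx : x ∈ ball (0:E3) R
      · rw [indicator_of_mem hx, indicator_of_mem hx]
        have dv : DifferentiableAt ℝ v x := (hv1.differentiableOn one_ne_zero x hx).differentiableAt
          (isOpen_ball.mem_nhds hx)
        have dp : HasFDerivAt (fun x => prim (scut (eps n)) (v x)) (scut (eps n) (v x) • fderiv ℝ v x) x :=
          (hasDerivAt_prim hk (v x)).comp_hasFDerivAt x dv.hasFDerivAt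
        rw [dp.fderiv, norm_smul, mul_pow, Real.norm_eq_abs, sq_abs]
      · simp [hx]
    rw [e, integral_indicator measurableSet_ball]
    refine integral_mono_of_nonneg (Eventually.of_forall fun x => by positivity) hi
      (Eventually.of_forall fun x => ?_)
    exact mul_le_of_le_one_left (by positivity) ((sq_le_one_iff_abs_le_one _).2 (abs_scut_le _ _))

lemma tendsto_ext0_cutoff (R : ℝ) (v : E3 → ℝ) (x : E3) :
    Tendsto (fun n => ext0 R (fun x => prim (scut (eps n)) (v x)) x) atTop (𝓝 (ext0 R (fun x => |v x|) x)) := by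
  by_cases hx : x ∈ ball (0:E3) R
  · simp only [ext0_of_mem hx]
    exact tendsto_prim_scut _
  · simp [ext0, hx]

lemma exists_bound_ext0 {R : ℝ} {v : E3 → ℝ} (hc : ContinuousOn v (closedBall 0 R)) :
    ∃ C, 0 ≤ C ∧ ∀ x, |ext0 R v x| ≤ C := by
  obtain ⟨C, hC⟩ := (isCompact_closedBall (0:E3) R).exists_bound_of_continuousOn hc
  refine ⟨max C 0, le_max_right _ _, fun x => ?_⟩
  by_cases hx : x ∈ ball (0:E3) R
  · rw [ext0_of_mem hx]
    exact (hC x (ball_subset_closedBall hx)).trans (le_max_left _ _)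
  · simp [ext0, hx]

/-- The sharp inequality for functions with zero boundary values. -/
lemma sharp_ineq {R lam M : ℝ} (hR : 0 < R) (hM : 0 < M)
    (H : ∀ w g z k : ℝ → ℝ, Adm R w g → Adm R z k → PP R w z ≤ M * √(Nn R lam w g) ^ 5 * √(En R k))
    {v ψ : E3 → ℝ} (hv : ContDiffOn ℝ 2 v (ball 0 R)) (hψ : ContDiffOn ℝ 2 ψ (ball 0 R))
    (cv : ContinuousOn v (closedBall 0 R)) (cψ : ContinuousOn ψ (closedBall 0 R))
    (v0 : ∀ x ∈ sphere (0:E3) R, v x = 0) (ψ0 : ∀ x ∈ sphere (0:E3) R, ψ x = 0)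
    (iv : IntegrableOn (fun x => ‖fderiv ℝ v x‖ ^ 2) (ball 0 R))
    (iψ : IntegrableOn (fun x => ‖fderiv ℝ ψ x‖ ^ 2) (ball 0 R)) :
    ∫ x in ball (0:E3) R, |v x| ^ 5 * |ψ x| ≤ M / kap ^ 2 *
      √((∫ x in ball (0:E3) R, ‖fderiv ℝ v x‖ ^ 2) - lam * ∫ x in ball (0:E3) R, v x ^ 2) ^ 5 *
      √(∫ x in ball (0:E3) R, ‖fderiv ℝ ψ x‖ ^ 2) := by
  have A := ext0_cutoff hv cv v0 iv
  have B := ext0_cutoff hψ cψ ψ0 iψ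
  obtain ⟨C, hC0, hC⟩ := exists_bound_ext0 cv
  obtain ⟨D, hD0, hD⟩ := exists_bound_ext0 cψ
  have bA := fun n x => ((A n).2.2.1 x).trans (hC x)
  have bB := fun n x => ((B n).2.2.1 x).trans (hD x)
  set a : ℕ → E3 → ℝ := fun n => ext0 R fun x => prim (scut (eps n)) (v x) with ha
  set b : ℕ → E3 → ℝ := fun n => ext0 R fun x => prim (scut (eps n)) (ψ x) with hb
  have oA : ∀ n x, R ≤ ‖x‖ → a n x = 0 := fun n x hx => ext0_of_le hx
  have oB : ∀ n x, R ≤ ‖x‖ → b n x = 0 := fun n x hx => ext0_of_le hx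
  have lA : ∀ x, Tendsto (fun n => a n x) atTop (𝓝 (ext0 R (fun x => |v x|) x)) := tendsto_ext0_cutoff R v
  have lB : ∀ x, Tendsto (fun n => b n x) atTop (𝓝 (ext0 R (fun x => |ψ x|) x)) := tendsto_ext0_cutoff R ψ
  have t1 : Tendsto (fun n => ∫ x, a n x ^ 5 * b n x) atTop
      (𝓝 (∫ x, ext0 R (fun x => |v x|) x ^ 5 * ext0 R (fun x => |ψ x|) x)) := by
    refine tendsto_integral_of_zero_outside (R := R) (C := C ^ 5 * D)
      (fun n => ((A n).1.continuous.pow 5).mul (B n).1.continuous)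
      (fun n x hx => by rw [oB n x hx, mul_zero]) (fun n x _ => ?_)
      fun x => ((lA x).pow 5).mul (lB x)
    rw [abs_mul, abs_pow]
    exact mul_le_mul (pow_le_pow_left₀ (abs_nonneg _) (bA n x) 5) (bB n x) (abs_nonneg _) (by positivity)
  have t2 : Tendsto (fun n => ∫ x, a n x ^ 2) atTop (𝓝 (∫ x, ext0 R (fun x => |v x|) x ^ 2)) := by
    refine tendsto_integral_of_zero_outside (R := R) (C := C ^ 2)
      (fun n => (A n).1.continuous.pow 2)
      (fun n x hx => by rw [oA n x hx]; norm_num) (fun n x _ => ?_)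
      fun x => (lA x).pow 2
    rw [abs_pow]
    exact pow_le_pow_left₀ (abs_nonneg _) (bA n x) 2
  have e1 : ∫ x, ext0 R (fun x => |v x|) x ^ 5 * ext0 R (fun x => |ψ x|) x =
      ∫ x in ball (0:E3) R, |v x| ^ 5 * |ψ x| := by
    rw [← integral_indicator measurableSet_ball]
    congr 1; ext x
    by_cases hx : x ∈ ball (0:E3) R <;> simp [ext0, indicator, hx]
  have e2 : ∫ x, ext0 R (fun x => |v x|) x ^ 2 = ∫ x in ball (0:E3) R, v x ^ 2 := by
    rw [← integral_indicator measurableSet_ball]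
    congr 1; ext x
    by_cases hx : x ∈ ball (0:E3) R <;> simp [ext0, indicator, hx]
  rw [e1] at t1
  rw [e2] at t2
  have t3 : Tendsto (fun n => M / kap ^ 2 *
      √((∫ x in ball (0:E3) R, ‖fderiv ℝ v x‖ ^ 2) - lam * ∫ x, a n x ^ 2) ^ 5 *
      √(∫ x in ball (0:E3) R, ‖fderiv ℝ ψ x‖ ^ 2)) atTop (𝓝 (M / kap ^ 2 *
      √((∫ x in ball (0:E3) R, ‖fderiv ℝ v x‖ ^ 2) - lam * ∫ x in ball (0:E3) R, v x ^ 2) ^ 5 *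
      √(∫ x in ball (0:E3) R, ‖fderiv ℝ ψ x‖ ^ 2))) :=
    (((Real.continuous_sqrt.tendsto _).comp ((t2.const_mul lam).const_sub _) |>.pow 5).const_mul _).mul_const _
  refine le_of_tendsto_of_tendsto' t1 t3 fun n => ?_
  refine (smooth_ineq hR hM H (A n).1 (B n).1 (A n).2.1 (B n).2.1 (oA n) (oB n)).trans ?_
  have h1 := (A n).2.2.2
  have h2 := (B n).2.2.2
  have k0 := kap_pos
  gcongr

section
variable {R q lam : ℝ} {v ψ : E3 → ℝ}

/-- The common value of the Nehari identities at a classical solution. -/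
lemma IsSolP.identities (h : IsSolP R q lam v ψ) :
    IntegrableOn (fun x => ‖fderiv ℝ v x‖ ^ 2) (ball 0 R) ∧
    IntegrableOn (fun x => ‖fderiv ℝ ψ x‖ ^ 2) (ball 0 R) ∧
    (∫ x in ball (0:E3) R, ‖fderiv ℝ v x‖ ^ 2) - lam * (∫ x in ball (0:E3) R, v x ^ 2) =
      q * ∫ x in ball (0:E3) R, |v x| ^ 5 * ψ x ∧
    ∫ x in ball (0:E3) R, ‖fderiv ℝ ψ x‖ ^ 2 = q * ∫ x in ball (0:E3) R, |v x| ^ 5 * ψ x := by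
  obtain ⟨hv, hψ, cv, cψ, ev, eψ, v0, ψ0⟩ := h
  have c5 : ContinuousOn (fun x => |v x| ^ 5) (closedBall 0 R) := cv.abs.pow 5
  have I := energy_identity hv cv v0 (f := fun x => lam * v x + q * |v x| ^ 3 * v x * ψ x)
    ((cv.const_smul lam).add (((cv.abs.pow 3).const_smul q |>.mul cv).mul cψ)) ev
  have J := energy_identity hψ cψ ψ0 (f := fun x => q * |v x| ^ 5) (c5.const_smul q) eψ
  have s {f : E3 → ℝ} (hf : ContinuousOn f (closedBall 0 R)) : IntegrableOn f (ball 0 R) :=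
    (hf.integrableOn_compact (isCompact_closedBall _ _)).mono_set ball_subset_closedBall
  have s2 : IntegrableOn (fun x => v x ^ 2) (ball 0 R) := s (cv.pow 2)
  have s5 : IntegrableOn (fun x => |v x| ^ 5 * ψ x) (ball 0 R) := s (c5.mul cψ)
  refine ⟨I.1, J.1, ?_, ?_⟩
  · rw [I.2, sub_eq_iff_eq_add', ← integral_const_mul, ← integral_const_mul,
      ← integral_add (s2.const_mul lam) (s5.const_mul q)]
    refine integral_congr_ae (Eventually.of_forall fun x => ?_)
    have : v x * v x = |v x| ^ 2 := by rw [sq_abs, sq]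
    simp only
    linear_combination (q * |v x| ^ 3 * ψ x) * this
  · rw [J.2, ← integral_const_mul]
    exact integral_congr_ae (Eventually.of_forall fun x => by simp only; ring)

lemma IsSolP.energy_eq (h : IsSolP R q lam v ψ) :
    energyF R q lam v ψ = 2 / 5 * (q * ∫ x in ball (0:E3) R, |v x| ^ 5 * ψ x) := by
  obtain ⟨-, -, h1, h2⟩ := h.identities
  simp only [energyF, norm_gradient]
  linear_combination (1 / 2) * h1 + (1 / 10) * h2

lemma IsSolP.pos (hq : 0 < q) (h : IsSolP R q lam v ψ) (hn : ∃ x ∈ ball (0:E3) R, v x ≠ 0) :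
    0 < q * ∫ x in ball (0:E3) R, |v x| ^ 5 * ψ x := by
  obtain ⟨-, i2, -, h2⟩ := h.identities
  rw [← h2]
  refine lt_of_le_of_ne (integral_nonneg fun x => by positivity) fun hz => ?_
  have hae := (integral_eq_zero_iff_of_nonneg (fun x => by positivity) i2).1 hz.symm
  have hcont : ContinuousOn (fun x => ‖fderiv ℝ ψ x‖ ^ 2) (ball 0 R) :=
    ((h.2.1.continuousOn_fderiv_of_isOpen isOpen_ball (by norm_num)).norm).pow 2
  have heq := Measure.eqOn_open_of_ae_eq hae isOpen_ball hcont continuousOn_const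
  have hD : ∀ x ∈ ball (0:E3) R, fderiv ℝ ψ x = 0 := fun x hx => by
    have := heq hx
    simpa using this
  obtain ⟨x, hx, hvx⟩ := hn
  have hl : lap ψ x = 0 := Finset.sum_eq_zero fun i _ => by
    have : (fun y => fderiv ℝ ψ y (EuclideanSpace.single i 1)) =ᶠ[𝓝 x] fun _ => 0 := by
      filter_upwards [isOpen_ball.mem_nhds hx] with y hy
      rw [hD y hy]; rfl
    rw [this.fderiv_eq, fderiv_fun_const]; rfl
  have := h.2.2.2.2.2.1 x hx
  rw [hl, neg_zero] at this
  have : 0 < q * |v x| ^ 5 := by positivity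
  linarith

lemma IsSolP.lower_bound {M : ℝ} (hR : 0 < R) (hq : 0 < q) (hM : 0 < M)
    (H : ∀ w g z k : ℝ → ℝ, Adm R w g → Adm R z k → PP R w z ≤ M * √(Nn R lam w g) ^ 5 * √(En R k))
    (h : IsSolP R q lam v ψ) (hn : ∃ x ∈ ball (0:E3) R, v x ≠ 0) :
    kap / √(q * M) ≤ q * ∫ x in ball (0:E3) R, |v x| ^ 5 * ψ x := by
  obtain ⟨i1, i2, h1, h2⟩ := h.identities
  have hA := h.pos hq hn
  have key := sharp_ineq hR hM H h.1 h.2.1 h.2.2.1 h.2.2.2.1 h.2.2.2.2.2.2.1 h.2.2.2.2.2.2.2 i1 i2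
  rw [h1, h2] at key
  have s {f : E3 → ℝ} (hf : ContinuousOn f (closedBall 0 R)) : IntegrableOn f (ball 0 R) :=
    (hf.integrableOn_compact (isCompact_closedBall _ _)).mono_set ball_subset_closedBall
  have hle : ∫ x in ball (0:E3) R, |v x| ^ 5 * ψ x ≤ ∫ x in ball (0:E3) R, |v x| ^ 5 * |ψ x| :=
    integral_mono (s ((h.2.2.1.abs.pow 5).mul h.2.2.2.1)) (s ((h.2.2.1.abs.pow 5).mul h.2.2.2.1.abs))
      fun x => mul_le_mul_of_nonneg_left (le_abs_self _) (by positivity)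
  have k0 := kap_pos
  generalize (∫ x in ball (0:E3) R, |v x| ^ 5 * ψ x) = I at *
  have h3 := hle.trans key
  have h4 : √(q * I) ^ 2 = q * I := Real.sq_sqrt hA.le
  have h5 : I ≤ M / kap ^ 2 * (q * I) ^ 3 := by
    refine h3.trans_eq ?_
    rw [← h4]; simp only [Real.sqrt_sq (Real.sqrt_nonneg _)]; ring
  have hI : 0 < I := pos_of_mul_pos_right hA hq.le
  have h6 : kap ^ 2 ≤ (q * M) * (q * I) ^ 2 := by
    have : kap ^ 2 * I ≤ M * (q * I) ^ 3 := by
      rw [div_mul_eq_mul_div, le_div_iff₀ (by positivity)] at h5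
      linarith
    refine le_of_mul_le_mul_right (this.trans_eq ?_) hI
    ring
  rw [div_le_iff₀ (by positivity)]
  refine le_of_sq_le_sq ?_ (by positivity)
  rw [mul_pow, Real.sq_sqrt (by positivity)]
  linarith

end

end

/-- If `λ ∈ (3/10·π²/R², π²/R²)`, problem (P) admits a positive classical solution which is a
ground state: its energy is less than or equal to that of any nontrivial classical solution. -/
theorem existence_ground_state (R q lam : ℝ) (hR : 0 < R) (hq : 0 < q)
    (hlow : 3 / 10 * (π ^ 2 / R ^ 2) < lam) (hhigh : lam < π ^ 2 / R ^ 2) :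
    ∃ u φ : E3 → ℝ, IsSolP R q lam u φ ∧
      (∀ x ∈ ball (0:E3) R, 0 < u x) ∧ (∀ x ∈ ball (0:E3) R, 0 < φ x) ∧
      (∀ v ψ : E3 → ℝ, IsSolP R q lam v ψ → (∃ x ∈ ball (0:E3) R, v x ≠ 0) →
        energyF R q lam u φ ≤ energyF R q lam v ψ) := by
  obtain ⟨M, u, φ, hM, hs, hu, hφ, hI, H⟩ := exists_solution hR hq hlow hhigh
  refine ⟨u, φ, hs, hu, hφ, fun v ψ h hn => ?_⟩
  rw [hs.energy_eq, h.energy_eq, hI]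
  exact mul_le_mul_of_nonneg_left (h.lower_bound hR hq hM H hn) (by norm_num)
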